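/- arXiv:2303.07691 — 11 statements merged into one kernel-verified Lean document; each statement's English description precedes it below -/
import Mathlib

section
/- Let X = ℓ¹ (real absolutely summable sequences) and let j : c₀ → X* be the canonical embedding given by j(b)(f) = ∑_{n} f(n)·b(n) for b ∈ c₀ and f ∈ ℓ¹, and set A = range(j) ⊆ X*. Then: (i) Ienv(A) = A; (ii) the weak*-closure of A is all of X*; and consequently (iii) there is no locally convex topology τ on X* (a topology making X* a locally convex topological vector space over ℝ) such that Ienv(B) equals the τ-closure of conv(B) for every B ⊆ X*. -/
open Filter Topology

noncomputable section

/-- The weak* topology on the dual of `E`: pointwise convergence on `E`. -/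
def wstarTop (E : Type*) [NormedAddCommGroup E] [NormedSpace ℝ E] :
    TopologicalSpace (E →L[ℝ] ℝ) :=
  TopologicalSpace.induced (fun f (x : E) => f x) Pi.topologicalSpace

/-- Weak* closure of a set of functionals. -/
def wstarClosure {E : Type*} [NormedAddCommGroup E] [NormedSpace ℝ E]
    (A : Set (E →L[ℝ] ℝ)) : Set (E →L[ℝ] ℝ) :=
  @closure _ (wstarTop E) A

/-- The (I)-envelope of a set in a dual Banach space. -/
def Ienv {E : Type*} [NormedAddCommGroup E] [NormedSpace ℝ E]
    (A : Set (E →L[ℝ] ℝ)) : Set (E →L[ℝ] ℝ) :=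
  ⋂ (As : ℕ → Set (E →L[ℝ] ℝ)) (_ : A = ⋃ n, As n),
    closure (convexHull ℝ (⋃ n, wstarClosure (convexHull ℝ (As n))))

/-- `B₁(E)`: elements of the bidual that are weak* limits of sequences from `E`. -/
def B1 (E : Type*) [NormedAddCommGroup E] [NormedSpace ℝ E] :
    Set ((E →L[ℝ] ℝ) →L[ℝ] ℝ) :=
  {F | ∃ x : ℕ → E, ∀ ξ : E →L[ℝ] ℝ,
    Tendsto (fun n => ξ (x n)) atTop (𝓝 (F ξ))}

/-- `C(E)`: elements of the bidual lying in the weak* closure of a countable subset of `E`. -/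
def CX (E : Type*) [NormedAddCommGroup E] [NormedSpace ℝ E] :
    Set ((E →L[ℝ] ℝ) →L[ℝ] ℝ) :=
  {F | ∃ C : Set E, C.Countable ∧
    F ∈ wstarClosure ((fun x => NormedSpace.inclusionInDoubleDual ℝ E x) '' C)}

/-- The topology `σ(E*, Y)` for a set `Y` of elements of the bidual. -/
def sigmaTop {E : Type*} [NormedAddCommGroup E] [NormedSpace ℝ E]
    (Y : Set ((E →L[ℝ] ℝ) →L[ℝ] ℝ)) : TopologicalSpace (E →L[ℝ] ℝ) :=
  TopologicalSpace.induced
    (fun f (y : Y) => (y : (E →L[ℝ] ℝ) →L[ℝ] ℝ) f) Pi.topologicalSpace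

end

/-- The real Banach space `ℓ¹` of absolutely summable real sequences. -/
abbrev ellOne : Type := lp (fun _ : ℕ => ℝ) 1

/-- The range of the canonical embedding `j : c₀ → (ℓ¹)*`, `j(b)(f) = ∑ f(n)·b(n)`. -/
def cZeroRange : Set (ellOne →L[ℝ] ℝ) :=
  {g | ∃ b : ℕ → ℝ, Tendsto b atTop (𝓝 0) ∧ ∀ f : ellOne, g f = ∑' n, f n * b n}

noncomputable section

namespace S8

/-- The canonical unit vectors of `ℓ¹`. -/
def e (n : ℕ) : ellOne := lp.single 1 n (1 : ℝ)

lemma norm_e (n : ℕ) : ‖e n‖ = 1 := by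
  unfold e
  rw [lp.norm_single (by norm_num)]; simp

lemma hasSum_rep (g : ellOne →L[ℝ] ℝ) (f : ellOne) :
    HasSum (fun n => f n * g (e n)) (g f) := by
  have h := (lp.hasSum_single (p := 1) (by norm_num) f).mapL g
  convert h using 2 with n
  have : (lp.single 1 n (f n) : ellOne) = (f n) • e n := by
    unfold e
    rw [← lp.single_smul]; simp
  rw [this]; simp

lemma tsum_single (b : ℕ → ℝ) (n : ℕ) : ∑' k, (e n) k * b k = b n := by
  rw [tsum_eq_single n]
  · unfold e; rw [lp.single_apply_self]; simp
  · intro k hk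
    unfold e; rw [lp.single_apply_ne _ _ _ hk]; simp

lemma mem_iff (g : ellOne →L[ℝ] ℝ) :
    g ∈ cZeroRange ↔ Tendsto (fun n => g (e n)) atTop (𝓝 0) := by
  constructor
  · rintro ⟨b, hb, h⟩
    have : (fun n => g (e n)) = b := by
      funext n; rw [h, tsum_single]
    rwa [this]
  · intro h
    exact ⟨_, h, fun f => (hasSum_rep g f).tsum_eq.symm⟩

lemma summable_abs (f : ellOne) : Summable (fun n => |f n|) := by
  have := (memℓp_gen_iff (p := 1) (by norm_num)).1 f.2
  simpa using this

lemma norm_eq (f : ellOne) : ‖f‖ = ∑' n, |f n| := by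
  rw [lp.norm_eq_tsum_rpow (by norm_num)]; simp

lemma bd (f : ellOne) (b : ℕ → ℝ) (hb : ∀ n, |b n| ≤ 1) (n : ℕ) : ‖f n * b n‖ ≤ |f n| := by
  rw [norm_mul, Real.norm_eq_abs, Real.norm_eq_abs]
  exact mul_le_of_le_one_right (abs_nonneg _) (hb n)

lemma summ (f : ellOne) (b : ℕ → ℝ) (hb : ∀ n, |b n| ≤ 1) : Summable (fun n => f n * b n) :=
  Summable.of_norm_bounded (summable_abs f) (bd f b hb)

/-- The functional with bounded coefficients `b`. -/
def T (b : ℕ → ℝ) (hb : ∀ n, |b n| ≤ 1) : ellOne →L[ℝ] ℝ :=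
  LinearMap.mkContinuous
    { toFun := fun f => ∑' n, f n * b n
      map_add' := by
        intro f g
        rw [← (summ f b hb).tsum_add (summ g b hb)]
        congr 1; funext n; simp [add_mul]
      map_smul' := by
        intro c f
        rw [RingHom.id_apply, smul_eq_mul, ← tsum_mul_left]
        congr 1; funext n; simp [mul_assoc] } 1
    (by
      intro f
      rw [one_mul, norm_eq]
      exact tsum_of_norm_bounded (summable_abs f).hasSum (bd f b hb))

lemma T_apply (b : ℕ → ℝ) (hb : ∀ n, |b n| ≤ 1) (f : ellOne) : T b hb f = ∑' n, f n * b n := rfl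

lemma T_e (b : ℕ → ℝ) (hb : ∀ n, |b n| ≤ 1) (n : ℕ) : T b hb (e n) = b n := by
  rw [T_apply, tsum_single]

lemma wcont {E : Type*} [NormedAddCommGroup E] [NormedSpace ℝ E] (x : E) :
    @Continuous _ _ (wstarTop E) _ (fun g : E →L[ℝ] ℝ => g x) := by
  letI := wstarTop E
  exact (continuous_apply x).comp continuous_induced_dom

lemma subset_wstarClosure {E : Type*} [NormedAddCommGroup E] [NormedSpace ℝ E]
    (A : Set (E →L[ℝ] ℝ)) : A ⊆ wstarClosure A :=
  @subset_closure _ (wstarTop E) A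

lemma subset_Ienv {E : Type*} [NormedAddCommGroup E] [NormedSpace ℝ E]
    (A : Set (E →L[ℝ] ℝ)) : A ⊆ Ienv A := by
  intro g hg
  simp only [Ienv, Set.mem_iInter]
  intro As h
  rw [h] at hg
  obtain ⟨n, hn⟩ := Set.mem_iUnion.1 hg
  exact subset_closure (subset_convexHull _ _ (Set.mem_iUnion.2
    ⟨n, subset_wstarClosure _ (subset_convexHull _ _ hn)⟩))

/-- Functionals with coefficients at most `ε` from `N` on. -/
def C (ε : ℝ) (N : ℕ) : Set (ellOne →L[ℝ] ℝ) := {g | ∀ k, N ≤ k → |g (e k)| ≤ ε}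

lemma convex_C (ε : ℝ) (N : ℕ) : Convex ℝ (C ε N) := by
  intro g hg h hh a b ha hb hab k hk
  have h1 := hg k hk
  have h2 := hh k hk
  calc |(a • g + b • h) (e k)| = |a * g (e k) + b * h (e k)| := by simp
    _ ≤ |a * g (e k)| + |b * h (e k)| := abs_add_le _ _
    _ = a * |g (e k)| + b * |h (e k)| := by rw [abs_mul, abs_mul, abs_of_nonneg ha, abs_of_nonneg hb]
    _ ≤ a * ε + b * ε := by gcongr
    _ = ε := by rw [← add_mul, hab, one_mul]

lemma closed_C (ε : ℝ) (N : ℕ) : @IsClosed _ (wstarTop ellOne) (C ε N) := by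
  letI := wstarTop ellOne
  have : C ε N = ⋂ k, ⋂ (_ : N ≤ k), {g | |g (e k)| ≤ ε} := by
    ext g; simp [C]
  rw [this]
  refine isClosed_iInter fun k => isClosed_iInter fun _ => ?_
  exact isClosed_le (wcont (e k)).abs continuous_const

lemma C_mono (ε : ℝ) : Monotone (C ε) := fun _ _ h _ hg k hk => hg k (h.trans hk)

lemma wcl_subset {A B : Set (ellOne →L[ℝ] ℝ)} (h : A ⊆ B)
    (hB : @IsClosed _ (wstarTop ellOne) B) : wstarClosure A ⊆ B := by
  unfold wstarClosure
  exact @closure_minimal (ellOne →L[ℝ] ℝ) (wstarTop ellOne) A B h hB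

lemma part1 : Ienv cZeroRange = cZeroRange := by
  refine Set.Subset.antisymm ?_ (subset_Ienv _)
  intro g hg
  rw [mem_iff, Metric.tendsto_atTop]
  intro ε hε
  simp only [Ienv, Set.mem_iInter] at hg
  have h := hg (fun n => cZeroRange ∩ C (ε / 3) n) (by
    rw [← Set.inter_iUnion]
    refine (Set.inter_eq_left.2 ?_).symm
    intro x hx
    rw [mem_iff, Metric.tendsto_atTop] at hx
    obtain ⟨N, hN⟩ := hx (ε / 3) (by positivity)
    refine Set.mem_iUnion.2 ⟨N, fun k hk => ?_⟩
    simpa using (hN k hk).le)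
  have hsub : convexHull ℝ (⋃ n, wstarClosure (convexHull ℝ (cZeroRange ∩ C (ε / 3) n)))
      ⊆ ⋃ n, C (ε / 3) n := by
    refine convexHull_min ?_ ?_
    · refine Set.iUnion_mono fun n => ?_
      have hs : convexHull ℝ (cZeroRange ∩ C (ε / 3) n) ⊆ C (ε / 3) n :=
        convexHull_min Set.inter_subset_right (convex_C _ _)
      exact wcl_subset hs (closed_C _ _)
    · exact (directed_of_isDirected_le (C_mono _)).convex_iUnion (fun n => convex_C _ n)
  obtain ⟨g', hg', hd⟩ := Metric.mem_closure_iff.1 h (ε / 3) (by positivity)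
  obtain ⟨N, hN⟩ := Set.mem_iUnion.1 (hsub hg')
  refine ⟨N, fun k hk => ?_⟩
  have h1 := hN k hk
  have h2 : |(g - g') (e k)| ≤ ε / 3 := by
    have := (g - g').le_opNorm (e k)
    rw [norm_e, mul_one, ← dist_eq_norm] at this
    exact this.trans hd.le
  have h3 : g (e k) = (g - g') (e k) + g' (e k) := by simp
  rw [dist_zero_right, Real.norm_eq_abs, h3]
  have := abs_add_le ((g - g') (e k)) (g' (e k))
  linarith

lemma add_mem {g h : ellOne →L[ℝ] ℝ} (hg : g ∈ cZeroRange) (hh : h ∈ cZeroRange) :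
    g + h ∈ cZeroRange := by
  rw [mem_iff] at *
  simpa using hg.add hh

lemma smul_mem (c : ℝ) {g : ellOne →L[ℝ] ℝ} (hg : g ∈ cZeroRange) :
    c • g ∈ cZeroRange := by
  rw [mem_iff] at *
  simpa using hg.const_mul c

lemma mem_of_eventually {g : ellOne →L[ℝ] ℝ} (h : ∀ᶠ n in atTop, g (e n) = 0) :
    g ∈ cZeroRange := by
  rw [mem_iff]
  exact tendsto_const_nhds.congr' (h.mono fun n hn => hn.symm)

lemma part2 : wstarClosure cZeroRange = Set.univ := by
  refine Set.eq_univ_of_forall fun g => ?_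
  let G : ℕ → (ellOne →L[ℝ] ℝ) := fun N =>
    ∑ n ∈ Finset.range N, (g (e n)) • lp.evalCLM ℝ (fun _ : ℕ => ℝ) 1 n
  have hG : ∀ N f, G N f = ∑ n ∈ Finset.range N, f n * g (e n) := by
    intro N f
    simp only [G, ContinuousLinearMap.sum_apply, ContinuousLinearMap.smul_apply, smul_eq_mul]
    exact Finset.sum_congr rfl fun n _ => mul_comm _ _
  letI := wstarTop ellOne
  refine mem_closure_of_tendsto (f := G) (b := atTop) ?_ (Eventually.of_forall fun N => ?_)
  · have hi : Topology.IsInducing (fun (f : ellOne →L[ℝ] ℝ) (x : ellOne) => f x) := ⟨rfl⟩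
    rw [hi.tendsto_nhds_iff, tendsto_pi_nhds]
    intro f
    have := (hasSum_rep g f).tendsto_sum_nat
    simpa [Function.comp_def, hG] using this
  · refine mem_of_eventually ?_
    filter_upwards [eventually_ge_atTop N] with k hk
    rw [hG]
    refine Finset.sum_eq_zero fun n hn => ?_
    have : n ≠ k := by have := Finset.mem_range.1 hn; omega
    unfold e; rw [lp.single_apply_ne _ _ _ this]; simp

/-- The compact cube. -/
abbrev K : Type := ℕ → Set.Icc (-1 : ℝ) 1

/-- The cube as a set of functionals. -/
def TK (x : K) : ellOne →L[ℝ] ℝ := T (fun n => (x n : ℝ)) (fun n => abs_le.2 (x n).2)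

lemma TK_e (x : K) (n : ℕ) : TK x (e n) = x n := T_e _ _ _

lemma TK_cont : @Continuous _ _ _ (wstarTop ellOne) TK := by
  letI := wstarTop ellOne
  refine continuous_induced_rng.2 (continuous_pi fun f => ?_)
  change Continuous fun x : K => ∑' n, f n * (x n : ℝ)
  refine continuous_tsum (fun n => by fun_prop) (summable_abs f) fun n x => ?_
  exact bd f (fun n => (x n : ℝ)) (fun n => abs_le.2 (x n).2) n

lemma key (φ : (ellOne →L[ℝ] ℝ) →ₗ[ℝ] ℝ) (hφ : ∀ g ∈ cZeroRange, φ g = 0)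
    (g : ellOne →L[ℝ] ℝ) (hg : 0 < φ g) (hm : ¬ IsMeagre {x : K | φ (TK x) ≤ 0}) :
    ∃ y ∈ Ienv {h : ellOne →L[ℝ] ℝ | φ h ≤ 0}, 0 < φ y := by
  have hg0 : 0 < ‖g‖ := by
    rw [norm_pos_iff]; rintro rfl; simp at hg
  let z : K := fun n => ⟨‖g‖⁻¹ * g (e n), abs_le.1 (by
    rw [abs_mul, abs_of_pos (inv_pos.2 hg0), inv_mul_le_iff₀ hg0]
    simpa [norm_e] using g.le_opNorm (e n))⟩
  have hz : ∀ y : K, (∀ᶠ n in atTop, y n = z n) → φ (TK y) = ‖g‖⁻¹ * φ g := by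
    intro y hy
    have h1 : TK y - ‖g‖⁻¹ • g ∈ cZeroRange := by
      refine mem_of_eventually ?_
      filter_upwards [hy] with n hn
      simp [TK_e, hn, z]
    have h2 := hφ _ h1
    rwa [map_sub, map_smul, sub_eq_zero] at h2
  have hpos : 0 < ‖g‖⁻¹ * φ g := mul_pos (inv_pos.2 hg0) hg
  refine ⟨(1 / 2 : ℝ) • TK z, ?_, ?_⟩
  swap
  · rw [map_smul, hz z (Eventually.of_forall fun _ => rfl), smul_eq_mul]
    positivity
  simp only [Ienv, Set.mem_iInter]
  intro As hAs
  have : ∃ n, ¬ IsNowhereDense (TK ⁻¹' (As n)) := by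
    by_contra hcon
    push Not at hcon
    refine hm ((isMeagre_iUnion fun n => (hcon n).isMeagre).mono ?_)
    intro x hx
    have hx' : TK x ∈ {h : ellOne →L[ℝ] ℝ | φ h ≤ 0} := hx
    rw [hAs] at hx'
    simpa using hx'
  obtain ⟨n, hn⟩ := this
  obtain ⟨x, hx⟩ := Set.nonempty_iff_ne_empty.2 hn
  rw [mem_interior_iff_mem_nhds, nhds_pi, Filter.mem_pi] at hx
  obtain ⟨I, hI, t, ht, hsub⟩ := hx
  obtain ⟨M, hM⟩ := hI.bddAbove
  let y : K := fun k => if k ≤ M then x k else z k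
  have hyc : y ∈ closure (TK ⁻¹' (As n)) := by
    refine hsub fun k hk => ?_
    have : y k = x k := if_pos (hM hk)
    rw [this]
    exact mem_of_mem_nhds (ht k)
  have hyw : TK y ∈ wstarClosure (convexHull ℝ (As n)) := by
    letI := wstarTop ellOne
    exact map_mem_closure TK_cont hyc fun _ h => subset_convexHull _ _ h
  have hyz : φ (TK y) = ‖g‖⁻¹ * φ g := by
    refine hz y ?_
    filter_upwards [eventually_gt_atTop M] with k hk
    exact if_neg (by omega)
  have hh : TK z - TK y ∈ {h : ellOne →L[ℝ] ℝ | φ h ≤ 0} := by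
    have : φ (TK z - TK y) = 0 := by
      rw [map_sub, hyz, hz z (Eventually.of_forall fun _ => rfl), sub_self]
    exact this.le
  rw [hAs] at hh
  obtain ⟨m, hmm⟩ := Set.mem_iUnion.1 hh
  have e1 := subset_convexHull ℝ (⋃ n, wstarClosure (convexHull ℝ (As n)))
    (Set.mem_iUnion.2 ⟨n, hyw⟩)
  have e2 := subset_convexHull ℝ (⋃ n, wstarClosure (convexHull ℝ (As n)))
    (Set.mem_iUnion.2 ⟨m, subset_wstarClosure _ (subset_convexHull _ _ hmm)⟩)
  apply subset_closure
  have := (convex_convexHull ℝ (⋃ n, wstarClosure (convexHull ℝ (As n)))) e1 e2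
    (a := 1 / 2) (b := 1 / 2) (by norm_num) (by norm_num) (by norm_num)
  rwa [← smul_add, add_sub_cancel] at this

lemma key2 (φ : (ellOne →L[ℝ] ℝ) →ₗ[ℝ] ℝ) (hφ : ∀ g ∈ cZeroRange, φ g = 0)
    (g : ellOne →L[ℝ] ℝ) (hg : 0 < φ g)
    (h1 : Ienv {h : ellOne →L[ℝ] ℝ | φ h ≤ 0} ⊆ {h | φ h ≤ 0})
    (h2 : Ienv {h : ellOne →L[ℝ] ℝ | 0 ≤ φ h} ⊆ {h | 0 ≤ φ h}) : False := by
  by_cases hm : IsMeagre {x : K | φ (TK x) ≤ 0}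
  · by_cases hm' : IsMeagre {x : K | (-φ) (TK x) ≤ 0}
    · have hu : IsMeagre (Set.univ : Set K) := by
        refine (hm.union hm').mono ?_
        intro x _
        rcases le_total (φ (TK x)) 0 with h | h
        · exact Or.inl h
        · exact Or.inr (by simpa using h)
      have hd : Dense ((Set.univ : Set K)ᶜ) := dense_of_mem_residual hu
      rw [Set.compl_univ] at hd
      haveI : Nonempty K := ⟨fun _ => ⟨0, by simp⟩⟩
      obtain ⟨x, hx⟩ := hd.nonempty
      exact hx
    · obtain ⟨y, hy, hy'⟩ := key (-φ) (fun g hg => by simp [hφ g hg]) (-g) (by simpa using hg) hm'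
      have : {h : ellOne →L[ℝ] ℝ | (-φ) h ≤ 0} = {h | 0 ≤ φ h} := by
        ext h; simp
      rw [this] at hy
      have := h2 hy
      simp only [Set.mem_setOf_eq] at this
      rw [LinearMap.neg_apply] at hy'
      linarith
  · obtain ⟨y, hy, hy'⟩ := key φ hφ g hg hm
    exact absurd (h1 hy) (not_le.2 hy')

lemma hb {E : Type*} [AddCommGroup E] [Module ℝ E] [TopologicalSpace E]
    [IsTopologicalAddGroup E] [ContinuousSMul ℝ E] [LocallyConvexSpace ℝ E]
    (t : Submodule ℝ E) (ht : IsClosed (t : Set E)) (x : E) (hx : x ∉ t) :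
    ∃ φ : E →ₗ[ℝ] ℝ, Continuous φ ∧ (∀ b ∈ t, φ b = 0) ∧ 0 < φ x := by
  obtain ⟨f, u, h1, h2⟩ := geometric_hahn_banach_point_closed t.convex ht hx
  have hu : u < 0 := by simpa using h2 0 t.zero_mem
  refine ⟨((-f : E →L[ℝ] ℝ) : E →ₗ[ℝ] ℝ), (-f).continuous, fun b hbt => ?_, ?_⟩
  · by_contra hne
    have hne' : f b ≠ 0 := by
      intro h; apply hne; simp [h]
    have := h2 ((u / f b) • b) (t.smul_mem _ hbt)
    rw [map_smul, smul_eq_mul, div_mul_cancel₀ _ hne'] at this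
    exact lt_irrefl _ this
  · have : f x < 0 := h1.trans hu
    simpa using this

/-- `c₀` as a subspace. -/
def cz : Submodule ℝ (ellOne →L[ℝ] ℝ) where
  carrier := cZeroRange
  add_mem' := add_mem
  zero_mem' := mem_of_eventually (by simp)
  smul_mem' := fun c _ h => smul_mem c h

lemma part3 (τ : TopologicalSpace (ellOne →L[ℝ] ℝ))
    (i1 : @IsTopologicalAddGroup (ellOne →L[ℝ] ℝ) τ _)
    (i2 : @ContinuousSMul ℝ (ellOne →L[ℝ] ℝ) _ _ τ)
    (i3 : @LocallyConvexSpace ℝ (ellOne →L[ℝ] ℝ) _ _ _ _ τ)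
    (H : ∀ B : Set (ellOne →L[ℝ] ℝ), Ienv B = @closure _ τ (convexHull ℝ B)) : False := by
  have hcl : @IsClosed _ τ (cz : Set (ellOne →L[ℝ] ℝ)) := by
    have : (cz : Set (ellOne →L[ℝ] ℝ)) = @closure _ τ (convexHull ℝ cZeroRange) := by
      rw [← H, part1]; rfl
    rw [this]
    exact @isClosed_closure _ τ _
  let g : ellOne →L[ℝ] ℝ := T (fun _ => 1) (by simp)
  have hg : g ∉ cz := by
    intro h
    have h' : g ∈ cZeroRange := h
    rw [mem_iff] at h'
    simp only [g, T_e] at h'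
    exact one_ne_zero (tendsto_nhds_unique tendsto_const_nhds h')
  obtain ⟨φ, hc, h0, hp⟩ := @hb (ellOne →L[ℝ] ℝ) _ _ τ i1 i2 i3 cz hcl g hg
  refine key2 φ h0 g hp ?_ ?_
  · rw [H, (convex_halfSpace_le φ.isLinear 0).convexHull_eq]
    exact ((@isClosed_le _ _ _ _ _ τ _ _ hc (@continuous_const _ _ τ _ 0)).closure_eq).subset
  · rw [H, (convex_halfSpace_ge φ.isLinear 0).convexHull_eq]
    exact ((@isClosed_le _ _ _ _ _ τ _ _ (@continuous_const _ _ τ _ 0) hc).closure_eq).subset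

end S8
end

theorem stmt8 :
    Ienv cZeroRange = cZeroRange ∧
    wstarClosure cZeroRange = Set.univ ∧
    ¬ ∃ τ : TopologicalSpace (ellOne →L[ℝ] ℝ),
        @IsTopologicalAddGroup (ellOne →L[ℝ] ℝ) τ _ ∧
        @ContinuousSMul ℝ (ellOne →L[ℝ] ℝ) _ _ τ ∧
        @LocallyConvexSpace ℝ (ellOne →L[ℝ] ℝ) _ _ _ _ τ ∧
        ∀ B : Set (ellOne →L[ℝ] ℝ), Ienv B = @closure _ τ (convexHull ℝ B) := by
  exact ⟨S8.part1, S8.part2, fun ⟨τ, i1, i2, i3, H⟩ => S8.part3 τ i1 i2 i3 H⟩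
end

section
/- Let X be a real Banach space that is weakly sequentially complete, i.e., every sequence (x_n) in X such that (f(x_n)) converges in ℝ for each f ∈ X* converges weakly to some element of X. The following are equivalent: (1) there is a locally convex topology τ on X* (making X* a locally convex topological vector space over ℝ) such that Ienv(A) equals the τ-closure of conv(A) for every A ⊆ X*; (2) every norm-closed norm-separable linear subspace of X* is weak*-closed; (3) X is reflexive. -/
open Filter Topology

section helpers
variable {X : Type*} [NormedAddCommGroup X] [NormedSpace ℝ X]

lemma ws_cont (x : X) : @Continuous _ _ (wstarTop X) _ (fun f : X →L[ℝ] ℝ => f x) :=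
  WeakDual.eval_continuous (𝕜 := ℝ) (E := X) x

lemma ws_closure_le {C : Set (X →L[ℝ] ℝ)} {x : X} {u : ℝ} (h : ∀ f ∈ C, f x ≤ u) :
    ∀ f ∈ wstarClosure C, f x ≤ u := by
  intro f hf
  have hc : @IsClosed _ (wstarTop X) {f : X →L[ℝ] ℝ | f x ≤ u} :=
    @IsClosed.preimage _ _ (wstarTop X) _ _ (ws_cont x) _ isClosed_Iic
  have h2 : wstarClosure C ⊆ {f : X →L[ℝ] ℝ | f x ≤ u} :=
    @closure_minimal _ (wstarTop X) _ _ (fun f hf => h f hf) hc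
  exact h2 hf

lemma ws_ball_compact (r : ℝ) :
    @IsCompact _ (wstarTop X) (Metric.closedBall (0 : X →L[ℝ] ℝ) r) :=
  WeakDual.isCompact_closedBall (𝕜 := ℝ) (E := X) 0 r

lemma ws_ball_closed (a : X →L[ℝ] ℝ) (r : ℝ) :
    @IsClosed _ (wstarTop X) (Metric.closedBall a r) :=
  WeakDual.isClosed_closedBall (𝕜 := ℝ) (E := X) a r

lemma ws_closure_convex {C : Set (X →L[ℝ] ℝ)} (hC : Convex ℝ C) : Convex ℝ (wstarClosure C) :=
  Convex.closure (E := WeakDual ℝ X) hC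

lemma ws_sep {M : Set (X →L[ℝ] ℝ)} (hM : Convex ℝ M) (hc : @IsClosed _ (wstarTop X) M)
    {g : X →L[ℝ] ℝ} (hg : g ∉ M) : ∃ (x : X) (u : ℝ), (∀ f ∈ M, f x < u) ∧ u < g x := by
  have : LocallyConvexSpace ℝ (WeakDual ℝ X) := 
    inferInstanceAs (LocallyConvexSpace ℝ (WeakBilin (topDualPairing ℝ X)))
  obtain ⟨φ, u, h1, h2⟩ := @geometric_hahn_banach_closed_point (WeakDual ℝ X)
    inferInstance WeakDual.instAddCommGroup _ M g _ _ _ hM hc hg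
  obtain ⟨x, hx⟩ := LinearMap.dualEmbedding_surjective (topDualPairing ℝ X) φ
  have : ∀ f : X →L[ℝ] ℝ, φ f = f x := fun f => by rw [← hx]; rfl
  refine ⟨x, u, fun f hf => ?_, ?_⟩
  · rw [← this]; exact h1 f hf
  · rw [← this]; exact h2

lemma compact_convexJoin {E : Type*} [AddCommGroup E] [Module ℝ E] [TopologicalSpace E]
    [IsTopologicalAddGroup E] [ContinuousSMul ℝ E] {K L : Set E} (hK : IsCompact K)
    (hL : IsCompact L) : IsCompact (convexJoin ℝ K L) := by
  have h := ((hK.prod hL).prod (isCompact_Icc (a := (0:ℝ)) (b := 1))).image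
    (f := fun p : (E × E) × ℝ => (1 - p.2) • p.1.1 + p.2 • p.1.2) (by fun_prop)
  convert h using 1
  ext z
  simp only [mem_convexJoin, segment_eq_image, Set.mem_image, Prod.exists, Set.mem_prod]
  constructor
  · rintro ⟨a, ha, b, hb, t, ht, rfl⟩
    exact ⟨a, b, t, ⟨⟨ha, hb⟩, ht⟩, rfl⟩
  · rintro ⟨a, b, t, ⟨⟨ha, hb⟩, ht⟩, rfl⟩
    exact ⟨a, ha, b, hb, t, ht, rfl⟩

lemma finite_join {E : Type*} [AddCommGroup E] [Module ℝ E] [TopologicalSpace E]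
    [IsTopologicalAddGroup E] [ContinuousSMul ℝ E] {D : Set E} (hD : Convex ℝ D) {d : E}
    (hd : d ∈ D) (K : ℕ → Set E) (hK : ∀ n, IsCompact (K n)) (hK' : ∀ n, Convex ℝ (K n))
    (hKD : ∀ n, K n ⊆ D) (n : ℕ) :
    ∃ M : Set E, IsCompact M ∧ Convex ℝ M ∧ M ⊆ D ∧ d ∈ M ∧ ∀ k < n, K k ⊆ M := by
  induction n with
  | zero => exact ⟨{d}, isCompact_singleton, convex_singleton d, by simpa using hd, rfl, by simp⟩
  | succ n ih =>
    obtain ⟨M, h1, h2, h3, h4, h5⟩ := ih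
    rcases (K n).eq_empty_or_nonempty with he | hne
    · refine ⟨M, h1, h2, h3, h4, fun k hk => ?_⟩
      rcases Nat.lt_succ_iff_lt_or_eq.1 hk with h | rfl
      · exact h5 k h
      · simp [he]
    · refine ⟨convexJoin ℝ M (K n), compact_convexJoin h1 (hK n), h2.convexJoin (hK' n),
        convexJoin_subset h3 (hKD n) hD, subset_convexJoin_left hne h4, fun k hk => ?_⟩
      rcases Nat.lt_succ_iff_lt_or_eq.1 hk with h | rfl
      · exact (h5 k h).trans (subset_convexJoin_left hne)
      · exact subset_convexJoin_right ⟨d, h4⟩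

lemma ws_compact_closed {M : Set (X →L[ℝ] ℝ)} (hc : @IsCompact _ (wstarTop X) M) :
    @IsClosed _ (wstarTop X) M := IsCompact.isClosed (X := WeakDual ℝ X) hc

lemma ws_closure_closed (C : Set (X →L[ℝ] ℝ)) : @IsClosed _ (wstarTop X) (wstarClosure C) :=
  @isClosed_closure _ (wstarTop X) C

lemma ws_subset_closure (C : Set (X →L[ℝ] ℝ)) : C ⊆ wstarClosure C :=
  @subset_closure _ (wstarTop X) C

lemma ws_closure_min {C D : Set (X →L[ℝ] ℝ)} (h : C ⊆ D) (hD : @IsClosed _ (wstarTop X) D) :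
    wstarClosure C ⊆ D :=
  @closure_minimal _ (wstarTop X) _ _ h hD

lemma ws_closure_mono {C D : Set (X →L[ℝ] ℝ)} (h : C ⊆ D) : wstarClosure C ⊆ wstarClosure D :=
  @closure_mono _ (wstarTop X) _ _ h

/-- Mazur in the reflexive case. -/
lemma refl_mazur (hr : Function.Surjective (NormedSpace.inclusionInDoubleDual ℝ X))
    {C : Set (X →L[ℝ] ℝ)} (hC : Convex ℝ C) : wstarClosure C ⊆ closure C := by
  intro f hf
  by_contra hcon
  obtain ⟨Φ, u, h1, h2⟩ := geometric_hahn_banach_closed_point hC.closure isClosed_closure hcon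
  obtain ⟨x, rfl⟩ := hr Φ
  have := ws_closure_le (C := C) (x := x) (u := u)
    (fun g hg => (h1 g (subset_closure hg)).le) f hf
  exact absurd h2 (not_lt.2 this)

lemma closure_conv_sub_Ienv (A : Set (X →L[ℝ] ℝ)) : closure (convexHull ℝ A) ⊆ Ienv A := by
  refine Set.subset_iInter₂ fun As hAs => closure_mono (convexHull_mono ?_)
  rw [hAs]
  exact Set.iUnion_mono fun n => (subset_convexHull ℝ _).trans
    (@subset_closure _ (wstarTop X) _)

lemma Ienv_refl (hr : Function.Surjective (NormedSpace.inclusionInDoubleDual ℝ X))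
    (A : Set (X →L[ℝ] ℝ)) : Ienv A = closure (convexHull ℝ A) := by
  refine Set.Subset.antisymm ?_ (closure_conv_sub_Ienv A)
  refine (Set.iInter₂_subset (fun _ => A) (by simp [Set.iUnion_const])).trans ?_
  rw [Set.iUnion_const]
  refine closure_minimal (convexHull_min (refl_mazur hr (convex_convexHull ℝ A)) ?_)
    isClosed_closure
  exact (convex_convexHull ℝ A).closure

open scoped Pointwise in
lemma Ienv_sep (Y : Submodule ℝ (X →L[ℝ] ℝ)) (hY : IsClosed (Y : Set (X →L[ℝ] ℝ)))
    (hs : TopologicalSpace.IsSeparable (Y : Set (X →L[ℝ] ℝ))) : Ienv (Y : Set (X →L[ℝ] ℝ)) ⊆ Y := by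
  intro f hf
  rw [← hY.closure_eq]
  rw [Metric.mem_closure_iff]
  intro ε hε
  obtain ⟨c, hc, hYc⟩ := hs
  have hcne : c.Nonempty := by
    by_contra h
    rw [Set.not_nonempty_iff_eq_empty] at h
    subst h
    simpa using hYc Y.zero_mem
  obtain ⟨y, rfl⟩ := hc.exists_eq_range hcne
  have h1 := Set.mem_iInter₂.1 hf (fun n => (Y : Set (X →L[ℝ] ℝ)) ∩ Metric.closedBall (y n) (ε/8)) (by
    rw [← Set.inter_iUnion]
    refine (Set.inter_eq_left.2 fun g hg => ?_).symm
    obtain ⟨b, ⟨n, rfl⟩, hb⟩ := Metric.mem_closure_iff.1 (hYc hg) (ε/8) (by positivity)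
    exact Set.mem_iUnion.2 ⟨n, hb.le⟩)
  have hconv : Convex ℝ ((Y : Set (X →L[ℝ] ℝ)) + Metric.closedBall (0 : X →L[ℝ] ℝ) (ε/4)) :=
    Y.convex.add (convex_closedBall _ _)
  have h2 : (⋃ n, wstarClosure (convexHull ℝ ((Y : Set (X →L[ℝ] ℝ)) ∩ Metric.closedBall (y n) (ε/8))))
      ⊆ (Y : Set (X →L[ℝ] ℝ)) + Metric.closedBall (0 : X →L[ℝ] ℝ) (ε/4) := by
    refine Set.iUnion_subset fun n => ?_
    rcases ((Y : Set (X →L[ℝ] ℝ)) ∩ Metric.closedBall (y n) (ε/8)).eq_empty_or_nonempty with he | ⟨z, hz, hz'⟩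
    · rw [he, convexHull_empty, wstarClosure, @closure_empty _ (wstarTop X)]
      exact Set.empty_subset _
    · intro g hg
      have h4 : wstarClosure (convexHull ℝ ((Y : Set (X →L[ℝ] ℝ)) ∩ Metric.closedBall (y n) (ε/8)))
          ⊆ Metric.closedBall (y n) (ε/8) :=
        @closure_minimal _ (wstarTop X) _ _
          (convexHull_min Set.inter_subset_right (convex_closedBall _ _)) (ws_ball_closed _ _)
      have h3 := h4 hg
      refine ⟨z, hz, g - z, ?_, by simp⟩
      rw [mem_closedBall_zero_iff, ← dist_eq_norm]
      have := dist_triangle_right g z (y n)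
      rw [Metric.mem_closedBall] at h3 hz'
      linarith
  obtain ⟨b, hb, hfb⟩ := Metric.mem_closure_iff.1 h1 (ε/4) (by positivity)
  obtain ⟨z, hz, w, hw, rfl⟩ := convexHull_min h2 hconv hb
  refine ⟨z, hz, ?_⟩
  have := dist_triangle f (z + w) z
  rw [mem_closedBall_zero_iff] at hw
  have h5 : dist (z + w) z = ‖w‖ := by rw [dist_eq_norm]; simp
  linarith


lemma key_B1 (F : (X →L[ℝ] ℝ) →ₗ[ℝ] ℝ)
    (hF : Ienv (LinearMap.ker F : Set (X →L[ℝ] ℝ)) ⊆ LinearMap.ker F) :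
    ∃ z : ℕ → X, ∀ f : X →L[ℝ] ℝ, Tendsto (fun n => f (z n)) atTop (𝓝 (F f)) := by
  by_cases h0 : F = 0
  · exact ⟨fun _ => 0, fun f => by simp [h0]⟩
  obtain ⟨g0, hg0⟩ : ∃ g0, F g0 ≠ 0 := by
    by_contra! h
    exact h0 (LinearMap.ext h)
  obtain ⟨g, hg⟩ : ∃ g, F g = 1 := ⟨(F g0)⁻¹ • g0, by simp [hg0]⟩
  have hgI : g ∉ Ienv (LinearMap.ker F : Set (X →L[ℝ] ℝ)) := fun h => by
    have := hF h
    simp [hg] at this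
  simp only [Ienv, Set.mem_iInter, not_forall] at hgI
  obtain ⟨As, hAs, hgc⟩ := hgI
  obtain ⟨Φ, u, h1, h2⟩ := geometric_hahn_banach_closed_point
    (convex_convexHull ℝ (⋃ n, wstarClosure (convexHull ℝ (As n)))).closure isClosed_closure hgc
  have h3 : ∀ n, ∀ f ∈ wstarClosure (convexHull ℝ (As n)), Φ f < u := fun n f hf =>
    h1 f (subset_closure (subset_convexHull ℝ _ (Set.mem_iUnion.2 ⟨n, hf⟩)))
  have hD : Convex ℝ {f | Φ f < u} := convex_halfSpace_lt Φ.isLinear u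
  have h0D : (0 : X →L[ℝ] ℝ) ∈ {f | Φ f < u} := by
    have : (0 : X →L[ℝ] ℝ) ∈ (LinearMap.ker F : Set (X →L[ℝ] ℝ)) := by simp
    rw [hAs] at this
    obtain ⟨n, hn⟩ := Set.mem_iUnion.1 this
    exact h3 n 0 (ws_subset_closure _ (subset_convexHull ℝ _ hn))
  have hz : ∀ n : ℕ, ∃ z : X, g z = 1 ∧ ∀ k < n, ∀ f ∈ As k, ‖f‖ ≤ n → f z < 1 := by
    intro n
    obtain ⟨M, hM1, hM2, hM3, hM4, hM5⟩ := finite_join (E := WeakDual ℝ X)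
      (D := {f : X →L[ℝ] ℝ | Φ f < u}) hD (d := (0 : X →L[ℝ] ℝ)) h0D
      (fun k => wstarClosure (convexHull ℝ (As k ∩ Metric.closedBall (0 : X →L[ℝ] ℝ) n)))
      (fun k => by
        have hs : wstarClosure (convexHull ℝ (As k ∩ Metric.closedBall (0 : X →L[ℝ] ℝ) n))
          ⊆ Metric.closedBall (0 : X →L[ℝ] ℝ) n :=
          ws_closure_min (convexHull_min Set.inter_subset_right (convex_closedBall _ _))
            (ws_ball_closed _ _)
        exact @IsCompact.of_isClosed_subset _ (wstarTop X) _ _ (ws_ball_compact (X := X) n)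
          (ws_closure_closed _) hs)
      (fun k => ws_closure_convex (convex_convexHull ℝ _))
      (fun k f hf => h3 k f (ws_closure_mono (convexHull_mono Set.inter_subset_left) hf)) n
    have hgM : g ∉ M := fun h => lt_asymm h2 (hM3 h)
    obtain ⟨x, v, hx1, hx2⟩ := ws_sep (X := X) hM2 (ws_compact_closed hM1) hgM
    have hv : 0 < v := hx1 0 hM4
    have hgx : 0 < g x := hv.trans hx2
    refine ⟨(g x)⁻¹ • x, by simp [hgx.ne'], fun k hk f hf hfn => ?_⟩
    have hfM : f ∈ M := hM5 k hk (ws_subset_closure _ (subset_convexHull ℝ _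
      ⟨hf, by simpa using hfn⟩))
    have := (hx1 f hfM).trans hx2
    rw [map_smul, smul_eq_mul, inv_mul_lt_iff₀ hgx]
    simpa using this
  choose z hz1 hz2 using hz
  have hev : ∀ f : X →L[ℝ] ℝ, F f = 0 → ∀ᶠ n in atTop, f (z n) < 1 := by
    intro f hf
    have hf' : f ∈ (LinearMap.ker F : Set (X →L[ℝ] ℝ)) := hf
    rw [hAs] at hf'
    obtain ⟨k, hk⟩ := Set.mem_iUnion.1 hf'
    obtain ⟨m, hm⟩ := exists_nat_ge ‖f‖
    filter_upwards [eventually_ge_atTop (max (k+1) m)] with n hn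
    refine hz2 n k (by have := le_max_left (k+1) m; omega) f hk (hm.trans ?_)
    exact_mod_cast (le_max_right (k+1) m).trans hn
  have hker : ∀ f : X →L[ℝ] ℝ, F f = 0 → Tendsto (fun n => f (z n)) atTop (𝓝 0) := by
    intro f hf
    rw [Metric.tendsto_nhds]
    intro ε hε
    filter_upwards [hev (ε⁻¹ • f) (by simp [hf]), hev (-(ε⁻¹ • f)) (by simp [hf])] with n hn1 hn2
    simp only [neg_apply, smul_apply, smul_eq_mul] at hn1 hn2
    rw [← mul_neg] at hn2
    rw [inv_mul_lt_iff₀ hε] at hn1 hn2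
    rw [Real.dist_0_eq_abs, abs_lt]
    constructor <;> linarith
  refine ⟨z, fun f => ?_⟩
  have := (hker (f - F f • g) (by simp [hg])).add_const (F f)
  simpa [hz1] using this

lemma one_two
    (hwsc : ∀ x : ℕ → X,
      (∀ f : X →L[ℝ] ℝ, ∃ l : ℝ, Tendsto (fun n => f (x n)) atTop (𝓝 l)) →
      ∃ y : X, ∀ f : X →L[ℝ] ℝ, Tendsto (fun n => f (x n)) atTop (𝓝 (f y)))
    (Y : Submodule ℝ (X →L[ℝ] ℝ)) (hY : IsClosed (Y : Set (X →L[ℝ] ℝ)))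
    (hs : TopologicalSpace.IsSeparable (Y : Set (X →L[ℝ] ℝ)))
    (τ : TopologicalSpace (X →L[ℝ] ℝ)) (h1 : @IsTopologicalAddGroup (X →L[ℝ] ℝ) τ _)
    (h2 : @ContinuousSMul ℝ (X →L[ℝ] ℝ) _ _ τ)
    (h3 : @LocallyConvexSpace ℝ (X →L[ℝ] ℝ) _ _ _ _ τ)
    (h4 : ∀ A : Set (X →L[ℝ] ℝ), Ienv A = @closure _ τ (convexHull ℝ A))
    :
    @IsClosed _ (wstarTop X) (Y : Set (X →L[ℝ] ℝ)) := by
  have hYc : @closure _ τ (Y : Set (X →L[ℝ] ℝ)) ⊆ Y := by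
    have := h4 Y
    rw [Y.convex.convexHull_eq] at this
    rw [← this]
    exact Ienv_sep Y hY hs
  have hYτ : @IsClosed _ τ (Y : Set (X →L[ℝ] ℝ)) := (@closure_subset_iff_isClosed _ τ _).1 hYc
  rw [← @closure_subset_iff_isClosed _ (wstarTop X)]
  intro f hf
  by_contra hfY
  obtain ⟨F, u, hF1, hF2⟩ := @geometric_hahn_banach_point_closed _ τ _ _ _ _ h1 h2 h3
    Y.convex hYτ hfY
  have hFY : ∀ g ∈ Y, F g = 0 := by
    intro g hg
    by_contra hne
    have := hF2 ((u / F g) • g) (Y.smul_mem _ hg)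
    rw [map_smul, smul_eq_mul, div_mul_cancel₀ _ hne] at this
    exact lt_irrefl _ this
  have hu : u < 0 := by simpa using hF2 0 Y.zero_mem
  let F' : (X →L[ℝ] ℝ) →ₗ[ℝ] ℝ := F.toLinearMap
  have hker : Ienv (LinearMap.ker F' : Set (X →L[ℝ] ℝ)) ⊆ LinearMap.ker F' := by
    rw [h4, (LinearMap.ker F').convex.convexHull_eq]
    have hc : @IsClosed _ τ (LinearMap.ker F' : Set (X →L[ℝ] ℝ)) :=
      @IsClosed.preimage _ _ τ _ _ F.cont _ (isClosed_singleton (x := (0:ℝ)))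
    exact (@closure_subset_iff_isClosed _ τ _).2 hc
  obtain ⟨z, hz⟩ := key_B1 F' hker
  obtain ⟨y, hy⟩ := hwsc z fun f => ⟨_, hz f⟩
  have hFy : ∀ f : X →L[ℝ] ℝ, F' f = f y := fun f => tendsto_nhds_unique (hz f) (hy f)
  have hle := ws_closure_le (C := (Y : Set (X →L[ℝ] ℝ))) (x := -y) (u := 0) (fun g hg => by
    have h := hFY g hg
    have h' := hFy g
    change F g = g y at h'
    rw [map_neg, ← h', h]; simp) f hf
  have h' := hFy f
  change F f = f y at h'
  rw [map_neg, ← h'] at hle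
  linarith

lemma exists_cluster {E : Type*} [TopologicalSpace E] {K : Set E} (hK : IsCompact K)
    (f : ℕ → E) (hf : ∀ n, f n ∈ K) : ∃ φ ∈ K, ∀ n, φ ∈ closure (f '' Set.Ici n) := by
  obtain ⟨φ, h1, h2⟩ := hK (f := map f atTop) (by
    rw [le_principal_iff]; exact Filter.mem_map.2 (Filter.univ_mem' hf))
  refine ⟨φ, h1, fun n => ?_⟩
  rw [mem_closure_iff_clusterPt]
  exact h2.mono (le_principal_iff.2 (image_mem_map (Ici_mem_atTop n)))

lemma goldstine (F : (X →L[ℝ] ℝ) →L[ℝ] ℝ) (s : Finset (X →L[ℝ] ℝ)) {ε : ℝ} (hε : 0 < ε) :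
    ∃ x : X, ‖x‖ ≤ ‖F‖ + 1 ∧ ∀ h ∈ s, |h x - F h| < ε := by
  set R := ‖F‖ + 1 with hR
  have hRpos : 0 < R := by positivity
  set C : Set ((X →L[ℝ] ℝ) →L[ℝ] ℝ) :=
    (NormedSpace.inclusionInDoubleDual ℝ X) '' Metric.closedBall 0 R with hC
  have hCc : Convex ℝ C :=
    (convex_closedBall (0 : X) R).linear_image (NormedSpace.inclusionInDoubleDual ℝ X).toLinearMap
  have hF : F ∈ wstarClosure C := by
    by_contra hcon
    obtain ⟨h, u, h1, h2⟩ := ws_sep (ws_closure_convex hCc) (ws_closure_closed C) hcon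
    have h3 : ∀ x : X, ‖x‖ ≤ R → h x < u := fun x hx =>
      h1 _ (ws_subset_closure C ⟨x, by simpa using hx, rfl⟩)
    have hu : 0 < u := by simpa using h3 0 (by simpa using hRpos.le)
    have hn : ‖h‖ ≤ u / R := by
      refine ContinuousLinearMap.opNorm_le_of_unit_norm (by positivity) fun x hx => ?_
      have ha := h3 (R • x) (by rw [norm_smul, hx, Real.norm_of_nonneg hRpos.le, mul_one])
      have hb := h3 (-(R • x)) (by rw [norm_neg, norm_smul, hx, Real.norm_of_nonneg hRpos.le, mul_one])
      rw [map_neg] at hb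
      rw [map_smul, smul_eq_mul] at ha hb
      rw [Real.norm_eq_abs, le_div_iff₀ hRpos, ← abs_of_pos hRpos, ← abs_mul, abs_le]
      rw [mul_comm]
      constructor <;> linarith
    have h4 : F h ≤ ‖F‖ * ‖h‖ := (le_abs_self _).trans (F.le_opNorm h)
    have h5 : ‖F‖ * ‖h‖ ≤ R * (u / R) := by
      gcongr
      linarith
    rw [mul_div_cancel₀ _ hRpos.ne'] at h5
    linarith
  have hopen : @IsOpen _ (wstarTop (X →L[ℝ] ℝ))
      (⋂ h ∈ s, {G : (X →L[ℝ] ℝ) →L[ℝ] ℝ | |G h - F h| < ε}) := by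
    refine @isOpen_biInter_finset _ _ (wstarTop (X →L[ℝ] ℝ)) _ _ fun h _ => ?_
    have hO : IsOpen {r : ℝ | |r - F h| < ε} := isOpen_lt (by fun_prop) continuous_const
    exact @IsOpen.preimage _ _ (wstarTop (X →L[ℝ] ℝ)) _ _ (ws_cont (X := X →L[ℝ] ℝ) h) _ hO
  obtain ⟨G, hG1, ⟨x, hx, rfl⟩⟩ := (@mem_closure_iff _ (wstarTop (X →L[ℝ] ℝ)) _ _).1 hF _ hopen
    (by simp [hε])
  refine ⟨x, by simpa using hx, fun h hh => ?_⟩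
  exact Set.mem_iInter₂.1 hG1 h hh

lemma ext_small {V : Type*} [NormedAddCommGroup V] [NormedSpace ℝ V] (F : V →L[ℝ] ℝ)
    (N : Submodule ℝ V) {c : ℝ} (hc : 0 ≤ c) (h : ∀ f ∈ N, ‖f‖ ≤ 1 → F f ≤ c) :
    ∃ G : V →L[ℝ] ℝ, (∀ f ∈ N, G f = F f) ∧ dist (F - G) F ≤ c := by
  let H : StrongDual ℝ N := F.comp N.subtypeL
  have hnorm : ‖H‖ ≤ c := by
    refine ContinuousLinearMap.opNorm_le_of_unit_norm hc fun f hf => ?_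
    have hf' : ‖(f : V)‖ = 1 := hf
    have h1 := h f f.2 hf'.le
    have h2 := h (-f) (N.neg_mem f.2) (by rw [norm_neg]; exact hf'.le)
    rw [map_neg] at h2
    change |F f| ≤ c
    rw [abs_le]
    constructor <;> linarith
  obtain ⟨G, hG1, hG2⟩ := exists_extension_norm_eq N H
  refine ⟨G, fun f hf => hG1 ⟨f, hf⟩, ?_⟩
  rw [dist_eq_norm, sub_sub_cancel_left, norm_neg, hG2]
  exact hnorm

lemma annih [CompleteSpace X] (F : (X →L[ℝ] ℝ) →L[ℝ] ℝ)
    (hF : F ∉ Set.range (NormedSpace.inclusionInDoubleDual ℝ X)) :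
    ∃ d > 0, ∀ s : Finset X, ∃ f : X →L[ℝ] ℝ, ‖f‖ ≤ 1 ∧ d ≤ F f ∧ ∀ x ∈ s, f x = 0 := by
  have hiso : Isometry (NormedSpace.inclusionInDoubleDual ℝ X) :=
    (NormedSpace.inclusionInDoubleDualLi ℝ (E := X)).isometry
  have hcl : IsClosed (Set.range (NormedSpace.inclusionInDoubleDual ℝ X)) :=
    hiso.isClosedEmbedding.isClosed_range
  obtain ⟨d, hd, hball⟩ := Metric.isOpen_iff.1 hcl.isOpen_compl F hF
  refine ⟨d / 2, by positivity, fun s => ?_⟩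
  by_contra! hcon
  let L : s → ((X →L[ℝ] ℝ) →ₗ[ℝ] ℝ) := fun x =>
    (NormedSpace.inclusionInDoubleDual ℝ X x.1).toLinearMap
  let N : Submodule ℝ (X →L[ℝ] ℝ) := ⨅ i, LinearMap.ker (L i)
  have hN : ∀ f, f ∈ N ↔ ∀ x ∈ s, f x = 0 := by
    intro f
    simp only [N, Submodule.mem_iInf, LinearMap.mem_ker]
    exact ⟨fun h x hx => h ⟨x, hx⟩, fun h x => h x.1 x.2⟩
  have hlt : ∀ f ∈ N, ‖f‖ ≤ 1 → F f < d / 2 := by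
    intro f hf h1
    by_contra! h2
    obtain ⟨x, hx, hne⟩ := hcon f h1 h2
    exact hne ((hN f).1 hf x hx)
  obtain ⟨G, hG1, hG2⟩ := ext_small F N (half_pos hd).le fun f hf h1 => (hlt f hf h1).le
  have hspan : (F - G).toLinearMap ∈ Submodule.span ℝ (Set.range L) := by
    refine mem_span_of_iInf_ker_le_ker fun f hf => ?_
    have := hG1 f hf
    rw [LinearMap.mem_ker]
    change F f - G f = 0
    rw [this]; simp
  have hle : Submodule.span ℝ (Set.range L) ≤ LinearMap.range
      ((ContinuousLinearMap.coeLM ℝ : ((X →L[ℝ] ℝ) →L[ℝ] ℝ) →ₗ[ℝ] _) ∘ₗ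
        (NormedSpace.inclusionInDoubleDual ℝ X).toLinearMap) := by
    rw [Submodule.span_le]
    rintro _ ⟨x, rfl⟩
    exact ⟨x.1, rfl⟩
  obtain ⟨x, hx⟩ := hle hspan
  have hx' : NormedSpace.inclusionInDoubleDual ℝ X x = F - G := by
    ext f
    exact LinearMap.congr_fun hx f
  have hmem : NormedSpace.inclusionInDoubleDual ℝ X x ∈ Metric.ball F d := by
    rw [hx', Metric.mem_ball]
    exact hG2.trans_lt (half_lt_self hd)
  exact hball hmem ⟨x, rfl⟩

lemma two_three [CompleteSpace X]
    (h2 : ∀ Y : Submodule ℝ (X →L[ℝ] ℝ), IsClosed (Y : Set (X →L[ℝ] ℝ)) →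
          TopologicalSpace.IsSeparable (Y : Set (X →L[ℝ] ℝ)) →
          @IsClosed _ (wstarTop X) (Y : Set (X →L[ℝ] ℝ))) :
    Function.Surjective (NormedSpace.inclusionInDoubleDual ℝ X) := by
  classical
  intro F
  by_contra hF
  obtain ⟨d, hd, hann⟩ := annih F hF
  obtain ⟨p, hp1, hp2⟩ := exists_seq_of_forall_finset_exists
    (α := (X →L[ℝ] ℝ) × X × ℕ)
    (fun q => ‖q.1‖ ≤ 1 ∧ d ≤ F q.1 ∧ ‖q.2.1‖ ≤ ‖F‖ + 1)
    (fun q r => r.1 q.2.1 = 0 ∧ q.2.2 < r.2.2 ∧ |q.1 r.2.1 - F q.1| < 1 / ((r.2.2 : ℝ) + 1))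
    (by
      intro s _
      let k := s.sup (fun q => q.2.2) + 1
      obtain ⟨f, hf1, hf2, hf3⟩ := hann (s.image fun q => q.2.1)
      obtain ⟨x, hx1, hx2⟩ := goldstine F (s.image fun q => q.1)
        (ε := 1 / ((k : ℝ) + 1)) (by positivity)
      refine ⟨(f, x, k), ⟨hf1, hf2, hx1⟩, fun q hq => ⟨?_, ?_, ?_⟩⟩
      · exact hf3 _ (Finset.mem_image_of_mem _ hq)
      · exact Nat.lt_succ_of_le (Finset.le_sup (f := fun q => q.2.2) hq)
      · exact hx2 _ (Finset.mem_image_of_mem (fun q => q.1) hq))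
  set f : ℕ → (X →L[ℝ] ℝ) := fun n => (p n).1 with hf
  set x : ℕ → X := fun n => (p n).2.1 with hx
  have hfn : ∀ n, ‖f n‖ ≤ 1 := fun n => (hp1 n).1
  have hfd : ∀ n, d ≤ F (f n) := fun n => (hp1 n).2.1
  have hxn : ∀ n, ‖x n‖ ≤ ‖F‖ + 1 := fun n => (hp1 n).2.2
  have hfx : ∀ m n, m < n → f n (x m) = 0 := fun m n h => (hp2 m n h).1
  have hk : StrictMono fun n => (p n).2.2 := fun m n h => (hp2 m n h).2.1
  have hap : ∀ m n, m < n → |f m (x n) - F (f m)| < 1 / ((n : ℝ) + 1) := by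
    intro m n h
    refine (hp2 m n h).2.2.trans_le ?_
    have : n ≤ (p n).2.2 := hk.id_le n
    have : (n : ℝ) ≤ ((p n).2.2 : ℝ) := by exact_mod_cast this
    gcongr
  -- the submodule on which `x n → F`
  let T : Submodule ℝ (X →L[ℝ] ℝ) :=
    { carrier := {h | Tendsto (fun n => h (x n)) atTop (𝓝 (F h))}
      add_mem' := fun {a b} ha hb => by
        simp only [Set.mem_ofPred_eq] at ha hb ⊢
        simpa using ha.add hb
      zero_mem' := by simp
      smul_mem' := fun c a ha => by
        simp only [Set.mem_ofPred_eq] at ha ⊢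
        simpa using ha.const_mul c }
  have hTc : IsClosed (T : Set (X →L[ℝ] ℝ)) := by
    rw [← closure_subset_iff_isClosed]
    intro h hh
    change Tendsto (fun n => h (x n)) atTop (𝓝 (F h))
    rw [Metric.tendsto_nhds]
    intro ε hε
    set R := 2 * ‖F‖ + 1 with hR
    have hRp : 0 < R := by positivity
    obtain ⟨g, hg, hgd⟩ := Metric.mem_closure_iff.1 hh (ε / 2 / R) (by positivity)
    have hg' : Tendsto (fun n => g (x n)) atTop (𝓝 (F g)) := hg
    filter_upwards [Metric.tendsto_nhds.1 hg' (ε / 2) (by positivity)] with n hn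
    rw [Real.dist_eq] at hn ⊢
    rw [dist_eq_norm, lt_div_iff₀ hRp] at hgd
    have e1 : |(h - g) (x n)| ≤ ‖h - g‖ * (‖F‖ + 1) :=
      ((h - g).le_opNorm (x n)).trans (by gcongr; exact hxn n)
    have e2 : |F (h - g)| ≤ ‖F‖ * ‖h - g‖ := F.le_opNorm _
    have e3 : h (x n) - F h = (h - g) (x n) + (g (x n) - F g) - F (h - g) := by
      simp only [sub_apply, map_sub]; ring
    have e4 : ‖h - g‖ * R = ‖h - g‖ * (‖F‖ + 1) + ‖F‖ * ‖h - g‖ := by rw [hR]; ring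
    rw [e3]
    have e5 := abs_sub ((h - g) (x n) + (g (x n) - F g)) (F (h - g))
    have e6 := abs_add_le ((h - g) (x n)) (g (x n) - F g)
    linarith
  have hfT : ∀ m, f m ∈ T := by
    intro m
    change Tendsto (fun n => f m (x n)) atTop (𝓝 (F (f m)))
    rw [tendsto_iff_dist_tendsto_zero]
    refine squeeze_zero' (Eventually.of_forall fun _ => dist_nonneg) ?_
      tendsto_one_div_add_atTop_nhds_zero_nat
    filter_upwards [eventually_gt_atTop m] with n hn
    exact (hap m n hn).le
  let Y : Submodule ℝ (X →L[ℝ] ℝ) := (Submodule.span ℝ (Set.range f)).topologicalClosure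
  have hYc : IsClosed (Y : Set (X →L[ℝ] ℝ)) := Submodule.isClosed_topologicalClosure _
  have hYs : TopologicalSpace.IsSeparable (Y : Set (X →L[ℝ] ℝ)) :=
    ((Set.countable_range f).isSeparable.span (R := ℝ)).closure
  have hfY : ∀ n, f n ∈ Y := fun n =>
    Submodule.le_topologicalClosure _ (Submodule.subset_span ⟨n, rfl⟩)
  have hYT : Y ≤ T := Submodule.topologicalClosure_minimal _
    (Submodule.span_le.2 (by rintro _ ⟨n, rfl⟩; exact hfT n)) hTc
  -- `F` is given by a point of `X` on `Y`
  let Z : Submodule ℝ (X →L[ℝ] ℝ) := Y ⊓ LinearMap.ker F.toLinearMap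
  have hZc : IsClosed (Z : Set (X →L[ℝ] ℝ)) := by
    have : IsClosed (LinearMap.ker F.toLinearMap : Set (X →L[ℝ] ℝ)) := F.isClosed_ker
    exact hYc.inter this
  have hZw := h2 Z hZc (hYs.mono Set.inter_subset_left)
  have hf0 : f 0 ∉ (Z : Set (X →L[ℝ] ℝ)) := fun h => by
    have h' : F (f 0) = 0 := h.2
    have := hfd 0
    linarith
  obtain ⟨w, u, hw1, hw2⟩ := ws_sep Z.convex hZw hf0
  have hu : 0 < u := by simpa using hw1 0 Z.zero_mem
  have hZw0 : ∀ g ∈ Z, g w = 0 := by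
    intro g hg
    by_contra hne
    have := hw1 ((u / g w) • g) (Z.smul_mem _ hg)
    rw [smul_apply, smul_eq_mul, div_mul_cancel₀ _ hne] at this
    exact lt_irrefl _ this
  have hf0w : 0 < f 0 w := hu.trans hw2
  have hF0 : 0 < F (f 0) := hd.trans_le (hfd 0)
  have hFw : ∀ g ∈ Y, F g = g ((F (f 0) / f 0 w) • w) := by
    intro g hg
    have h1 : g - (F g / F (f 0)) • f 0 ∈ Z := by
      refine ⟨Y.sub_mem hg (Y.smul_mem _ (hfY 0)), ?_⟩
      change F (g - (F g / F (f 0)) • f 0) = 0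
      rw [map_sub, map_smul, smul_eq_mul, div_mul_cancel₀ _ hF0.ne', sub_self]
    have h3 := hZw0 _ h1
    simp only [sub_apply, smul_apply, smul_eq_mul] at h3
    rw [map_smul, smul_eq_mul, sub_eq_zero.1 h3]
    field_simp
  -- a weak* cluster point
  have hcomp : @IsCompact _ (wstarTop X)
      ((Y : Set (X →L[ℝ] ℝ)) ∩ Metric.closedBall (0 : X →L[ℝ] ℝ) 1) :=
    @IsCompact.inter_left _ (wstarTop X) _ _ (ws_ball_compact (X := X) 1) (h2 Y hYc hYs)
  obtain ⟨φ, hφ, hcl⟩ := @exists_cluster _ (wstarTop X) _ hcomp f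
    (fun n => ⟨hfY n, by simpa using hfn n⟩)
  have hφx : ∀ i, φ (x i) = 0 := by
    intro i
    have a1 := ws_closure_le (C := f '' Set.Ici (i+1)) (x := x i) (u := 0) (by
      rintro _ ⟨n, hn, rfl⟩
      exact (hfx i n hn).le) φ (hcl (i+1))
    have a2 := ws_closure_le (C := f '' Set.Ici (i+1)) (x := -x i) (u := 0) (by
      rintro _ ⟨n, hn, rfl⟩
      rw [map_neg, hfx i n hn, neg_zero]) φ (hcl (i+1))
    rw [map_neg] at a2
    linarith
  have hφ0 : F φ = 0 := by
    have : Tendsto (fun n => φ (x n)) atTop (𝓝 (F φ)) := hYT hφ.1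
    simp only [hφx] at this
    exact tendsto_nhds_unique this tendsto_const_nhds
  have hφd := ws_closure_le (C := f '' Set.Ici 0) (x := -((F (f 0) / f 0 w) • w)) (u := -d) (by
      rintro _ ⟨n, hn, rfl⟩
      rw [map_neg, ← hFw _ (hfY n)]
      exact neg_le_neg (hfd n)) φ (hcl 0)
  rw [map_neg, ← hFw φ hφ.1, hφ0] at hφd
  linarith

end helpers

theorem stmt9 {X : Type*} [NormedAddCommGroup X] [NormedSpace ℝ X] [CompleteSpace X]
    (hwsc : ∀ x : ℕ → X,
      (∀ f : X →L[ℝ] ℝ, ∃ l : ℝ, Tendsto (fun n => f (x n)) atTop (𝓝 l)) →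
      ∃ y : X, ∀ f : X →L[ℝ] ℝ, Tendsto (fun n => f (x n)) atTop (𝓝 (f y))) :
    List.TFAE
      [ ∃ τ : TopologicalSpace (X →L[ℝ] ℝ),
          @IsTopologicalAddGroup (X →L[ℝ] ℝ) τ _ ∧
          @ContinuousSMul ℝ (X →L[ℝ] ℝ) _ _ τ ∧
          @LocallyConvexSpace ℝ (X →L[ℝ] ℝ) _ _ _ _ τ ∧
          ∀ A : Set (X →L[ℝ] ℝ), Ienv A = @closure _ τ (convexHull ℝ A),
        ∀ Y : Submodule ℝ (X →L[ℝ] ℝ), IsClosed (Y : Set (X →L[ℝ] ℝ)) →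
          TopologicalSpace.IsSeparable (Y : Set (X →L[ℝ] ℝ)) →
          @IsClosed _ (wstarTop X) (Y : Set (X →L[ℝ] ℝ)),
        Function.Surjective (NormedSpace.inclusionInDoubleDual ℝ X) ] := by
  tfae_have 1 → 2 := by
    rintro ⟨τ, h1, h2, h3, h4⟩ Y hY hs
    exact one_two hwsc Y hY hs τ h1 h2 h3 h4
  tfae_have 2 → 3 := two_three
  tfae_have 3 → 1 := fun hr =>
    ⟨inferInstance, inferInstance, inferInstance, inferInstance, Ienv_refl hr⟩
  tfae_finish
end

section
/- Let X and Y be real Banach spaces, Q : X → Y a bounded linear map and J : Y → X a bounded linear map with Q ∘ J = id_Y (so that Y is complemented in X via the projection J ∘ Q). Let Q* : Y* → X* be the adjoint map, Q*(η) = η ∘ Q. Then for every A ⊆ Y*, Ienv(Q*(A)) = Q*(Ienv(A)). -/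
open Filter Topology

theorem wstar_eval_cont {E : Type*} [NormedAddCommGroup E] [NormedSpace ℝ E] (x : E) :
    @Continuous _ _ (wstarTop E) _ (fun f : E →L[ℝ] ℝ => f x) := by
  have h : @Continuous _ _ (wstarTop E) _ (fun (f : E →L[ℝ] ℝ) (x : E) => f x) :=
    continuous_induced_dom
  exact @Continuous.comp _ _ _ (wstarTop E) _ _ _ (fun g : E → ℝ => g x) (continuous_apply x) h

theorem wstar_comp_cont {E F : Type*} [NormedAddCommGroup E] [NormedSpace ℝ E]
    [NormedAddCommGroup F] [NormedSpace ℝ F] (T : E →L[ℝ] F) :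
    @Continuous _ _ (wstarTop F) (wstarTop E) (fun f : F →L[ℝ] ℝ => f.comp T) := by
  unfold wstarTop
  rw [continuous_induced_rng]
  change @Continuous _ _ (wstarTop F) _ _
  refine @continuous_pi _ _ _ (wstarTop F) _ _ fun x => ?_
  exact wstar_eval_cont (T x)

theorem wstarClosure_comp {E F : Type*} [NormedAddCommGroup E] [NormedSpace ℝ E]
    [NormedAddCommGroup F] [NormedSpace ℝ F] (T : E →L[ℝ] F) {S : Set (F →L[ℝ] ℝ)}
    {f : F →L[ℝ] ℝ} (hf : f ∈ wstarClosure S) :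
    f.comp T ∈ wstarClosure ((fun f : F →L[ℝ] ℝ => f.comp T) '' S) := by
  have h := @image_closure_subset_closure_image _ _ (wstarTop F) (wstarTop E) _ S
    (wstar_comp_cont T)
  exact h (Set.mem_image_of_mem _ hf)

theorem Ienv_comp {E F : Type*} [NormedAddCommGroup E] [NormedSpace ℝ E]
    [NormedAddCommGroup F] [NormedSpace ℝ F] (T : E →L[ℝ] F) {A : Set (F →L[ℝ] ℝ)}
    {f : F →L[ℝ] ℝ} (hf : f ∈ Ienv A) :
    f.comp T ∈ Ienv ((fun f : F →L[ℝ] ℝ => f.comp T) '' A) := by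
  let L : (F →L[ℝ] ℝ) →L[ℝ] (E →L[ℝ] ℝ) := (ContinuousLinearMap.compL ℝ E F ℝ).flip T
  have hL : ∀ g, L g = g.comp T := fun g => rfl
  have hLf : (fun f : F →L[ℝ] ℝ => f.comp T) = (L.toLinearMap : _ → _) := rfl
  simp only [Ienv, Set.mem_iInter] at hf ⊢
  intro Bs hB
  have h1 := hf (fun n => A ∩ L ⁻¹' (Bs n)) (by
    ext g
    simp only [Set.mem_iUnion, Set.mem_inter_iff, Set.mem_preimage]
    refine ⟨fun hg => ?_, fun ⟨_, hg, _⟩ => hg⟩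
    have : L g ∈ ⋃ n, Bs n := hB ▸ Set.mem_image_of_mem _ hg
    obtain ⟨n, hn⟩ := Set.mem_iUnion.1 this
    exact ⟨n, hg, hn⟩)
  have h2 := image_closure_subset_closure_image L.continuous (Set.mem_image_of_mem L h1)
  refine closure_mono ?_ h2
  change L.toLinearMap '' _ ⊆ _
  rw [LinearMap.image_convexHull]
  refine convexHull_mono ?_
  rintro _ ⟨g, hg, rfl⟩
  obtain ⟨n, hn⟩ := Set.mem_iUnion.1 hg
  refine Set.mem_iUnion.2 ⟨n, ?_⟩
  have h3 := wstarClosure_comp T hn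
  suffices h4 : (fun f : F →L[ℝ] ℝ => f.comp T) '' convexHull ℝ (A ∩ L ⁻¹' (Bs n)) ⊆
      convexHull ℝ (Bs n) by
    have h5 := @closure_mono _ (wstarTop E) _ _ h4
    exact h5 h3
  rw [hLf, LinearMap.image_convexHull]
  refine convexHull_mono ?_
  rintro _ ⟨k, hk, rfl⟩
  exact hk.2

theorem Ienv_fixed {E : Type*} [NormedAddCommGroup E] [NormedSpace ℝ E]
    (P : E →L[ℝ] E) {A : Set (E →L[ℝ] ℝ)} (hA : ∀ f ∈ A, f.comp P = f)
    {f : E →L[ℝ] ℝ} (hf : f ∈ Ienv A) : f.comp P = f := by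
  simp only [Ienv, Set.mem_iInter] at hf
  have h1 := hf (fun _ => A) (Set.iUnion_const A).symm
  let S : Set (E →L[ℝ] ℝ) := {f | ∀ x, f (P x) = f x}
  have hS : Convex ℝ S := by
    intro f hf g hg a b _ _ _ x
    simp [hf x, hg x]
  have hc : IsClosed S := by
    simp only [S, Set.ofPred_forall]
    exact isClosed_iInter fun x => isClosed_eq (by fun_prop) (by fun_prop)
  have hw : @IsClosed _ (wstarTop E) S := by
    simp only [S, Set.ofPred_forall]
    exact @isClosed_iInter _ _ (wstarTop E) _ fun x =>
      @isClosed_eq _ _ _ (wstarTop E) _ _ _ (wstar_eval_cont _) (wstar_eval_cont _)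
  have hAS : A ⊆ S := fun f hf x => congrArg (fun g : E →L[ℝ] ℝ => g x) (hA f hf)
  have hm : wstarClosure (convexHull ℝ A) ⊆ S := by
    unfold wstarClosure
    exact @closure_minimal _ (wstarTop E) _ _ (convexHull_min hAS hS) hw
  have : f ∈ S := closure_minimal (convexHull_min (Set.iUnion_subset fun _ => hm) hS) hc h1
  ext x
  exact this x

theorem stmt10 {X Y : Type*} [NormedAddCommGroup X] [NormedSpace ℝ X] [CompleteSpace X]
    [NormedAddCommGroup Y] [NormedSpace ℝ Y] [CompleteSpace Y]
    (Q : X →L[ℝ] Y) (J : Y →L[ℝ] X) (hQJ : Q.comp J = ContinuousLinearMap.id ℝ Y)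
    (A : Set (Y →L[ℝ] ℝ)) :
    Ienv ((fun η : Y →L[ℝ] ℝ => η.comp Q) '' A) =
      (fun η : Y →L[ℝ] ℝ => η.comp Q) '' Ienv A := by
  have key : ∀ y, Q (J y) = y := fun y => congrArg (fun g : Y →L[ℝ] Y => g y) hQJ
  apply Set.Subset.antisymm
  · intro f hf
    refine ⟨f.comp J, ?_, ?_⟩
    · have h := Ienv_comp J hf
      rw [Set.image_image] at h
      have e : ∀ η : Y →L[ℝ] ℝ, (η.comp Q).comp J = η := fun η => by
        ext y; simp [key]
      simpa only [e, Set.image_id'] using h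
    · refine Ienv_fixed (J.comp Q) ?_ hf
      rintro _ ⟨η, _, rfl⟩
      ext x
      simp [key]
  · rintro _ ⟨η, hη, rfl⟩
    exact Ienv_comp Q hη
end

section
/- Let X be a real Banach space containing a complemented isomorphic copy of ℓ¹, i.e., there exist a bounded linear projection P : X → X (P ∘ P = P) and a continuous linear bijection with continuous inverse from ℓ¹ onto the range of P. Then there is a norm-closed norm-separable linear subspace Y ⊆ X* that is strictly contained in its closure in the topology σ(X*,B₁(X)). In particular, there is no locally convex topology τ on X* (making X* a locally convex topological vector space over ℝ) such that Ienv(A) equals the τ-closure of conv(A) for every A ⊆ X*. -/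
open Filter Topology

namespace Stmt11Aux

lemma isClosed_induced_aux {α β : Type*} [TopologicalSpace β] (f : α → β) (s : Set β)
    (hs : IsClosed s) : IsClosed[TopologicalSpace.induced f inferInstance] (f ⁻¹' s) :=
  isClosed_induced_iff.2 ⟨s, hs, rfl⟩

lemma cl_min {α : Type*} (t : TopologicalSpace α) {A B : Set α} (h : A ⊆ B)
    (hB : IsClosed[t] B) : @closure _ t A ⊆ B := closure_minimal h hB

lemma cl_mono {α : Type*} (t : TopologicalSpace α) {A B : Set α} (h : A ⊆ B) :
    @closure _ t A ⊆ @closure _ t B := closure_mono h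

lemma cont_comp {α β γ : Type*} [TopologicalSpace α] [TopologicalSpace β]
    (t : TopologicalSpace γ) {g : β → γ} {f : α → β} (hg : @Continuous _ _ _ t g)
    (hf : Continuous f) : @Continuous _ _ _ t (fun x => g (f x)) := hg.comp hf

lemma map_cl {α β : Type*} [TopologicalSpace α] (t : TopologicalSpace β) {f : α → β}
    (hf : @Continuous _ _ _ t f) {s : Set α} {u : Set β} {a : α} (ha : a ∈ closure s)
    (h : ∀ b ∈ s, f b ∈ u) : f a ∈ @closure _ t u := map_mem_closure hf ha h

lemma mem_cl {β : Type*} (t : TopologicalSpace β) {f : ℕ → β} {b : β} {s : Set β}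
    (hf : Tendsto f atTop (@nhds _ t b)) (h : ∀ n, f n ∈ s) : b ∈ @closure _ t s :=
  mem_closure_of_tendsto hf (Eventually.of_forall h)

lemma sep {E : Type*} [AddCommGroup E] [Module ℝ E] [TopologicalSpace E]
    [IsTopologicalAddGroup E] [ContinuousSMul ℝ E] [LocallyConvexSpace ℝ E]
    (Y : Submodule ℝ E) (hY : IsClosed (Y : Set E)) (x : E) (hx : x ∉ Y) :
    ∃ f : E →ₗ[ℝ] ℝ, (∀ y ∈ Y, f y = 0) ∧ 0 < f x ∧ ∀ r : ℝ, IsClosed {z | f z ≤ r} := by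
  obtain ⟨f, u, h1, h2⟩ := geometric_hahn_banach_closed_point (Y.convex) hY hx
  have hu : 0 < u := by simpa using h1 0 Y.zero_mem
  refine ⟨f.toLinearMap, ?_, hu.trans h2, fun r => isClosed_le f.continuous continuous_const⟩
  intro y hy
  by_contra hne
  have hne' : f y ≠ 0 := hne
  have := h1 ((u / f y) • y) (Y.smul_mem _ hy)
  rw [map_smul, smul_eq_mul, div_mul_cancel₀ _ hne'] at this
  exact lt_irrefl _ this

/-- indicator value -/
noncomputable def ind (b : Bool) : ℝ := if b then 1 else 0

lemma ind_abs (b : Bool) : |ind b| ≤ 1 := by cases b <;> simp [ind]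

lemma summable_abs (f : ellOne) : Summable (fun k => |f k|) := by
  have := (lp.memℓp f).summable (by simp)
  simpa using this

lemma norm_eq (f : ellOne) : ‖f‖ = ∑' k, |f k| := by
  rw [lp.norm_eq_tsum_rpow (by simp)]
  simp

lemma bnd (a : ℕ → Bool) (f : ellOne) (k : ℕ) : ‖ind (a k) * f k‖ ≤ |f k| := by
  rw [norm_mul]
  have := ind_abs (a k)
  have h2 := abs_nonneg (f k)
  simp only [Real.norm_eq_abs]
  nlinarith

lemma summ (a : ℕ → Bool) (f : ellOne) : Summable (fun k => ind (a k) * f k) :=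
  Summable.of_norm_bounded (summable_abs f) (bnd a f)

/-- sum functional -/
noncomputable def S (a : ℕ → Bool) : ellOne →L[ℝ] ℝ :=
  LinearMap.mkContinuous
    { toFun := fun f => ∑' k, ind (a k) * f k
      map_add' := by
        intro f g
        rw [← (summ a f).tsum_add (summ a g)]
        congr 1; ext k; simp [mul_add]
      map_smul' := by
        intro r f
        simp only [RingHom.id_apply, smul_eq_mul]
        rw [← tsum_mul_left]
        congr 1; ext k; simp; ring } 1
    (by
      intro f
      rw [one_mul, norm_eq]
      exact tsum_of_norm_bounded (summable_abs f).hasSum (bnd a f))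

lemma S_apply (a : ℕ → Bool) (f : ellOne) : S a f = ∑' k, ind (a k) * f k := rfl

lemma S_norm (a : ℕ → Bool) : ‖S a‖ ≤ 1 := LinearMap.mkContinuous_norm_le _ zero_le_one _

lemma S_add (a b c d : ℕ → Bool) (h : ∀ k, ind (a k) + ind (b k) = ind (c k) + ind (d k)) :
    S a + S b = S c + S d := by
  ext f
  simp only [add_apply, S_apply]
  rw [← (summ a f).tsum_add (summ b f), ← (summ c f).tsum_add (summ d f)]
  congr 1; ext k
  rw [← add_mul, h, add_mul]

lemma S_cont (f : ellOne) : Continuous (fun a => S a f) := by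
  simp only [S_apply]
  refine continuous_tsum (fun k => ?_) (summable_abs f) (fun k a => bnd a f k)
  refine Continuous.mul ?_ continuous_const
  exact (continuous_of_discreteTopology (f := ind)).comp (continuous_apply k)

lemma S_single (a : ℕ → Bool) (k : ℕ) : S a (lp.single 1 k (1 : ℝ)) = ind (a k) := by
  rw [S_apply, tsum_eq_single k]
  · simp
  · intro j hj
    simp [hj]

/-- The splice of `a` (before `N`) and `b` (from `N` on). -/
def spl (N : ℕ) (a b : ℕ → Bool) : ℕ → Bool := fun k => if k < N then a k else b k

lemma spl_tendsto (a b : ℕ → Bool) : Tendsto (fun N => spl N a b) atTop (𝓝 a) := by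
  rw [tendsto_pi_nhds]
  intro k
  refine tendsto_const_nhds.congr' ?_
  filter_upwards [eventually_gt_atTop k] with N hN
  simp [spl, hN]

lemma spl_cont (N : ℕ) (c : ℕ → Bool) : Continuous (fun a => spl N c a) := by
  refine continuous_pi fun k => ?_
  by_cases h : k < N
  · simp only [spl, h, if_true]; exact continuous_const
  · simp only [spl, h, if_false]; exact continuous_apply k

/-- constants -/
def one : ℕ → Bool := fun _ => true
/-- constants -/
def zer : ℕ → Bool := fun _ => false

section
variable {X : Type*} [NormedAddCommGroup X] [NormedSpace ℝ X] (Q : X →L[ℝ] ellOne)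

/-- functionals on `X` -/
noncomputable def phi (a : ℕ → Bool) : X →L[ℝ] ℝ := (S a).comp Q

lemma phi_add (a b c d : ℕ → Bool) (h : ∀ k, ind (a k) + ind (b k) = ind (c k) + ind (d k)) :
    phi Q a + phi Q b = phi Q c + phi Q d := by
  simp only [phi, ← ContinuousLinearMap.add_comp, S_add a b c d h]

lemma phi_zer : phi Q zer = 0 := by
  ext x; simp [phi, S_apply, zer, ind]

lemma phi_norm (a : ℕ → Bool) : ‖phi Q a‖ ≤ ‖Q‖ := by
  refine (ContinuousLinearMap.opNorm_comp_le _ _).trans ?_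
  have := S_norm a
  have := norm_nonneg Q
  nlinarith

lemma phi_cont (x : X) : Continuous (fun a => phi Q a x) := S_cont (Q x)

lemma phi_wcont : @Continuous _ _ _ (wstarTop X) (phi Q) := by
  rw [wstarTop, continuous_induced_rng]
  exact continuous_pi fun x => phi_cont Q x

/-- finite indicator -/
def e (s : Finset ℕ) : ℕ → Bool := fun k => decide (k ∈ s)

lemma spl_e (N : ℕ) (a : ℕ → Bool) : spl N a zer = e ((Finset.range N).filter (fun k => a k)) := by
  ext k
  by_cases h : k < N <;> simp [spl, e, zer, h]

lemma nikodym (F : (X →L[ℝ] ℝ) →L[ℝ] ℝ) (hF : F ∈ B1 X) :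
    Tendsto (fun N => F (phi Q (spl N one zer))) atTop (𝓝 (F (phi Q one))) := by
  obtain ⟨x, hx⟩ := hF
  have key : Tendsto (fun N => F (phi Q (spl N zer one))) atTop (𝓝 0) := by
    rw [Metric.tendsto_atTop]
    intro ε hε
    let K : ℕ → Set (ℕ → Bool) := fun m =>
      {a | ∀ n, m ≤ n → |phi Q a (x n) - phi Q a (x m)| ≤ ε / 4}
    have hKc : ∀ m, IsClosed (K m) := by
      intro m
      simp only [K, Set.ofPred_forall]
      refine isClosed_iInter fun n => isClosed_iInter fun _ => ?_
      exact isClosed_le ((phi_cont Q _).sub (phi_cont Q _)).abs continuous_const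
    have hKu : ⋃ m, K m = Set.univ := by
      rw [Set.eq_univ_iff_forall]
      intro a
      have hc := (hx (phi Q a)).cauchySeq
      obtain ⟨m, hm⟩ := Metric.cauchySeq_iff'.1 hc (ε / 4) (by positivity)
      refine Set.mem_iUnion.2 ⟨m, fun n hn => ?_⟩
      have := hm n hn
      rw [Real.dist_eq] at this
      exact this.le
    obtain ⟨m, a, ha⟩ := nonempty_interior_of_iUnion_of_closed hKc hKu
    have hO : interior (K m) ∈ 𝓝 a := isOpen_interior.mem_nhds ha
    have h1 := (spl_tendsto a one).eventually hO
    have h2 := (spl_tendsto a zer).eventually hO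
    have h3 : Tendsto (fun N => phi Q (spl N zer one) (x m)) atTop (𝓝 0) := by
      have := ((phi_cont Q (x m)).tendsto zer).comp (spl_tendsto zer one)
      simpa [phi_zer, Function.comp_def] using this
    have h4 := h3.eventually (Metric.ball_mem_nhds 0 (show 0 < ε / 4 by positivity))
    obtain ⟨N0, hN0⟩ := eventually_atTop.1 (h1.and (h2.and h4))
    refine ⟨N0, fun N hN => ?_⟩
    obtain ⟨g1, g2, g3⟩ := hN0 N hN
    have g1 := interior_subset g1
    have g2 := interior_subset g2
    have hadd : phi Q (spl N a one) + phi Q zer = phi Q (spl N a zer) + phi Q (spl N zer one) := by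
      apply phi_add
      intro k
      by_cases h : k < N <;> simp [spl, h, one, zer, ind]
    rw [phi_zer, add_zero] at hadd
    have hb : ∀ n, m ≤ n →
        |phi Q (spl N zer one) (x n) - phi Q (spl N zer one) (x m)| ≤ ε / 4 + ε / 4 := by
      intro n hn
      have a1 := g1 n hn
      have a2 := g2 n hn
      rw [hadd] at a1
      simp only [add_apply] at a1
      rw [abs_le] at *
      constructor <;> linarith [a1.1, a1.2, a2.1, a2.2]
    have hl : |F (phi Q (spl N zer one)) - phi Q (spl N zer one) (x m)| ≤ ε / 4 + ε / 4 := by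
      refine le_of_tendsto ((hx (phi Q (spl N zer one))).sub_const _).abs ?_
      filter_upwards [eventually_ge_atTop m] with n hn using hb n hn
    have g3' : |phi Q (spl N zer one) (x m)| < ε / 4 := by simpa using g3
    rw [Real.dist_eq, sub_zero]
    rw [abs_le] at hl
    rw [abs_lt] at *
    constructor <;> linarith [hl.1, hl.2, g3'.1, g3'.2]
  have h5 : ∀ N, F (phi Q (spl N one zer)) = F (phi Q one) - F (phi Q (spl N zer one)) := by
    intro N
    have hadd : phi Q (spl N one zer) + phi Q (spl N zer one) = phi Q one + phi Q zer := by
      apply phi_add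
      intro k
      by_cases h : k < N <;> simp [spl, h, one, zer, ind]
    rw [phi_zer, add_zero] at hadd
    rw [← hadd, map_add]; ring
  simp only [h5]
  simpa using tendsto_const_nhds.sub key

lemma wstar_ball (d : X →L[ℝ] ℝ) (ε : ℝ) (hε : 0 ≤ ε) (A : Set (X →L[ℝ] ℝ))
    (hA : A ⊆ Metric.closedBall d ε) : wstarClosure A ⊆ Metric.closedBall d ε := by
  have hc : IsClosed[wstarTop X] (Metric.closedBall d ε) := by
    have : Metric.closedBall d ε =
        (fun (f : X →L[ℝ] ℝ) (x : X) => f x) ⁻¹' {g | ∀ x, |g x - d x| ≤ ε * ‖x‖} := by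
      ext f
      rw [Metric.mem_closedBall, dist_eq_norm, ContinuousLinearMap.opNorm_le_iff hε]
      rfl
    rw [this, wstarTop]
    refine isClosed_induced_aux _ _ ?_
    simp only [Set.ofPred_forall]
    refine isClosed_iInter fun x => ?_
    exact isClosed_le ((continuous_apply x).sub continuous_const).abs continuous_const
  exact cl_min (wstarTop X) hA hc

lemma ienv_sep (Y : Submodule ℝ (X →L[ℝ] ℝ)) (hc : IsClosed (Y : Set (X →L[ℝ] ℝ)))
    (hs : TopologicalSpace.IsSeparable (Y : Set (X →L[ℝ] ℝ))) :
    Ienv (Y : Set (X →L[ℝ] ℝ)) ⊆ Y := by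
  intro z hz
  rw [← hc.closure_eq, Metric.closure_eq_iInter_cthickening]
  refine Set.mem_iInter₂.2 fun ε hε => ?_
  obtain ⟨D, hDY, hDc, hYD⟩ := hs.exists_countable_dense_subset
  have hne : D.Nonempty := by
    rw [← closure_nonempty_iff]
    exact ⟨0, hYD Y.zero_mem⟩
  obtain ⟨d, rfl⟩ := hDc.exists_eq_range hne
  have hcov : (Y : Set (X →L[ℝ] ℝ)) = ⋃ n, ((Y : Set (X →L[ℝ] ℝ)) ∩ Metric.closedBall (d n) ε) := by
    refine Set.Subset.antisymm (fun y hy => ?_) (Set.iUnion_subset fun n => Set.inter_subset_left)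
    obtain ⟨_, ⟨n, rfl⟩, hn⟩ := Metric.mem_closure_iff.1 (hYD hy) ε hε
    exact Set.mem_iUnion.2 ⟨n, hy, hn.le⟩
  have := Set.mem_iInter₂.1 hz _ hcov
  refine closure_minimal (convexHull_min ?_ (Y.convex.cthickening ε)) Metric.isClosed_cthickening this
  refine Set.iUnion_subset fun n => ?_
  refine (wstar_ball (d n) ε hε.le _ ?_).trans
    (Metric.closedBall_subset_cthickening (hDY (Set.mem_range_self n)) ε)
  exact convexHull_min Set.inter_subset_right (convex_closedBall _ _)

/-- the Baire step -/
lemma baire_step (D : Set (ℕ → Bool)) (A : ℕ → Set (X →L[ℝ] ℝ))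
    (hA : phi Q '' D = ⋃ n, A n) (N : ℕ)
    (hD : ∀ a, spl N one a ∈ D ∨ spl N one (fun k => !a k) ∈ D) :
    ∃ n M s, N ≤ M ∧ (∀ k, k < N → s k = true) ∧ (∀ k, M ≤ k → s k = true) ∧
      phi Q s ∈ wstarClosure (A n) := by
  let fl : Bool → (ℕ → Bool) → (ℕ → Bool) := fun i a k => (i ^^ a k)
  have flc : ∀ i, Continuous (fl i) := fun i => continuous_pi fun k =>
    (continuous_of_discreteTopology (f := fun b => (i ^^ b))).comp (continuous_apply k)
  let L : ℕ × Bool → Set (ℕ → Bool) := fun p => {a | phi Q (spl N one (fl p.2 a)) ∈ A p.1}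
  have hu : ⋃ p, closure (L p) = Set.univ := by
    rw [Set.eq_univ_iff_forall]
    intro a
    have : ∃ i, spl N one (fl i a) ∈ D := by
      rcases hD a with h | h
      · exact ⟨false, by simpa [fl] using h⟩
      · exact ⟨true, by simpa [fl] using h⟩
    obtain ⟨i, hi⟩ := this
    have h2 : phi Q (spl N one (fl i a)) ∈ ⋃ n, A n := hA ▸ Set.mem_image_of_mem _ hi
    obtain ⟨n, hn⟩ := Set.mem_iUnion.1 h2
    exact Set.mem_iUnion.2 ⟨(n, i), subset_closure hn⟩
  obtain ⟨⟨n, i⟩, a, ha⟩ := nonempty_interior_of_iUnion_of_closed (fun p => isClosed_closure) hu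
  have h1 := (spl_tendsto a (fun _ => !i)).eventually (isOpen_interior.mem_nhds ha)
  obtain ⟨M, hM, hMN⟩ := (h1.and (eventually_ge_atTop N)).exists
  refine ⟨n, M, spl N one (fl i (spl M a (fun _ => !i))), hMN, ?_, ?_, ?_⟩
  · intro k hk; simp [spl, hk, one]
  · intro k hk
    have h2 : ¬ k < M := by omega
    have h3 : ¬ k < N := by omega
    simp [spl, h2, h3, fl]
  · have hcont : @Continuous _ _ _ (wstarTop X) (fun b => phi Q (spl N one (fl i b))) :=
      cont_comp (wstarTop X) (phi_wcont Q) ((spl_cont N one).comp (flc i))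
    have := interior_subset hM
    exact map_cl (wstarTop X) hcont this (fun b hb => hb)

lemma avg (U : Set (X →L[ℝ] ℝ))
    (hU : ∀ N, ∃ M s, N ≤ M ∧ (∀ k, k < N → s k = true) ∧ (∀ k, M ≤ k → s k = true) ∧
      phi Q s ∈ U) : phi Q one ∈ closure (convexHull ℝ U) := by
  have step : ∀ m : ℕ, ∃ N g, (∀ k, N ≤ k → g k = false) ∧
      phi Q one - ((m : ℝ) + 1)⁻¹ • phi Q g ∈ convexHull ℝ U := by
    have hcompl : ∀ s : ℕ → Bool, phi Q s = phi Q one - phi Q (fun k => !s k) := by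
      intro s
      have := phi_add Q s (fun k => !s k) one zer (by
        intro k; cases h : s k <;> simp [ind, one, zer, h])
      rw [phi_zer, add_zero] at this
      rw [← this]; abel
    intro m
    induction m with
    | zero =>
      obtain ⟨M, s, -, -, h2, h3⟩ := hU 0
      refine ⟨M, fun k => !s k, fun k hk => by simp [h2 k hk], ?_⟩
      have := subset_convexHull ℝ U h3
      rw [hcompl] at this
      simpa using this
    | succ m ih =>
      obtain ⟨N, g, hg, hm⟩ := ih
      obtain ⟨M, s, hNM, h1, h2, h3⟩ := hU N
      refine ⟨M, fun k => g k || !s k, fun k hk => by simp [h2 k hk, hg k (hNM.trans hk)], ?_⟩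
      have h3 := subset_convexHull ℝ U h3
      rw [hcompl] at h3
      have hadd : phi Q (fun k => g k || !s k) = phi Q g + phi Q (fun k => !s k) := by
        have := phi_add Q (fun k => g k || !s k) zer g (fun k => !s k) (by
          intro k
          by_cases hk : k < N
          · cases h : g k <;> simp [ind, zer, h, h1 k hk]
          · simp [ind, zer, hg k (not_lt.1 hk)])
        rwa [phi_zer, add_zero] at this
      have hpos : (0 : ℝ) < (m : ℝ) + 1 := by positivity
      have hpos2 : (0 : ℝ) < (m : ℝ) + 1 + 1 := by positivity
      have := (convex_convexHull ℝ U) hm h3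
        (a := ((m : ℝ) + 1) / ((m : ℝ) + 1 + 1)) (b := 1 / ((m : ℝ) + 1 + 1))
        (by positivity) (by positivity) (by field_simp)
      convert this using 1
      rw [hadd]
      ext x
      simp only [sub_apply, add_apply,
        smul_apply, smul_eq_mul]
      push_cast
      field_simp
      ring
  rw [Metric.mem_closure_iff]
  intro ε hε
  obtain ⟨m, hm⟩ := exists_nat_gt (‖Q‖ / ε)
  obtain ⟨N, g, -, hg⟩ := step m
  refine ⟨_, hg, ?_⟩
  have hpos : (0 : ℝ) < (m : ℝ) + 1 := by positivity
  rw [dist_eq_norm, sub_sub_cancel, norm_smul, norm_inv, Real.norm_of_nonneg hpos.le]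
  rw [div_lt_iff₀ hε] at hm
  rw [inv_mul_lt_iff₀ hpos]
  have := phi_norm Q g
  nlinarith

end

lemma exists_Q {X : Type*} [NormedAddCommGroup X] [NormedSpace ℝ X]
    (P : X →L[ℝ] X) (hP : P.comp P = P)
    (T : ellOne →L[ℝ] X) (c : ℝ) (hc : 0 < c) (hT : ∀ f : ellOne, c * ‖f‖ ≤ ‖T f‖)
    (hrange : Set.range T = Set.range P) :
    ∃ Q : X →L[ℝ] ellOne, ∀ f, Q (T f) = f := by
  have hinj : Function.Injective T := by
    rw [injective_iff_map_eq_zero]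
    intro f hf
    have := hT f
    rw [hf, norm_zero] at this
    have h0 := norm_nonneg f
    exact norm_eq_zero.1 (by nlinarith)
  have hex : ∀ x, ∃ f, T f = P x := fun x => by
    have : P x ∈ Set.range T := hrange ▸ Set.mem_range_self x
    exact this
  choose q hq using hex
  refine ⟨LinearMap.mkContinuous ⟨⟨q, fun x y => hinj (by simp [hq])⟩,
    fun r x => hinj (by simp [hq])⟩ (c⁻¹ * ‖P‖) ?_, ?_⟩
  · intro x
    change ‖q x‖ ≤ _
    have h1 := hT (q x)
    rw [hq] at h1
    have h2 := P.le_opNorm x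
    rw [mul_assoc, le_inv_mul_iff₀ hc]
    linarith
  · intro f
    change q (T f) = f
    apply hinj
    rw [hq]
    have : T f ∈ Set.range P := hrange ▸ Set.mem_range_self f
    obtain ⟨y, hy⟩ := this
    rw [← hy]
    exact congrArg (fun R : X →L[ℝ] X => R y) hP

end Stmt11Aux

open Stmt11Aux in

theorem stmt11 {X : Type*} [NormedAddCommGroup X] [NormedSpace ℝ X] [CompleteSpace X]
    (P : X →L[ℝ] X) (hP : P.comp P = P)
    (T : ellOne →L[ℝ] X) (c : ℝ) (hc : 0 < c) (hT : ∀ f : ellOne, c * ‖f‖ ≤ ‖T f‖)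
    (hrange : Set.range T = Set.range P) :
    (∃ Y : Submodule ℝ (X →L[ℝ] ℝ), IsClosed (Y : Set (X →L[ℝ] ℝ)) ∧
        TopologicalSpace.IsSeparable (Y : Set (X →L[ℝ] ℝ)) ∧
        (Y : Set (X →L[ℝ] ℝ)) ⊂ @closure _ (sigmaTop (B1 X)) (Y : Set (X →L[ℝ] ℝ))) ∧
      ¬ ∃ τ : TopologicalSpace (X →L[ℝ] ℝ),
          @IsTopologicalAddGroup (X →L[ℝ] ℝ) τ _ ∧
          @ContinuousSMul ℝ (X →L[ℝ] ℝ) _ _ τ ∧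
          @LocallyConvexSpace ℝ (X →L[ℝ] ℝ) _ _ _ _ τ ∧
          ∀ A : Set (X →L[ℝ] ℝ), Ienv A = @closure _ τ (convexHull ℝ A) := by
  obtain ⟨Q, hQ⟩ := exists_Q P hP T c hc hT hrange
  set Z : Submodule ℝ (X →L[ℝ] ℝ) :=
    Submodule.span ℝ (Set.range fun s : Finset ℕ => phi Q (e s)) with hZ
  set Y := Z.topologicalClosure with hYdef
  have hcl : IsClosed (Y : Set (X →L[ℝ] ℝ)) := Z.isClosed_topologicalClosure
  have hsep : TopologicalSpace.IsSeparable (Y : Set (X →L[ℝ] ℝ)) := by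
    rw [hYdef, Submodule.topologicalClosure_coe]
    exact ((Set.countable_range _).isSeparable.span (R := ℝ)).closure
  have hspl : ∀ N a, phi Q (spl N a zer) ∈ Y := by
    intro N a
    rw [spl_e]
    exact Z.le_topologicalClosure (Submodule.subset_span ⟨_, rfl⟩)
  have hone : phi Q one ∉ Y := by
    intro h
    have hev : ∀ y ∈ Z, ∀ᶠ k in atTop, y (T (lp.single 1 k (1 : ℝ))) = 0 := by
      intro y hy
      induction hy using Submodule.span_induction with
      | mem y hy =>
        obtain ⟨s, rfl⟩ := hy
        filter_upwards [eventually_gt_atTop (s.sup id)] with k hk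
        have hks : k ∉ s := fun hks => absurd (Finset.le_sup (f := id) hks) (not_le.2 hk)
        simp [phi, hQ, S_single, e, hks, ind]
      | zero => simp
      | add x y _ _ hx hy =>
        filter_upwards [hx, hy] with k h1 h2
        simp [h1, h2]
      | smul r x _ hx =>
        filter_upwards [hx] with k h1
        simp [h1]
    have h' : phi Q one ∈ closure (Z : Set (X →L[ℝ] ℝ)) := by
      rw [← Submodule.topologicalClosure_coe]; exact h
    have hpos : 0 < ‖T‖ + 1 := by positivity
    obtain ⟨y, hy, hd⟩ := Metric.mem_closure_iff.1 h' ((‖T‖ + 1)⁻¹) (by positivity)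
    obtain ⟨k, hk⟩ := (hev y hy).exists
    have h1 : (phi Q one - y) (T (lp.single 1 k (1 : ℝ))) = 1 := by
      rw [sub_apply, hk]
      simp [phi, hQ, S_single, one, ind]
    have h2 := (phi Q one - y).le_opNorm (T (lp.single 1 k (1 : ℝ)))
    have h3 := T.le_opNorm (lp.single 1 k (1 : ℝ))
    have h4 : ‖(lp.single 1 k (1 : ℝ) : ellOne)‖ = 1 := by
      rw [lp.norm_single (by simp)]; simp
    rw [h1, norm_one] at h2
    rw [h4, mul_one] at h3
    rw [dist_eq_norm, lt_inv_comm₀ (by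
      by_contra hn
      have : ‖phi Q one - y‖ = 0 := le_antisymm (not_lt.1 hn) (norm_nonneg _)
      rw [this] at h2; linarith) hpos, ] at hd
    have h5 : 0 < ‖phi Q one - y‖ := by
      by_contra hn
      have : ‖phi Q one - y‖ = 0 := le_antisymm (not_lt.1 hn) (norm_nonneg _)
      rw [this] at h2; linarith
    rw [lt_inv_comm₀ hpos h5, lt_inv_comm₀ h5 hpos, ← one_div, lt_div_iff₀ h5] at hd
    nlinarith
  refine ⟨⟨Y, hcl, hsep, ?_⟩, ?_⟩
  · refine ⟨@subset_closure _ (sigmaTop (B1 X)) _, fun hsub => hone (hsub ?_)⟩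
    have ht : @Tendsto _ _ (fun N => phi Q (spl N one zer)) atTop
        (@nhds _ (sigmaTop (B1 X)) (phi Q one)) := by
      rw [sigmaTop, nhds_induced, tendsto_comap_iff, tendsto_pi_nhds]
      intro F
      exact nikodym Q F.1 F.2
    exact mem_cl (sigmaTop (B1 X)) ht (fun N => hspl N one)
  · rintro ⟨τ, i1, i2, i3, hτ⟩
    have hYτ : IsClosed[τ] (Y : Set (X →L[ℝ] ℝ)) := by
      have h1 := hτ (Y : Set (X →L[ℝ] ℝ))
      rw [Y.convex.convexHull_eq] at h1
      have h2 := ienv_sep Y hcl hsep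
      rw [h1] at h2
      exact @isClosed_of_closure_subset _ τ _ h2
    obtain ⟨F, hFY, hF1, hFc⟩ := @sep _ _ _ τ i1 i2 i3 Y hYτ _ hone
    set r := F (phi Q one) / 2 with hr
    let D : Set (ℕ → Bool) := {a | F (phi Q a) ≤ r}
    have hmem : phi Q one ∈ Ienv (phi Q '' D) := by
      refine Set.mem_iInter₂.2 fun A hA => ?_
      refine avg Q _ fun N => ?_
      obtain ⟨n, M, s, h1, h2, h3, h4⟩ := baire_step Q D A hA N (by
        intro a
        have hadd := phi_add Q (spl N one a) (spl N one (fun k => !a k))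
          one (spl N one zer) (by
            intro k
            by_cases hk : k < N
            · simp [spl, hk, one, zer, ind]
            · cases h : a k <;> simp [spl, hk, one, zer, ind, h])
        have hF := congrArg F hadd
        rw [map_add, map_add, hFY _ (hspl N one)] at hF
        by_contra hcon
        rw [not_or] at hcon
        have c1 := not_le.1 (show ¬ F (phi Q (spl N one a)) ≤ r from hcon.1)
        have c2 := not_le.1 (show ¬ F (phi Q (spl N one (fun k => !a k))) ≤ r from hcon.2)
        linarith)
      refine ⟨M, s, h1, h2, h3, Set.mem_iUnion.2 ⟨n, ?_⟩⟩
      exact cl_mono (wstarTop X) (subset_convexHull ℝ (A n)) h4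
    rw [hτ] at hmem
    have hsub : convexHull ℝ (phi Q '' D) ⊆ {z | F z ≤ r} := by
      refine convexHull_min ?_ (convex_halfSpace_le F.isLinear r)
      rintro _ ⟨a, ha, rfl⟩
      exact ha
    have h9 : F (phi Q one) ≤ r := cl_min τ hsub (hFc r) hmem
    linarith
end

section
/- Let K be an uncountable compact metrizable topological space and let X = C(K,ℝ) be the Banach space of continuous real-valued functions on K with the supremum norm. Then there is no locally convex topology τ on X* (a topology making X* a locally convex topological vector space over ℝ) such that Ienv(A) equals the τ-closure of conv(A) for every A ⊆ X*. -/
open Filter Topology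

theorem compact_hull_biUnion {V : Type*} [AddCommGroup V] [Module ℝ V] [TopologicalSpace V]
    [IsTopologicalAddGroup V] [ContinuousSMul ℝ V] {ι : Type*} (s : Finset ι) (C : ι → Set V)
    (hc : ∀ i, IsCompact (C i)) (hv : ∀ i, Convex ℝ (C i)) :
    IsCompact (convexHull ℝ (⋃ i ∈ s, C i)) := by
  classical
  induction s using Finset.induction_on with
  | empty => simp
  | insert a s ha ih =>
    rw [Finset.set_biUnion_insert]
    rcases (C a).eq_empty_or_nonempty with h | h
    · rw [h, Set.empty_union]; exact ih
    rcases (⋃ i ∈ s, C i).eq_empty_or_nonempty with h' | h'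
    · rw [h', Set.union_empty, (hv a).convexHull_eq]; exact hc a
    rw [convexHull_union h h', (hv a).convexHull_eq]
    have : convexJoin ℝ (C a) (convexHull ℝ (⋃ i ∈ s, C i)) =
        (fun p : ℝ × V × V => (1 - p.1) • p.2.1 + p.1 • p.2.2) ''
          (Set.Icc (0:ℝ) 1 ×ˢ (C a ×ˢ convexHull ℝ (⋃ i ∈ s, C i))) := by
      ext x
      simp only [mem_convexJoin, segment_eq_image, Set.mem_image, Set.mem_prod, Prod.exists]
      constructor
      · rintro ⟨p, hp, q, hq, t, ht, rfl⟩
        exact ⟨t, p, q, ⟨ht, hp, hq⟩, rfl⟩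
      · rintro ⟨t, p, q, ⟨ht, hp, hq⟩, rfl⟩
        exact ⟨p, hp, q, hq, t, ht, rfl⟩
    rw [this]
    exact (isCompact_Icc.prod ((hc a).prod ih)).image (by fun_prop)

theorem wd_sep {E : Type*} [NormedAddCommGroup E] [NormedSpace ℝ E]
    (T : Set (WeakDual ℝ E)) (hT : Convex ℝ T) (hc : IsCompact T) (ξ : WeakDual ℝ E)
    (hξ : ξ ∉ T) : ∃ x : E, ∀ ζ ∈ T, ζ x < ξ x := by
  have : LocallyConvexSpace ℝ (WeakDual ℝ E) :=
    inferInstanceAs (LocallyConvexSpace ℝ (WeakBilin (topDualPairing ℝ E)))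
  have : IsTopologicalAddGroup (WeakDual ℝ E) :=
    inferInstanceAs (IsTopologicalAddGroup (WeakBilin (topDualPairing ℝ E)))
  obtain ⟨f, u, h1, h2⟩ := geometric_hahn_banach_closed_point hT hc.isClosed hξ
  obtain ⟨x, hx⟩ := LinearMap.dualEmbedding_surjective (topDualPairing ℝ E) f
  refine ⟨x, fun ζ hζ => ?_⟩
  have e : ∀ ζ : WeakDual ℝ E, f ζ = ζ x := fun ζ => by rw [← hx]; rfl
  rw [← e, ← e]
  exact (h1 ζ hζ).trans h2

theorem key_sep {E : Type*} [NormedAddCommGroup E] [NormedSpace ℝ E]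
    (Ks : ℕ → Set (WeakDual ℝ E)) (hv : ∀ i, Convex ℝ (Ks i)) (hc : ∀ i, IsClosed (Ks i))
    (ξ : WeakDual ℝ E) (δ : ℝ) (hδ : 0 < δ)
    (hd : ∀ ζ ∈ convexHull ℝ (⋃ i, Ks i), δ ≤ ‖WeakDual.toStrongDual (ξ - ζ)‖) (n : ℕ) :
    ∃ x : E, ‖x‖ ≤ 1 ∧ ∀ i ≤ n, ∀ ζ ∈ Ks i, ‖WeakDual.toStrongDual ζ‖ ≤ n →
      ζ x + δ / 2 ≤ ξ x := by
  have : IsTopologicalAddGroup (WeakDual ℝ E) :=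
    inferInstanceAs (IsTopologicalAddGroup (WeakBilin (topDualPairing ℝ E)))
  let B : ℝ → Set (WeakDual ℝ E) := fun r =>
    WeakDual.toStrongDual ⁻¹' Metric.closedBall (0 : StrongDual ℝ E) r
  have hB : ∀ r, IsCompact (B r) := fun r => WeakDual.isCompact_closedBall 0 r
  have hBv : ∀ r, Convex ℝ (B r) := fun r =>
    (convex_closedBall (0 : StrongDual ℝ E) r).linear_preimage
      (WeakDual.toStrongDual (𝕜 := ℝ) (E := E)).toLinearMap
  have hC : IsCompact (convexHull ℝ (⋃ i ∈ Finset.range (n+1), (Ks i ∩ B n))) :=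
    compact_hull_biUnion _ _ (fun i => (hB n).inter_left (hc i)) (fun i => (hv i).inter (hBv n))
  set C := convexHull ℝ (⋃ i ∈ Finset.range (n+1), (Ks i ∩ B n)) with hCdef
  have hCs : C ⊆ convexHull ℝ (⋃ i, Ks i) := by
    apply convexHull_mono
    intro z hz
    simp only [Set.mem_iUnion] at hz ⊢
    obtain ⟨i, _, h, _⟩ := hz
    exact ⟨i, h⟩
  have hmem : ∀ i ≤ n, ∀ ζ ∈ Ks i, ‖WeakDual.toStrongDual ζ‖ ≤ n → ζ ∈ C := by
    intro i hi ζ hζ hn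
    apply subset_convexHull
    simp only [Set.mem_iUnion]
    refine ⟨i, by simp; omega, hζ, ?_⟩
    simpa [B] using hn
  rcases C.eq_empty_or_nonempty with hE | ⟨z0, hz0⟩
  · refine ⟨0, by simp, fun i hi ζ hζ hn => ?_⟩
    have := hmem i hi ζ hζ hn
    rw [hE] at this; exact this.elim
  have hT : IsCompact ((fun p : WeakDual ℝ E × WeakDual ℝ E => p.1 + p.2) '' (C ×ˢ B (δ/2))) :=
    (hC.prod (hB _)).image (by fun_prop)
  rw [Set.add_image_prod] at hT
  open Pointwise in
  obtain ⟨x, hx⟩ := wd_sep (C + B (δ/2)) ((convex_convexHull ℝ _).add (hBv _)) hT ξ (by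
    rintro ⟨c, hc, b, hb, rfl⟩
    have := hd c (hCs hc)
    simp only [add_sub_cancel_left] at this
    have hb' : ‖WeakDual.toStrongDual b‖ ≤ δ/2 := by simpa [B] using hb
    linarith)
  have hx' : ∀ c ∈ C, ∀ b ∈ B (δ/2), c x + b x < ξ x := fun c hc b hb =>
    hx (c + b) (Set.add_mem_add hc hb)
  obtain ⟨g, hg1, hg2⟩ := exists_dual_vector'' ℝ x
  have hmain : ∀ c ∈ C, c x + δ/2 * ‖x‖ < ξ x := by
    intro c hc
    have := hx' c hc (StrongDual.toWeakDual ((δ/2) • g)) (by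
      have : ‖(δ/2) • g‖ ≤ δ/2 := by
        rw [norm_smul, Real.norm_of_nonneg (by positivity)]
        nlinarith
      simpa [B] using this)
    have e : (StrongDual.toWeakDual ((δ/2) • g)) x = δ/2 * ‖x‖ := by
      change (δ/2) * g x = _
      rw [hg2]; rfl
    rwa [e] at this
  have hx0 : x ≠ 0 := by
    rintro rfl
    have := hmain z0 hz0
    simp at this
  have hxp : 0 < ‖x‖ := norm_pos_iff.2 hx0
  refine ⟨‖x‖⁻¹ • x, by rw [norm_smul]; simp [hxp.ne'], fun i hi ζ hζ hn => ?_⟩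
  have := hmain ζ (hmem i hi ζ hζ hn)
  rw [map_smul, map_smul, smul_eq_mul, smul_eq_mul]
  have h3 : ‖x‖⁻¹ * (ζ x + δ/2 * ‖x‖) ≤ ‖x‖⁻¹ * ξ x := by gcongr
  have h4 : ‖x‖⁻¹ * (ζ x + δ/2 * ‖x‖) = ‖x‖⁻¹ * ζ x + δ/2 := by field_simp
  linarith

theorem F_B1 {E : Type*} [NormedAddCommGroup E] [NormedSpace ℝ E]
    (F : (E →L[ℝ] ℝ) →ₗ[ℝ] ℝ) (ξ : E →L[ℝ] ℝ) (hF : F ξ ≠ 0)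
    (h : ξ ∉ Ienv {η : E →L[ℝ] ℝ | F η = 0}) :
    ∃ x : ℕ → E, ∃ a : ℝ, a ≠ 0 ∧ ∀ η : E →L[ℝ] ℝ,
      Tendsto (fun n => η (x n)) atTop (𝓝 (a * F η)) := by
  have hg : IsTopologicalAddGroup (WeakDual ℝ E) :=
    inferInstanceAs (IsTopologicalAddGroup (WeakBilin (topDualPairing ℝ E)))
  simp only [Ienv, Set.mem_iInter, not_forall] at h
  obtain ⟨As, hAs, hξ⟩ := h
  rw [Metric.mem_closure_iff] at hξ
  push Not at hξ
  obtain ⟨δ, hδ, hd⟩ := hξ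
  let Ks : ℕ → Set (WeakDual ℝ E) := fun i =>
    closure (convexHull ℝ (As i : Set (WeakDual ℝ E)) : Set (WeakDual ℝ E))
  have hk := key_sep Ks (fun i => (convex_convexHull ℝ _).closure) (fun i => isClosed_closure)
    ξ δ hδ (fun ζ hζ => by
      have := hd ζ hζ
      exact this.trans_eq (dist_eq_norm (E := E →L[ℝ] ℝ) ξ ζ))
  choose x hx1 hx2 using hk
  have hev : ∀ η : E →L[ℝ] ℝ, F η = 0 → ∀ᶠ n in atTop, η (x n) + δ/2 ≤ ξ (x n) := by
    intro η hη
    have : η ∈ ⋃ n, As n := by rw [← hAs]; exact hη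
    obtain ⟨i, hi⟩ := Set.mem_iUnion.1 this
    obtain ⟨m, hm⟩ := exists_nat_ge ‖η‖
    filter_upwards [eventually_ge_atTop i, eventually_ge_atTop m] with n hn1 hn2
    exact hx2 n i hn1 η (subset_closure (subset_convexHull ℝ _ hi))
      (hm.trans (by exact_mod_cast hn2))
  have hub : ∀ n, ξ (x n) ≤ ‖ξ‖ := fun n =>
    (le_abs_self _).trans ((ξ.le_opNorm (x n)).trans
      (mul_le_of_le_one_right (norm_nonneg _) (hx1 n)))
  have hker : ∀ η : E →L[ℝ] ℝ, F η = 0 → Tendsto (fun n => η (x n)) atTop (𝓝 0) := by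
    intro η hη
    rw [Metric.tendsto_nhds]
    intro ε hε
    set t : ℝ := (‖ξ‖ + 1) / ε
    have ht : 0 < t := by positivity
    filter_upwards [hev (t • η) (by simp [hη]), hev (-(t • η)) (by simp [hη])] with n h1 h2
    have h1' : t * η (x n) + δ/2 ≤ ξ (x n) := h1
    have h2' : -(t * η (x n)) + δ/2 ≤ ξ (x n) := h2
    have h3 : |t * η (x n)| ≤ ‖ξ‖ := by
      rw [abs_le]; constructor <;> linarith [hub n]
    rw [abs_mul, abs_of_pos ht] at h3
    rw [Real.dist_eq, sub_zero]
    have h4 : t * |η (x n)| < t * ε := by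
      have : t * ε = ‖ξ‖ + 1 := by simp only [t]; field_simp
      linarith
    exact lt_of_mul_lt_mul_left h4 ht.le
  obtain ⟨a, ha, φ, hφ, hlim⟩ := tendsto_subseq_of_frequently_bounded
    (Metric.isBounded_Icc (δ/2) ‖ξ‖) (x := fun n => ξ (x n))
    ((hev 0 (by simp)).mono (fun n hn => ⟨by simpa using hn, hub n⟩)).frequently
  rw [closure_Icc] at ha
  refine ⟨fun n => x (φ n), a / F ξ, div_ne_zero (by linarith [ha.1]) hF, fun η => ?_⟩
  have h1 := (hker (η - (F η / F ξ) • ξ) (by simp [hF])).comp hφ.tendsto_atTop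
  have h2 := h1.add (hlim.const_mul (F η / F ξ))
  have e : 0 + F η / F ξ * a = a / F ξ * F η := by ring
  rw [e] at h2
  refine h2.congr (fun n => ?_)
  simp [Function.comp]

theorem Ienv_countable {E : Type*} [NormedAddCommGroup E] [NormedSpace ℝ E]
    (a : ℕ → (E →L[ℝ] ℝ)) : Ienv (Set.range a) ⊆ closure (convexHull ℝ (Set.range a)) := by
  intro ξ hξ
  simp only [Ienv, Set.mem_iInter] at hξ
  have := hξ (fun n => {a n}) (by ext; simp [eq_comm])
  have e : ∀ n, wstarClosure (convexHull ℝ {a n}) = {a n} := by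
    intro n
    rw [convexHull_singleton]
    exact (isClosed_singleton (X := WeakDual ℝ E) (x := a n)).closure_eq
  simp only [e] at this
  rwa [show (⋃ n, {a n}) = Set.range a by ext; simp [eq_comm]] at this

theorem lc_sep {V : Type*} [AddCommGroup V] [Module ℝ V] [TopologicalSpace V]
    [IsTopologicalAddGroup V] [ContinuousSMul ℝ V] [LocallyConvexSpace ℝ V]
    (A : Set V) (hA : ∀ v ∈ A, ∀ n : ℤ, n • v ∈ A) (ξ : V) (hA0 : A.Nonempty)
    (hξ : ξ ∉ closure (convexHull ℝ A)) :
    ∃ F : V →ₗ[ℝ] ℝ, (∀ v ∈ A, F v = 0) ∧ F ξ ≠ 0 ∧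
      ξ ∉ closure (convexHull ℝ {v | F v = 0}) := by
  obtain ⟨f, u, h1, h2⟩ := geometric_hahn_banach_closed_point
    (convex_convexHull ℝ A).closure isClosed_closure hξ
  have hb : ∀ v ∈ A, f v < u := fun v hv => h1 v (subset_closure (subset_convexHull ℝ _ hv))
  have h0 : ∀ v ∈ A, f v = 0 := by
    intro v hv
    by_contra hne
    obtain ⟨m, hm⟩ := exists_nat_ge (u / |f v|)
    have hp : 0 < |f v| := abs_pos.2 hne
    rw [div_le_iff₀ hp] at hm
    rcases abs_cases (f v) with h | h
    · have := hb _ (hA v hv m)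
      simp at this
      rw [h.1] at hm; linarith
    · have := hb _ (hA v hv (-m))
      simp at this
      rw [h.1] at hm; linarith
  obtain ⟨v, hv⟩ := hA0
  have hne : f ξ ≠ 0 := by
    have := hb v hv
    rw [h0 v hv] at this
    linarith
  refine ⟨f.toLinearMap, h0, hne, ?_⟩
  have hcl : IsClosed {v | f v = 0} := isClosed_eq f.continuous continuous_const
  have hcv : Convex ℝ {v | f v = 0} := (LinearMap.ker f.toLinearMap).convex
  change ξ ∉ closure (convexHull ℝ {v | f v = 0})
  rw [hcv.convexHull_eq, hcl.closure_eq]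
  exact hne

theorem cantor_dense (b : Bool) :
    Dense (Set.range (fun (s : Finset ℕ) (n : ℕ) => if n ∈ s then !b else b)) := by
  rw [dense_iff_inter_open]
  rintro U hU ⟨x, hx⟩
  obtain ⟨I, u, hu, hsub⟩ := isOpen_pi_iff.1 hU x hx
  refine ⟨_, hsub ?_, ⟨I.filter (fun n => x n = !b), rfl⟩⟩
  intro n hn
  have hn' : n ∈ I := hn
  have : (if n ∈ I.filter (fun n => x n = !b) then !b else b) = x n := by
    simp only [Finset.mem_filter, hn', true_and]
    cases b <;> cases x n <;> simp
  change (if n ∈ I.filter (fun n => x n = !b) then !b else b) ∈ u n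
  rw [this]
  exact (hu n hn').2

theorem baire_contra {T : Type*} [TopologicalSpace T] [BaireSpace T] [Nonempty T]
    (y : ℕ → T → ℝ) (hy : ∀ n, Continuous (y n)) (f : T → ℝ)
    (hf : ∀ t, Tendsto (fun n => y n t) atTop (𝓝 (f t))) (D D' : Set T) (hD : Dense D)
    (hD' : Dense D') (c : ℝ) (hc : c ≠ 0) (h1 : ∀ t ∈ D, f t = c) (h0 : ∀ t ∈ D', f t = 0) :
    False := by
  have hp : 0 < |c| := abs_pos.2 hc
  have hcl : ∀ N, IsClosed {t | ∀ n ≥ N, |y n t - y N t| ≤ |c| / 4} := by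
    intro N
    simp only [Set.ofPred_forall]
    exact isClosed_iInter fun n => isClosed_iInter fun _ =>
      isClosed_le ((hy n).sub (hy N)).abs continuous_const
  obtain ⟨N, hN⟩ := nonempty_interior_of_iUnion_of_closed hcl (by
    rw [Set.eq_univ_iff_forall]
    intro t
    obtain ⟨N, hN⟩ := Metric.cauchySeq_iff'.1 (hf t).cauchySeq (|c|/4) (by positivity)
    exact Set.mem_iUnion.2 ⟨N, fun n hn => (hN n hn).le⟩)
  set U := interior {t | ∀ n ≥ N, |y n t - y N t| ≤ |c| / 4}
  have hU : ∀ t ∈ U, |f t - y N t| ≤ |c|/4 := by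
    intro t ht
    have := interior_subset ht
    exact le_of_tendsto ((hf t).sub_const (y N t)).abs
      ((eventually_ge_atTop N).mono (fun n hn => this n hn))
  obtain ⟨d', hd'U, hd'⟩ := hD'.inter_open_nonempty U isOpen_interior hN
  have e1 := hU d' hd'U
  rw [h0 d' hd', zero_sub, abs_neg] at e1
  obtain ⟨d, ⟨hdU, hdy⟩, hd⟩ := hD.inter_open_nonempty (U ∩ {t | |y N t| < |c|/2})
    (isOpen_interior.inter (isOpen_lt (hy N).abs continuous_const))
    ⟨d', hd'U, by change |y N d'| < |c|/2; linarith⟩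
  have e2 := hU d hdU
  rw [h1 d hd] at e2
  have hdy' : |y N d| < |c|/2 := hdy
  have := abs_sub_abs_le_abs_sub c (y N d)
  linarith

theorem dist_contra {E : Type*} [NormedAddCommGroup E] [NormedSpace ℝ E] (f g : E →L[ℝ] ℝ)
    (x : E) (hx : ‖x‖ ≤ 1) (h : f x - g x = 1) (hd : dist f g < 1) : False := by
  have := (f - g).le_opNorm x
  rw [dist_eq_norm] at hd
  rw [ContinuousLinearMap.sub_apply, h, norm_one] at this
  nlinarith [norm_nonneg x, norm_nonneg (f - g)]

theorem conv_dist {K : Type*} [TopologicalSpace K] [CompactSpace K] [T2Space K]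
    {ι κ : Type*} (p : ι → K) (q : κ → K) (hpq : ∀ i j, p i ≠ q j) (i0 : ι)
    (v : ι ⊕ κ → (C(K, ℝ) →L[ℝ] ℝ))
    (hv1 : ∀ i, v (Sum.inl i) = ContinuousMap.evalCLM ℝ (p i) - ContinuousMap.evalCLM ℝ (p i0))
    (hv2 : ∀ j, v (Sum.inr j) = ContinuousMap.evalCLM ℝ (q j)) :
    (ContinuousMap.evalCLM ℝ (p i0) : C(K, ℝ) →L[ℝ] ℝ) ∉
      closure (convexHull ℝ (Set.range (fun i : ℤ × (ι ⊕ κ) => i.1 • v i.2))) := by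
  classical
  let S : Set (C(K, ℝ) →L[ℝ] ℝ) := {η | ∃ (P : Finset ι) (R : Finset κ), ∀ φ : C(K, ℝ),
    (∀ i ∈ P, φ (p i) = 1) → (∀ j ∈ R, φ (q j) = 0) → η φ = 0}
  have hS : Convex ℝ S := by
    rintro η ⟨P, R, h⟩ η' ⟨P', R', h'⟩ a b _ _ _
    refine ⟨P ∪ P', R ∪ R', fun φ h1 h2 => ?_⟩
    have e1 := h φ (fun i hi => h1 i (Finset.mem_union_left _ hi))
      (fun i hi => h2 i (Finset.mem_union_left _ hi))
    have e2 := h' φ (fun i hi => h1 i (Finset.mem_union_right _ hi))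
      (fun i hi => h2 i (Finset.mem_union_right _ hi))
    simp [e1, e2]
  have hAS : Set.range (fun i : ℤ × (ι ⊕ κ) => i.1 • v i.2) ⊆ S := by
    rintro _ ⟨⟨n, i | j⟩, rfl⟩
    · refine ⟨{i, i0}, ∅, fun φ h1 _ => ?_⟩
      have e1 := h1 i (by simp)
      have e2 := h1 i0 (by simp)
      simp [hv1, e1, e2]
    · refine ⟨∅, {j}, fun φ _ h2 => ?_⟩
      have e1 := h2 j (by simp)
      simp [hv2, e1]
  intro hcl
  replace hcl := (Metric.mem_closure_iff (α := C(K, ℝ) →L[ℝ] ℝ)).1 hcl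
  obtain ⟨η, hη, hd⟩ := hcl 1 one_pos
  obtain ⟨P, R, h⟩ := convexHull_min hAS hS hη
  obtain ⟨φ, h0, h1, h01⟩ := exists_continuous_zero_one_of_isClosed
    (s := q '' (R : Set κ)) (t := p '' (insert i0 P : Finset ι))
    (R.finite_toSet.image q).isClosed ((Finset.finite_toSet _).image p).isClosed (by
      rw [Set.disjoint_left]
      rintro _ ⟨j, _, rfl⟩ ⟨i, _, hi⟩
      exact hpq i j hi)
  have hp : ∀ i ∈ insert i0 P, φ (p i) = 1 := fun i hi => h1 ⟨i, hi, rfl⟩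
  have hη0 := h φ (fun i hi => hp i (Finset.mem_insert_of_mem hi)) (fun j hj => h0 ⟨j, hj, rfl⟩)
  have hφ : ‖φ‖ ≤ 1 := by
    rw [ContinuousMap.norm_le _ zero_le_one]
    intro x
    rw [Real.norm_of_nonneg (h01 x).1]
    exact (h01 x).2
  refine dist_contra (E := C(K, ℝ)) _ η φ hφ ?_ hd
  rw [hη0, sub_zero]
  exact hp i0 (Finset.mem_insert_self _ _)

theorem stmt12 (K : Type*) [TopologicalSpace K] [CompactSpace K]
    [TopologicalSpace.MetrizableSpace K] [Uncountable K] :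
    ¬ ∃ τ : TopologicalSpace (C(K, ℝ) →L[ℝ] ℝ),
        @IsTopologicalAddGroup (C(K, ℝ) →L[ℝ] ℝ) τ _ ∧
        @ContinuousSMul ℝ (C(K, ℝ) →L[ℝ] ℝ) _ _ τ ∧
        @LocallyConvexSpace ℝ (C(K, ℝ) →L[ℝ] ℝ) _ _ _ _ τ ∧
        ∀ A : Set (C(K, ℝ) →L[ℝ] ℝ), Ienv A = @closure _ τ (convexHull ℝ A) := by
  rintro ⟨τ, h1, h2, h3, hI⟩
  letI := TopologicalSpace.metrizableSpaceMetric K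
  obtain ⟨e, -, he, hinj⟩ := (isClosed_univ (X := K)).exists_nat_bool_injection_of_not_countable
    (by rw [Set.countable_univ_iff]; exact not_countable)
  let p0 : Finset ℕ → (ℕ → Bool) := fun s n => if n ∈ s then !false else false
  let q0 : Finset ℕ → (ℕ → Bool) := fun s n => if n ∈ s then !true else true
  have hpq0 : ∀ s t, p0 s ≠ q0 t := by
    intro s t h
    obtain ⟨n, hn⟩ := Infinite.exists_notMem_finset (s ∪ t)
    have := congrFun h n
    simp only [Finset.mem_union, not_or] at hn
    simp [p0, q0, hn.1, hn.2] at this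
  let v : Finset ℕ ⊕ Finset ℕ → (C(K, ℝ) →L[ℝ] ℝ) := Sum.elim
    (fun s => ContinuousMap.evalCLM ℝ (e (p0 s)) - ContinuousMap.evalCLM ℝ (e (p0 ∅)))
    (fun s => ContinuousMap.evalCLM ℝ (e (q0 s)))
  have hnot := conv_dist (fun s => e (p0 s)) (fun s => e (q0 s))
    (fun s t h => hpq0 s t (hinj h)) ∅ v (fun _ => rfl) (fun _ => rfl)
  set A := Set.range (fun i : ℤ × (Finset ℕ ⊕ Finset ℕ) => i.1 • v i.2) with hA
  set ξ : C(K, ℝ) →L[ℝ] ℝ := ContinuousMap.evalCLM ℝ (e (p0 ∅)) with hξ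
  obtain ⟨u, hu⟩ := exists_surjective_nat (ℤ × (Finset ℕ ⊕ Finset ℕ))
  have hAr : A = Set.range ((fun i : ℤ × (Finset ℕ ⊕ Finset ℕ) => i.1 • v i.2) ∘ u) :=
    (hu.range_comp _).symm
  have hnI : ξ ∉ Ienv A := fun h => hnot (by
    rw [hAr] at h ⊢
    exact Ienv_countable _ h)
  rw [hI A] at hnI
  obtain ⟨F, hF0, hFξ, hFk⟩ := @lc_sep _ _ _ τ h1 h2 h3 A (by
    rintro _ ⟨⟨n, i⟩, rfl⟩ m
    exact ⟨(m * n, i), by simp [mul_smul]⟩) ξ (Set.range_nonempty _) hnI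
  rw [← hI] at hFk
  obtain ⟨x, a, ha, hx⟩ := F_B1 F ξ hFξ hFk
  refine baire_contra (fun n t => x n (e t)) (fun n => (x n).continuous.comp he)
    (fun t => a * F (ContinuousMap.evalCLM ℝ (e t)))
    (fun t => hx (ContinuousMap.evalCLM ℝ (e t))) _ _ (cantor_dense false) (cantor_dense true)
    (a * F ξ) (mul_ne_zero ha hFξ) ?_ ?_
  · rintro _ ⟨s, rfl⟩
    have := hF0 (v (Sum.inl s)) ⟨(1, Sum.inl s), by simp⟩
    simp only [v, Sum.elim_inl, map_sub, sub_eq_zero] at this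
    exact congrArg (a * ·) this
  · rintro _ ⟨s, rfl⟩
    have := hF0 (v (Sum.inr s)) ⟨(1, Sum.inr s), by simp⟩
    simp only [v, Sum.elim_inr] at this
    change a * F (ContinuousMap.evalCLM ℝ (e (q0 s))) = 0
    rw [this, mul_zero]
end

section
/- There exists a set E ⊆ [0,1] that is a countable union of closed sets (an F_σ set) such that for every nonempty open subset G of [0,1] one has λ(E ∩ G) > 0 and λ(G \ E) > 0, where λ denotes Lebesgue measure on [0,1]. -/
open MeasureTheory Set

lemma fat_aux (J C : Set ℝ) (hJ : IsOpen J) (hC : IsClosed C)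
    (hQ : ∀ q : ℚ, (q : ℝ) ∉ C) :
    ∃ K : Set ℝ, IsClosed K ∧ K ⊆ J \ C ∧ (∀ q : ℚ, (q : ℝ) ∉ K) ∧
      (J.Nonempty → 0 < volume K) := by
  by_cases hne : J.Nonempty
  · obtain ⟨q, hx⟩ := (Rat.denseRange_cast (𝕜 := ℝ)).exists_mem_open hJ hne
    have hU : IsOpen (J \ C) := hJ.sdiff hC
    have hpos : 0 < volume (J \ C) := hU.measure_pos volume ⟨_, hx, hQ q⟩
    have hc : (range ((↑) : ℚ → ℝ)).Countable := countable_range _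
    have hpos' : 0 < volume ((J \ C) \ range ((↑) : ℚ → ℝ)) := by
      rwa [measure_sdiff_null (hc.measure_zero volume)]
    obtain ⟨K, hK, hKc, hKp⟩ :=
      (hU.measurableSet.diff hc.measurableSet).exists_lt_isCompact hpos'
    exact ⟨K, hKc.isClosed, fun y hy => (hK hy).1, fun r hr => (hK hr).2 ⟨r, rfl⟩,
      fun _ => hKp⟩
  · exact ⟨∅, isClosed_empty, by simp, by simp, fun h => absurd h hne⟩

lemma seq_aux (J : ℕ → Set ℝ) (hJ : ∀ n, IsOpen (J n)) :
    ∃ K : ℕ → Set ℝ, (∀ n, IsClosed (K n)) ∧ (∀ n, K n ⊆ J n) ∧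
      (∀ n, (J n).Nonempty → 0 < volume (K n)) ∧
      (∀ m n, m < n → Disjoint (K m) (K n)) := by
  have step : ∀ (n : ℕ) (C : Set ℝ), ∃ K : Set ℝ, IsClosed C → (∀ q : ℚ, (q : ℝ) ∉ C) →
      IsClosed K ∧ K ⊆ J n \ C ∧ (∀ q : ℚ, (q : ℝ) ∉ K) ∧
      ((J n).Nonempty → 0 < volume K) := by
    intro n C
    by_cases h : IsClosed C ∧ (∀ q : ℚ, (q : ℝ) ∉ C)
    · obtain ⟨K, hK⟩ := fat_aux (J n) C (hJ n) h.1 h.2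
      exact ⟨K, fun _ _ => hK⟩
    · exact ⟨∅, fun h1 h2 => absurd ⟨h1, h2⟩ h⟩
  choose f hf using step
  let C : ℕ → Set ℝ := fun n => Nat.rec ∅ (fun n c => c ∪ f n c) n
  have hCs : ∀ n, C (n+1) = C n ∪ f n (C n) := fun n => rfl
  have hC : ∀ n, IsClosed (C n) ∧ ∀ q : ℚ, (q : ℝ) ∉ C n := by
    intro n
    induction n with
    | zero => exact ⟨isClosed_empty, fun q h => h⟩
    | succ n ih =>
      have h := hf n (C n) ih.1 ih.2
      rw [hCs]
      exact ⟨ih.1.union h.1, fun q hq => hq.elim (ih.2 q) (h.2.2.1 q)⟩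
  have H := fun n => hf n (C n) (hC n).1 (hC n).2
  have hmono : Monotone C := monotone_nat_of_le_succ fun n => by
    rw [hCs]; exact subset_union_left
  refine ⟨fun n => f n (C n), fun n => (H n).1, fun n x hx => ((H n).2.1 hx).1,
    fun n => (H n).2.2.2, fun m n hmn => ?_⟩
  rw [Set.disjoint_left]
  intro x hx hx'
  refine ((H n).2.1 hx').2 (hmono (Nat.succ_le_of_lt hmn) ?_)
  rw [Nat.succ_eq_add_one, hCs]
  exact Or.inr hx

theorem stmt13 :
    ∃ E : Set ℝ, E ⊆ Icc (0:ℝ) 1 ∧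
      (∃ F : ℕ → Set ℝ, (∀ n, IsClosed (F n)) ∧ E = ⋃ n, F n) ∧
      ∀ G : Set ℝ, IsOpen G → (G ∩ Icc (0:ℝ) 1).Nonempty →
        0 < volume (E ∩ G) ∧ 0 < volume ((Icc (0:ℝ) 1 ∩ G) \ E) := by
  have hb := TopologicalSpace.isBasis_countableBasis ℝ
  obtain ⟨x0, hx0⟩ : ∃ s, s ∈ TopologicalSpace.countableBasis ℝ := by
    obtain ⟨s, hs, -⟩ := hb.exists_subset_of_mem_open (mem_univ (0:ℝ)) isOpen_univ
    exact ⟨s, hs⟩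
  obtain ⟨B, hB⟩ := (TopologicalSpace.countable_countableBasis ℝ).exists_eq_range ⟨x0, hx0⟩
  have hBo : ∀ n, IsOpen (B n) := fun n => hb.isOpen (hB ▸ mem_range_self n)
  obtain ⟨K, hKc, hKJ, hKp, hKd⟩ := seq_aux (fun n => B (n / 2) ∩ Ioo 0 1)
    (fun n => (hBo _).inter isOpen_Ioo)
  refine ⟨⋃ n, K (2 * n), ?_, ⟨fun n => K (2 * n), fun n => hKc _, rfl⟩, ?_⟩
  · exact iUnion_subset fun n x hx => Ioo_subset_Icc_self (hKJ _ hx).2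
  · intro G hG hne
    have hne' : (G ∩ Ioo (0:ℝ) 1).Nonempty := by
      obtain ⟨x, hxG, hx⟩ := hne
      rw [← closure_Ioo (zero_ne_one (α := ℝ))] at hx
      exact mem_closure_iff.1 hx G hG hxG
    obtain ⟨x, hxG, hx⟩ := hne'
    obtain ⟨s, hs, hxs, hsG⟩ := hb.exists_subset_of_mem_open hxG hG
    rw [hB] at hs
    obtain ⟨n, rfl⟩ := hs
    have e0 : 2 * n / 2 = n := by omega
    have e1 : (2 * n + 1) / 2 = n := by omega
    constructor
    · refine (hKp (2 * n) ⟨x, by rw [e0]; exact hxs, hx⟩).trans_le (measure_mono ?_)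
      intro y hy
      have h := (hKJ _ hy).1
      rw [e0] at h
      exact ⟨mem_iUnion.2 ⟨n, hy⟩, hsG h⟩
    · refine (hKp (2 * n + 1) ⟨x, by rw [e1]; exact hxs, hx⟩).trans_le (measure_mono ?_)
      intro y hy
      have h := (hKJ _ hy)
      simp only [e1] at h
      refine ⟨⟨Ioo_subset_Icc_self h.2, hsG h.1⟩, fun hy' => ?_⟩
      obtain ⟨m, hm⟩ := mem_iUnion.1 hy'
      rcases lt_or_gt_of_ne (show 2 * m ≠ 2 * n + 1 by omega) with h1 | h1
      · exact Set.disjoint_left.1 (hKd _ _ h1) hm hy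
      · exact Set.disjoint_left.1 (hKd _ _ h1) hy hm
end

section
/- Let X be a nonempty set, β : 𝒫(X) → 𝒫(X) a closure operator (β(∅)=∅, A ⊆ β(A) for all A, and β(A∪B)=β(A)∪β(B) for all A,B), and α : 𝒫(X) → 𝒫(X) a monotone map with α(∅)=∅, A ⊆ α(A) and β(A) ⊆ α(A) for all A ⊆ X. Define γ₁(A) = ⋂ { β(α(A₁) ∪ … ∪ α(A_n)) : n ∈ ℕ, A = A₁ ∪ … ∪ A_n } and γ₂(A) = ⋂ { β(⋃_{n∈ℕ} α(A_n)) : A = ⋃_{n∈ℕ} A_n }. Then: (a) γ₁ and γ₂ are closure operators; (b) β(A) ⊆ γ₂(A) ⊆ γ₁(A) ⊆ α(α(A)) for every A ⊆ X; (c) if α is idempotent (α(α(A)) = α(A) for all A) then γ₁ is idempotent (γ₁(γ₁(A)) = γ₁(A) for all A). -/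
/-- `γ₁(A) = ⋂ { β(α(A₁) ∪ … ∪ α(A_n)) : n ∈ ℕ, A = A₁ ∪ … ∪ A_n }`. -/
def gamma1 {X : Type*} (α β : Set X → Set X) (A : Set X) : Set X :=
  ⋂ (n : ℕ) (As : Fin n → Set X) (_ : A = ⋃ i, As i), β (⋃ i, α (As i))

/-- `γ₂(A) = ⋂ { β(⋃_{n∈ℕ} α(A_n)) : A = ⋃_{n∈ℕ} A_n }`. -/
def gamma2 {X : Type*} (α β : Set X → Set X) (A : Set X) : Set X :=
  ⋂ (As : ℕ → Set X) (_ : A = ⋃ n, As n), β (⋃ n, α (As n))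

/-- A closure operator on a set. -/
def IsClosureOp {X : Type*} (γ : Set X → Set X) : Prop :=
  γ ∅ = ∅ ∧ (∀ A, A ⊆ γ A) ∧ ∀ A B, γ (A ∪ B) = γ A ∪ γ B

theorem aux_mono {X : Type*} {β : Set X → Set X} (hβ : IsClosureOp β) {A B : Set X}
    (h : A ⊆ B) : β A ⊆ β B := by
  have h2 := hβ.2.2 A B
  rw [Set.union_eq_self_of_subset_left h] at h2
  rw [h2]
  exact Set.subset_union_left

theorem mem_gamma1 {X : Type*} (α β : Set X → Set X) (A : Set X) (x : X) :
    x ∈ gamma1 α β A ↔ ∀ ι : Type, Finite ι → ∀ As : ι → Set X, A = ⋃ i, As i →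
      x ∈ β (⋃ i, α (As i)) := by
  simp only [gamma1, Set.mem_iInter]
  constructor
  · intro h ι hι As hA
    obtain ⟨n, ⟨e⟩⟩ := Finite.exists_equiv_fin ι
    have := h n (fun i => As (e.symm i)) (by rw [hA]; exact (e.symm.surjective.iUnion_comp As).symm)
    rwa [e.symm.surjective.iUnion_comp (fun i => α (As i))] at this
  · intro h n As hA
    exact h (Fin n) inferInstance As hA

theorem mem_gamma2 {X : Type*} (α β : Set X → Set X) (hα0 : α ∅ = ∅) (A : Set X) (x : X) :
    x ∈ gamma2 α β A ↔ ∀ ι : Type, Countable ι → ∀ As : ι → Set X, A = ⋃ i, As i →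
      x ∈ β (⋃ i, α (As i)) := by
  simp only [gamma2, Set.mem_iInter]
  constructor
  · intro h ι hι As hA
    rcases isEmpty_or_nonempty ι with he | he
    · have := h (fun _ => ∅) (by rw [hA]; simp)
      simpa [hα0] using this
    · obtain ⟨f, hf⟩ := exists_surjective_nat ι
      have := h (fun i => As (f i)) (by rw [hA]; exact (hf.iUnion_comp As).symm)
      rwa [hf.iUnion_comp (fun i => α (As i))] at this
  · intro h As hA
    exact h ℕ inferInstance As hA

theorem aux_closure {X : Type*} (α β γ : Set X → Set X) (P : Type → Prop)
    (hβ : IsClosureOp β)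
    (hαmono : ∀ A B : Set X, A ⊆ B → α A ⊆ α B)
    (hα1 : ∀ A : Set X, A ⊆ α A)
    (hP0 : P Empty) (hPs : ∀ a b, P a → P b → P (a ⊕ b))
    (hγ : ∀ A x, x ∈ γ A ↔ ∀ ι : Type, P ι → ∀ As : ι → Set X, A = ⋃ i, As i →
      x ∈ β (⋃ i, α (As i))) :
    IsClosureOp γ ∧ ∀ A, β A ⊆ γ A := by
  have hb : ∀ A, β A ⊆ γ A := by
    intro A x hx
    rw [hγ]
    intro ι _ As hA
    refine aux_mono hβ ?_ hx
    rw [hA]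
    exact Set.iUnion_mono fun i => hα1 _
  have hm : ∀ A B, A ⊆ B → γ A ⊆ γ B := by
    intro A B hAB x hx
    rw [hγ] at hx ⊢
    intro ι hι Bs hB
    have := hx ι hι (fun i => A ∩ Bs i) (by
      rw [← Set.inter_iUnion, ← hB, Set.inter_eq_left.2 hAB])
    exact aux_mono hβ (Set.iUnion_mono fun i => hαmono _ _ Set.inter_subset_right) this
  refine ⟨⟨?_, fun A => (hβ.2.1 A).trans (hb A), ?_⟩, hb⟩
  · ext x
    simp only [Set.mem_empty_iff_false, iff_false]
    intro hx
    rw [hγ] at hx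
    have := hx Empty hP0 (fun _ => ∅) (by simp)
    simp [hβ.1] at this
  · intro A B
    apply Set.Subset.antisymm
    · intro x hx
      by_contra hn
      rw [Set.mem_union, not_or, hγ, hγ] at hn
      obtain ⟨h1, h2⟩ := hn
      push Not at h1 h2
      obtain ⟨ι, hι, As, hA, h1⟩ := h1
      obtain ⟨κ, hκ, Bs, hB, h2⟩ := h2
      rw [hγ] at hx
      have := hx (ι ⊕ κ) (hPs _ _ hι hκ) (Sum.elim As Bs) (by
        rw [Set.iUnion_sum, hA, hB]; rfl)
      rw [Set.iUnion_sum, hβ.2.2] at this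
      exact this.elim h1 h2
    · exact Set.union_subset (hm _ _ Set.subset_union_left) (hm _ _ Set.subset_union_right)

theorem aux_iUnion {X : Type*} {γ : Set X → Set X} (hγ : IsClosureOp γ) :
    ∀ (n : ℕ) (As : Fin n → Set X), γ (⋃ i, As i) = ⋃ i, γ (As i) := by
  intro n
  induction n with
  | zero => intro As; simp [hγ.1]
  | succ n ih =>
    intro As
    have key : ∀ Bs : Fin (n+1) → Set X, ⋃ i, Bs i = Bs 0 ∪ ⋃ i : Fin n, Bs i.succ := by
      intro Bs
      ext x
      simp [Fin.exists_fin_succ]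
    rw [key, key, hγ.2.2, ih]

theorem stmt14 {X : Type*} [Nonempty X] (α β : Set X → Set X)
    (hβ : IsClosureOp β)
    (hαmono : ∀ A B : Set X, A ⊆ B → α A ⊆ α B)
    (hα0 : α ∅ = ∅) (hα1 : ∀ A : Set X, A ⊆ α A)
    (hβα : ∀ A : Set X, β A ⊆ α A) :
    (IsClosureOp (gamma1 α β) ∧ IsClosureOp (gamma2 α β)) ∧
    (∀ A : Set X, β A ⊆ gamma2 α β A ∧ gamma2 α β A ⊆ gamma1 α β A ∧
      gamma1 α β A ⊆ α (α A)) ∧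
    ((∀ A : Set X, α (α A) = α A) →
      ∀ A : Set X, gamma1 α β (gamma1 α β A) = gamma1 α β A) := by
  have c1 := aux_closure α β (gamma1 α β) (fun ι => Finite ι) hβ hαmono hα1 inferInstance
    (fun a b _ _ => inferInstance) (mem_gamma1 α β)
  have c2 := aux_closure α β (gamma2 α β) (fun ι => Countable ι) hβ hαmono hα1 inferInstance
    (fun a b _ _ => inferInstance) (mem_gamma2 α β hα0)
  have h3 : ∀ A : Set X, gamma1 α β A ⊆ α (α A) := by
    intro A x hx
    rw [mem_gamma1] at hx
    have := hx Unit inferInstance (fun _ => A) (Set.iUnion_const A).symm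
    rw [Set.iUnion_const] at this
    exact hβα _ this
  refine ⟨⟨c1.1, c2.1⟩, fun A => ⟨c2.2 A, ?_, h3 A⟩, ?_⟩
  · intro x hx
    rw [mem_gamma2 α β hα0] at hx
    rw [mem_gamma1]
    intro ι hι As hA
    exact hx ι inferInstance As hA
  · intro hid A
    apply Set.Subset.antisymm _ (c1.1.2.1 _)
    intro x hx
    simp only [gamma1, Set.mem_iInter]
    intro n As hA
    rw [mem_gamma1] at hx
    have := hx (Fin n) inferInstance (fun i => gamma1 α β (As i)) (by
      rw [hA]; exact aux_iUnion c1.1 n As)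
    refine aux_mono hβ (Set.iUnion_mono fun i => ?_) this
    have h4 := hαmono _ _ (h3 (As i))
    rwa [hid, hid] at h4
end

section
/- Let X be a real Banach space. The following are equivalent: (1) there is a topology τ on X* such that Ienv(A) equals the τ-closure of conv(A) for every A ⊆ X*; (2) whenever A₁, …, A_n are convex subsets of X* such that A₁ ∪ … ∪ A_n is convex, one has Ienv(A₁ ∪ … ∪ A_n) = Ienv(A₁) ∪ … ∪ Ienv(A_n); (3) Ienv(A) = cl_IF(conv(A)) for every A ⊆ X*, where cl_IF(B) = ⋂ { Ienv(B₁) ∪ … ∪ Ienv(B_n) : n ∈ ℕ, B = B₁ ∪ … ∪ B_n }. -/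
open Filter Topology

/-- `cl_IF(A) = ⋂ { Ienv(A₁) ∪ … ∪ Ienv(A_n) : n ∈ ℕ, A = A₁ ∪ … ∪ A_n }`. -/
def clIF {E : Type*} [NormedAddCommGroup E] [NormedSpace ℝ E]
    (A : Set (E →L[ℝ] ℝ)) : Set (E →L[ℝ] ℝ) :=
  ⋂ (n : ℕ) (As : Fin n → Set (E →L[ℝ] ℝ)) (_ : A = ⋃ i, As i), ⋃ i, Ienv (As i)

open scoped Pointwise

lemma wTop_eq (X : Type*) [NormedAddCommGroup X] [NormedSpace ℝ X] :
    wstarTop X = (inferInstance : TopologicalSpace (WeakDual ℝ X)) := rfl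

lemma gen_join {V : Type*} [AddCommGroup V] [Module ℝ V] [TopologicalSpace V] [ContinuousAdd V]
    [ContinuousSMul ℝ V] {K L : Set V} (hK : IsCompact K) (hL : IsCompact L)
    (cK : Convex ℝ K) (cL : Convex ℝ L) : IsCompact (convexHull ℝ (K ∪ L)) := by
  rcases K.eq_empty_or_nonempty with rfl | nK
  · simpa [cL.convexHull_eq] using hL
  rcases L.eq_empty_or_nonempty with rfl | nL
  · simpa [cK.convexHull_eq] using hK
  rw [cK.convexHull_union cL nK nL]
  have h : IsCompact ((fun p : ℝ × V × V => (1 - p.1) • p.2.1 + p.1 • p.2.2) ''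
      (Set.Icc (0:ℝ) 1 ×ˢ K ×ˢ L)) := by
    refine (isCompact_Icc.prod (hK.prod hL)).image ?_
    fun_prop
  convert h using 1
  ext x
  simp only [mem_convexJoin, segment_eq_image, Set.mem_image, Set.mem_prod, Prod.exists]
  constructor
  · rintro ⟨a, ha, b, hb, t, ht, rfl⟩
    exact ⟨t, a, b, ⟨ht, ha, hb⟩, rfl⟩
  · rintro ⟨t, a, b, ⟨ht, ha, hb⟩, rfl⟩
    exact ⟨a, ha, b, hb, t, ht, rfl⟩

section
variable {X : Type*} [NormedAddCommGroup X] [NormedSpace ℝ X]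

/-- weak* compact -/
def WC (K : Set (X →L[ℝ] ℝ)) : Prop := @IsCompact _ (wstarTop X) K

lemma wc_join {K L : Set (X →L[ℝ] ℝ)} (hK : WC K) (hL : WC L)
    (cK : Convex ℝ K) (cL : Convex ℝ L) : WC (convexHull ℝ (K ∪ L)) :=
  gen_join (V := WeakDual ℝ X) hK hL cK cL

lemma wc_add {K L : Set (X →L[ℝ] ℝ)} (hK : WC K) (hL : WC L) : WC (K + L) :=
  IsCompact.add (N := WeakDual ℝ X) hK hL

lemma wc_ball (r : ℝ) : WC (Metric.closedBall (0 : X →L[ℝ] ℝ) r) :=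
  WeakDual.isCompact_closedBall (𝕜 := ℝ) (E := X) 0 r

lemma wc_closure {K A : Set (X →L[ℝ] ℝ)} (hK : WC K) (h : A ⊆ K) : wstarClosure A ⊆ K := by
  have hc : @IsClosed _ (wstarTop X) K := IsCompact.isClosed (X := WeakDual ℝ X) hK
  exact @closure_minimal _ (wstarTop X) _ _ h hc

lemma wc_closure' {K A : Set (X →L[ℝ] ℝ)} (hK : WC K) (h : A ⊆ K) : WC (wstarClosure A) :=
  IsCompact.of_isClosed_subset (X := WeakDual ℝ X) hK (@isClosed_closure _ (wstarTop X) A)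
    (wc_closure hK h)

lemma convex_wc {A : Set (X →L[ℝ] ℝ)} (h : Convex ℝ A) : Convex ℝ (wstarClosure A) :=
  Convex.closure (𝕜 := ℝ) (E := WeakDual ℝ X) h

lemma subset_wc {A : Set (X →L[ℝ] ℝ)} : A ⊆ wstarClosure A :=
  @subset_closure _ (wstarTop X) A

lemma wc_mono {A B : Set (X →L[ℝ] ℝ)} (h : A ⊆ B) : wstarClosure A ⊆ wstarClosure B :=
  @closure_mono _ (wstarTop X) _ _ h

lemma Ienv_sub {A : Set (X →L[ℝ] ℝ)} (As : ℕ → Set (X →L[ℝ] ℝ)) (h : A ⊆ ⋃ n, As n) :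
    Ienv A ⊆ closure (convexHull ℝ (⋃ n, wstarClosure (convexHull ℝ (As n)))) := by
  intro x hx
  have h2 : A = ⋃ n, (A ∩ As n) := by
    rw [← Set.inter_iUnion]; exact (Set.inter_eq_left.2 h).symm
  have := Set.mem_iInter₂.1 hx _ h2
  refine closure_mono (convexHull_mono (Set.iUnion_mono fun n => wc_mono (convexHull_mono ?_))) this
  exact Set.inter_subset_right

lemma key {A : Set (X →L[ℝ] ℝ)} (As : ℕ → Set (X →L[ℝ] ℝ)) (hA : A = ⋃ n, As n) :
    ∃ D : Set (X →L[ℝ] ℝ), Convex ℝ D ∧ A ⊆ D ∧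
      D ⊆ convexHull ℝ (⋃ n, wstarClosure (convexHull ℝ (As n))) ∧
      ∀ S ⊆ closure D, Ienv S ⊆ closure D := by
  let A' : ℕ → Set (X →L[ℝ] ℝ) := fun n =>
    As n.unpair.1 ∩ Metric.closedBall 0 (n.unpair.2 : ℝ)
  let L : ℕ → Set (X →L[ℝ] ℝ) := fun n => wstarClosure (convexHull ℝ (A' n))
  have hLc : ∀ n, WC (L n) := fun n => wc_closure' (wc_ball (n.unpair.2 : ℝ))
    (convexHull_min Set.inter_subset_right (convex_closedBall _ _))
  have hLv : ∀ n, Convex ℝ (L n) := fun n => convex_wc (convex_convexHull _ _)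
  let K : ℕ → Set (X →L[ℝ] ℝ) := fun n => Nat.rec ∅ (fun n K => convexHull ℝ (K ∪ L n)) n
  have hKs : ∀ n, K (n+1) = convexHull ℝ (K n ∪ L n) := fun n => rfl
  have hKv : ∀ n, Convex ℝ (K n) := by
    intro n
    cases n with
    | zero => exact convex_empty
    | succ n => exact convex_convexHull _ _
  have hKc : ∀ n, WC (K n) := by
    intro n
    induction n with
    | zero => exact @isCompact_empty _ (wstarTop X)
    | succ n ih => exact wc_join ih (hLc n) (hKv n) (hLv n)
  have hKm : Monotone K := monotone_nat_of_le_succ fun n =>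
    Set.subset_union_left.trans (subset_convexHull ℝ _)
  have hLK : ∀ n, L n ⊆ K (n+1) := fun n => Set.subset_union_right.trans (subset_convexHull ℝ _)
  have hDv : Convex ℝ (⋃ n, K n) := hKm.directed_le.convex_iUnion fun n => hKv n
  refine ⟨⋃ n, K n, hDv, ?_, ?_, ?_⟩
  · rw [hA]
    intro x hx
    obtain ⟨n, hn⟩ := Set.mem_iUnion.1 hx
    obtain ⟨m, hm⟩ := exists_nat_ge ‖x‖
    refine Set.mem_iUnion.2 ⟨Nat.pair n m + 1, hLK _ (subset_wc (subset_convexHull ℝ _ ?_))⟩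
    simp only [A', Nat.unpair_pair]
    exact ⟨hn, by simpa using hm⟩
  · refine Set.iUnion_subset fun n => ?_
    induction n with
    | zero => exact Set.empty_subset _
    | succ n ih =>
      refine convexHull_min (Set.union_subset ih ?_) (convex_convexHull _ _)
      refine Set.Subset.trans ?_ (subset_convexHull ℝ _)
      refine Set.Subset.trans ?_ (Set.subset_iUnion _ n.unpair.1)
      exact wc_mono (convexHull_mono Set.inter_subset_left)
  · intro S hS x hx
    rw [Metric.mem_closure_iff]
    intro ε hε
    have h1 : S ⊆ ⋃ n, (K n + Metric.closedBall 0 (ε/2)) := by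
      intro y hy
      obtain ⟨z, hz, hd⟩ := Metric.mem_closure_iff.1 (hS hy) (ε/2) (by positivity)
      obtain ⟨n, hn⟩ := Set.mem_iUnion.1 hz
      refine Set.mem_iUnion.2 ⟨n, Set.mem_add.2 ⟨z, hn, y - z, ?_, by simp⟩⟩
      rw [dist_eq_norm] at hd
      simpa using hd.le
    have h2 := Ienv_sub _ h1 hx
    have h3 : convexHull ℝ (⋃ n, wstarClosure (convexHull ℝ (K n + Metric.closedBall 0 (ε/2))))
        ⊆ (⋃ n, K n) + Metric.closedBall 0 (ε/2) := by
      refine convexHull_min (Set.iUnion_subset fun n => ?_) (hDv.add (convex_closedBall _ _))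
      refine Set.Subset.trans (wc_closure (wc_add (hKc n) (wc_ball (ε/2))) ?_)
        (Set.add_subset_add_right (Set.subset_iUnion _ n))
      exact convexHull_min subset_rfl ((hKv n).add (convex_closedBall _ _))
    obtain ⟨y, hy, hxy⟩ := Metric.mem_closure_iff.1 h2 (ε/2) (by positivity)
    obtain ⟨z, hz, w, hw, rfl⟩ := Set.mem_add.1 (h3 hy)
    refine ⟨z, hz, ?_⟩
    have hw' : ‖w‖ ≤ ε/2 := by simpa using hw
    have : dist (z + w) z ≤ ε/2 := by simpa [dist_eq_norm] using hw'
    linarith [dist_triangle x (z + w) z]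

lemma sub_Ienv (A : Set (X →L[ℝ] ℝ)) : A ⊆ Ienv A := by
  refine Set.subset_iInter₂ fun As h => ?_
  obtain ⟨D, -, h1, h2, -⟩ := key As h
  exact h1.trans (h2.trans subset_closure)

lemma Ienv_mono {A B : Set (X →L[ℝ] ℝ)} (h : A ⊆ B) : Ienv A ⊆ Ienv B :=
  Set.subset_iInter₂ fun As hB => Ienv_sub As (hB ▸ h)

lemma Ienv_convex (A : Set (X →L[ℝ] ℝ)) : Convex ℝ (Ienv A) :=
  convex_iInter₂ fun _ _ => (convex_convexHull _ _).closure

lemma Ienv_hull (A : Set (X →L[ℝ] ℝ)) : Ienv (convexHull ℝ A) = Ienv A := by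
  refine Set.Subset.antisymm (Set.subset_iInter₂ fun As h => ?_)
    (Ienv_mono (subset_convexHull ℝ A))
  obtain ⟨D, h0, h1, h2, h3⟩ := key As h
  exact (h3 _ ((convexHull_min h1 h0).trans subset_closure)).trans (closure_mono h2)

lemma Ienv_idem (A : Set (X →L[ℝ] ℝ)) : Ienv (Ienv A) ⊆ Ienv A := by
  refine Set.subset_iInter₂ fun As h => ?_
  obtain ⟨D, h0, h1, h2, h3⟩ := key As h
  exact (h3 _ (h3 _ (h1.trans subset_closure))).trans (closure_mono h2)

lemma clIF_sub {A : Set (X →L[ℝ] ℝ)} {n : ℕ} (As : Fin n → Set (X →L[ℝ] ℝ))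
    (h : A ⊆ ⋃ i, As i) : clIF A ⊆ ⋃ i, Ienv (As i) := by
  intro x hx
  simp only [clIF, Set.mem_iInter] at hx
  have h2 : A = ⋃ n, (A ∩ As n) := by
    rw [← Set.inter_iUnion]; exact (Set.inter_eq_left.2 h).symm
  exact Set.iUnion_mono (fun i => Ienv_mono Set.inter_subset_right) (hx n _ h2)

lemma le_clIF {A B : Set (X →L[ℝ] ℝ)}
    (h : ∀ (n : ℕ) (As : Fin n → Set (X →L[ℝ] ℝ)), A = ⋃ i, As i → B ⊆ ⋃ i, Ienv (As i)) :
    B ⊆ clIF A := by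
  intro x hx
  simp only [clIF, Set.mem_iInter]
  exact fun n As hA => h n As hA hx

lemma sub_clIF (A : Set (X →L[ℝ] ℝ)) : A ⊆ clIF A :=
  le_clIF fun _ _ h => h.le.trans (Set.iUnion_mono fun _ => sub_Ienv _)

lemma clIF_mono {A B : Set (X →L[ℝ] ℝ)} (h : A ⊆ B) : clIF A ⊆ clIF B :=
  le_clIF fun _ As hB => clIF_sub As (hB ▸ h)

lemma clIF_idem (A : Set (X →L[ℝ] ℝ)) : clIF (clIF A) ⊆ clIF A :=
  le_clIF fun _ As hA => (clIF_sub (fun i => Ienv (As i)) (clIF_sub As hA.le)).trans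
    (Set.iUnion_mono fun _ => Ienv_idem _)

lemma clIF_union (A B : Set (X →L[ℝ] ℝ)) : clIF (A ∪ B) ⊆ clIF A ∪ clIF B := by
  intro x hx
  by_contra hc
  simp only [Set.mem_union, not_or] at hc
  obtain ⟨h1, h2⟩ := hc
  simp only [clIF, Set.mem_iInter, not_forall] at h1 h2
  obtain ⟨n, As, hA, hxA⟩ := h1
  obtain ⟨m, Bs, hB, hxB⟩ := h2
  have h : A ∪ B ⊆ ⋃ i, Fin.append As Bs i := by
    rw [hA, hB]
    refine Set.union_subset (Set.iUnion_subset fun i => ?_) (Set.iUnion_subset fun i => ?_)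
    · have := Set.subset_iUnion (Fin.append As Bs) (Fin.castAdd m i)
      rwa [Fin.append_left] at this
    · have := Set.subset_iUnion (Fin.append As Bs) (Fin.natAdd n i)
      rwa [Fin.append_right] at this
  obtain ⟨i, hi⟩ := Set.mem_iUnion.1 (clIF_sub _ h hx)
  induction i using Fin.addCases with
  | left i => rw [Fin.append_left] at hi; exact hxA (Set.mem_iUnion.2 ⟨i, hi⟩)
  | right i => rw [Fin.append_right] at hi; exact hxB (Set.mem_iUnion.2 ⟨i, hi⟩)

lemma clIF_empty : clIF (∅ : Set (X →L[ℝ] ℝ)) ⊆ ∅ := by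
  have := clIF_sub (A := (∅ : Set (X →L[ℝ] ℝ))) (n := 0) (fun _ => ∅) (Set.empty_subset _)
  simpa using this

/-- topology with closure operator clIF -/
def topIF (X : Type*) [NormedAddCommGroup X] [NormedSpace ℝ X] :
    TopologicalSpace (X →L[ℝ] ℝ) :=
  TopologicalSpace.ofClosed {A | clIF A ⊆ A} clIF_empty
    (fun _ hA => Set.subset_sInter fun _ hB =>
      (clIF_mono (Set.sInter_subset_of_mem hB)).trans (hA hB))
    (fun A hA B hB => (clIF_union A B).trans (Set.union_subset_union hA hB))

lemma closure_topIF (A : Set (X →L[ℝ] ℝ)) : @closure _ (topIF X) A = clIF A := by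
  have hc : ∀ B : Set (X →L[ℝ] ℝ), @IsClosed _ (topIF X) B ↔ clIF B ⊆ B := by
    intro B
    rw [← @isOpen_compl_iff _ _ (topIF X)]
    change clIF (Bᶜᶜ) ⊆ Bᶜᶜ ↔ _
    rw [compl_compl]
  refine Set.Subset.antisymm ?_ ?_
  · exact @closure_minimal _ (topIF X) _ _ (sub_clIF A) ((hc _).2 (clIF_idem A))
  · exact (clIF_mono (@subset_closure _ (topIF X) A)).trans
      ((hc _).1 (@isClosed_closure _ (topIF X) A))

end

theorem stmt16 {X : Type*} [NormedAddCommGroup X] [NormedSpace ℝ X] [CompleteSpace X] :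
    List.TFAE
      [ ∃ τ : TopologicalSpace (X →L[ℝ] ℝ),
          ∀ A : Set (X →L[ℝ] ℝ), Ienv A = @closure _ τ (convexHull ℝ A),
        ∀ (n : ℕ) (As : Fin n → Set (X →L[ℝ] ℝ)),
          (∀ i, Convex ℝ (As i)) → Convex ℝ (⋃ i, As i) →
          Ienv (⋃ i, As i) = ⋃ i, Ienv (As i),
        ∀ A : Set (X →L[ℝ] ℝ), Ienv A = clIF (convexHull ℝ A) ] := by
  tfae_have 1 → 2 := by
    rintro ⟨τ, h⟩ n As hc hu
    rw [h, hu.convexHull_eq, @closure_iUnion_of_finite _ τ]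
    exact Set.iUnion_congr fun i => by rw [h, (hc i).convexHull_eq]
  tfae_have 2 → 3 := by
    intro h A
    rw [← Ienv_hull]
    refine Set.Subset.antisymm (le_clIF fun n Bs hB => ?_) ?_
    · have e : convexHull ℝ A = ⋃ i, (convexHull ℝ A ∩ Ienv (Bs i)) := by
        rw [← Set.inter_iUnion]
        refine (Set.inter_eq_left.2 ?_).symm
        exact hB.le.trans (Set.iUnion_mono fun _ => sub_Ienv _)
      have h2 := h n (fun i => convexHull ℝ A ∩ Ienv (Bs i))
        (fun i => (convex_convexHull _ _).inter (Ienv_convex _)) (e ▸ convex_convexHull _ _)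
      rw [← e] at h2
      rw [h2]
      exact Set.iUnion_mono fun i => (Ienv_mono Set.inter_subset_right).trans (Ienv_idem _)
    · have := clIF_sub (A := convexHull ℝ A) (n := 1) (fun _ => convexHull ℝ A)
        (fun x hx => Set.mem_iUnion.2 ⟨0, hx⟩)
      exact this.trans (Set.iUnion_subset fun _ => subset_rfl)
  tfae_have 3 → 1 := by
    intro h
    exact ⟨topIF X, fun A => by rw [closure_topIF, h]⟩
  tfae_finish
end

section
/- Let X be a real Banach space. For every A ⊆ X*: (i) Icl(A) = Iccl(A), where Icl(A) = ⋂ { norm-closure of ⋃_{n∈ℕ} weak*-closure(A_n) : A = ⋃_{n∈ℕ} A_n } and Iccl(A) = ⋂ { norm-closure of ⋃_{n∈ℕ} weak*-closure(conv(A_n)) : A = ⋃_{n∈ℕ} A_n }; (ii) cl_IF(A) ⊆ Ienv(A) ∩ weak*-closure(A), where cl_IF(A) = ⋂ { Ienv(A₁) ∪ … ∪ Ienv(A_n) : n ∈ ℕ, A = A₁ ∪ … ∪ A_n }. -/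
open Filter Topology

/-- `(I)-cl(A)`: as the (I)-envelope but with no convex hulls. -/
def Icl {E : Type*} [NormedAddCommGroup E] [NormedSpace ℝ E]
    (A : Set (E →L[ℝ] ℝ)) : Set (E →L[ℝ] ℝ) :=
  ⋂ (As : ℕ → Set (E →L[ℝ] ℝ)) (_ : A = ⋃ n, As n),
    closure (⋃ n, wstarClosure (As n))

/-- `(I)-c-cl(A)`: as the (I)-envelope but without the outer convex hull. -/
def Iccl {E : Type*} [NormedAddCommGroup E] [NormedSpace ℝ E]
    (A : Set (E →L[ℝ] ℝ)) : Set (E →L[ℝ] ℝ) :=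
  ⋂ (As : ℕ → Set (E →L[ℝ] ℝ)) (_ : A = ⋃ n, As n),
    closure (⋃ n, wstarClosure (convexHull ℝ (As n)))

lemma aux_cont {E : Type*} [NormedAddCommGroup E] [NormedSpace ℝ E] (x : E) :
    @Continuous _ _ (wstarTop E) _ (fun ξ : E →L[ℝ] ℝ => ξ x) := by
  letI := wstarTop E
  have h : @Continuous _ _ (wstarTop E) _ (fun (f : E →L[ℝ] ℝ) (x : E) => f x) :=
    continuous_induced_dom
  exact (continuous_apply x).comp h

lemma aux_half {E : Type*} [NormedAddCommGroup E] [NormedSpace ℝ E] (x : E) (c : ℝ)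
    (B : Set (E →L[ℝ] ℝ)) (hB : ∀ ξ ∈ B, c ≤ ξ x) :
    ∀ ξ ∈ wstarClosure (convexHull ℝ B), c ≤ ξ x := by
  have hc : Convex ℝ {ξ : E →L[ℝ] ℝ | c ≤ ξ x} := by
    intro a ha b hb s t hs ht hst
    simp only [Set.mem_setOf_eq, ContinuousLinearMap.add_apply, ContinuousLinearMap.smul_apply,
      smul_eq_mul] at *
    calc c = s * c + t * c := by rw [← add_mul, hst, one_mul]
      _ ≤ _ := add_le_add (mul_le_mul_of_nonneg_left ha hs) (mul_le_mul_of_nonneg_left hb ht)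
  have h1 : convexHull ℝ B ⊆ {ξ : E →L[ℝ] ℝ | c ≤ ξ x} := convexHull_min hB hc
  have h2 : @IsClosed _ (wstarTop E) {ξ : E →L[ℝ] ℝ | c ≤ ξ x} :=
    @IsClosed.preimage _ _ (wstarTop E) _ _ (aux_cont x) _ (isClosed_Ici (a := c))
  exact @closure_minimal _ (wstarTop E) _ _ h1 h2

lemma aux_env {E : Type*} [NormedAddCommGroup E] [NormedSpace ℝ E] (x : E) (c : ℝ)
    (B : Set (E →L[ℝ] ℝ)) (hB : ∀ ξ ∈ B, c ≤ ξ x) :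
    ∀ ξ ∈ Ienv B, c ≤ ξ x := by
  intro ξ hξ
  have h := Set.mem_iInter₂.1 hξ (fun _ => B) (Set.iUnion_const B).symm
  have hc : Convex ℝ {ξ : E →L[ℝ] ℝ | c ≤ ξ x} := by
    intro a ha b hb s t hs ht hst
    simp only [Set.mem_setOf_eq, ContinuousLinearMap.add_apply, ContinuousLinearMap.smul_apply,
      smul_eq_mul] at *
    calc c = s * c + t * c := by rw [← add_mul, hst, one_mul]
      _ ≤ _ := add_le_add (mul_le_mul_of_nonneg_left ha hs) (mul_le_mul_of_nonneg_left hb ht)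
  have h2 : IsClosed {ξ : E →L[ℝ] ℝ | c ≤ ξ x} :=
    isClosed_le continuous_const (by fun_prop)
  refine closure_minimal (convexHull_min ?_ hc) h2 h
  exact Set.iUnion_subset fun _ => aux_half x c B hB

lemma aux_sep {E : Type*} [NormedAddCommGroup E] [NormedSpace ℝ E]
    (A : Set (E →L[ℝ] ℝ)) (η : E →L[ℝ] ℝ) (h : η ∉ wstarClosure A) :
    ∃ I : Set E, I.Finite ∧ ∃ ε : E → ℝ, (∀ x, 0 < ε x) ∧
      ∀ ξ ∈ A, ∃ x ∈ I, ε x ≤ |ξ x - η x| := by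
  unfold wstarClosure at h
  rw [@mem_closure_iff_frequently _ (wstarTop E), Filter.not_frequently] at h
  unfold wstarTop at h
  rw [nhds_induced, nhds_pi, Filter.eventually_comap,
    (Filter.hasBasis_pi (fun _ => Metric.nhds_basis_ball)).eventually_iff] at h
  obtain ⟨⟨I, ε⟩, ⟨hI, hε⟩, h⟩ := h
  classical
  refine ⟨I, hI, fun x => if x ∈ I then ε x else 1, fun x => ?_, fun ξ hξ => ?_⟩
  · dsimp only
    split_ifs with hx
    · exact hε x hx
    · exact one_pos
  · by_contra! hcon
    refine h (x := fun x => ξ x) ?_ ξ rfl hξ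
    intro x hx
    have := hcon x hx
    rw [if_pos hx] at this
    simpa [Real.dist_eq] using this

lemma aux_compact {E : Type*} [NormedAddCommGroup E] [NormedSpace ℝ E]
    (B : Set (E →L[ℝ] ℝ)) (m : ℝ) (hB : B ⊆ Metric.closedBall 0 m) :
    @IsCompact _ (wstarTop E) (wstarClosure B) := by
  have h1 : @IsCompact _ (wstarTop E) (Metric.closedBall (0 : E →L[ℝ] ℝ) m) :=
    WeakDual.isCompact_closedBall (𝕜 := ℝ) (E := E) 0 m
  have h2 : @IsClosed _ (wstarTop E) (Metric.closedBall (0 : E →L[ℝ] ℝ) m) :=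
    WeakDual.isClosed_closedBall (𝕜 := ℝ) (E := E) 0 m
  exact @IsCompact.of_isClosed_subset _ (wstarTop E) _ _ h1 (@isClosed_closure _ (wstarTop E) B)
    (@closure_minimal _ (wstarTop E) _ _ hB h2)

lemma aux_norm {E : Type*} [NormedAddCommGroup E] [NormedSpace ℝ E]
    (f : E →L[ℝ] ℝ) (s r : ℝ) (hs : 0 ≤ s) (hsr : s < r) (h : r ≤ ‖f‖) :
    ∃ x : E, ‖x‖ ≤ 1 ∧ s < f x := by
  by_contra! hcon
  have : ‖f‖ ≤ s := by
    refine ContinuousLinearMap.opNorm_le_of_unit_norm hs fun x hx => ?_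
    rw [Real.norm_eq_abs, abs_le]
    have h1 := hcon x hx.le
    have h2 := hcon (-x) (by rw [norm_neg, hx])
    rw [map_neg] at h2
    constructor <;> linarith
  linarith

lemma aux_finite {E : Type*} [NormedAddCommGroup E] [NormedSpace ℝ E]
    (B : Set (E →L[ℝ] ℝ)) (m : ℝ) (hB : B ⊆ Metric.closedBall 0 m) (η : E →L[ℝ] ℝ)
    (r : ℝ) (hr : 0 < r) (h : ∀ ξ ∈ wstarClosure B, r ≤ ‖ξ - η‖) :
    ∃ T : Set E, T.Finite ∧ (∀ x ∈ T, ‖x‖ ≤ 1) ∧ ∀ ξ ∈ B, ∃ x ∈ T, η x + r / 2 < ξ x := by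
  have hK := aux_compact B m hB
  obtain ⟨T, hT1, hT2, hT3⟩ := @IsCompact.elim_finite_subcover_image _ _ (wstarTop E) _ 
    {x : E | ‖x‖ ≤ 1} (fun x => {ξ : E →L[ℝ] ℝ | η x + r / 2 < ξ x}) hK
    (fun x _ => @IsOpen.preimage _ _ (wstarTop E) _ _ (aux_cont x) _
      (isOpen_Ioi (a := η x + r / 2)))
    (by
      intro ξ hξ
      obtain ⟨x, hx, hx'⟩ := aux_norm (ξ - η) (r / 2) r (by linarith) (by linarith) (h ξ hξ)
      rw [ContinuousLinearMap.sub_apply] at hx'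
      refine Set.mem_iUnion₂.2 ⟨x, hx, ?_⟩
      show η x + r / 2 < ξ x
      linarith)
  refine ⟨T, hT2, hT1, fun ξ hξ => ?_⟩
  obtain ⟨x, hx, hx'⟩ := Set.mem_iUnion₂.1 (hT3 (@subset_closure _ (wstarTop E) _ _ hξ))
  exact ⟨x, hx, hx'⟩

theorem stmt17 {X : Type*} [NormedAddCommGroup X] [NormedSpace ℝ X] [CompleteSpace X]
    (A : Set (X →L[ℝ] ℝ)) :
    Icl A = Iccl A ∧ clIF A ⊆ Ienv A ∩ wstarClosure A := by
  refine ⟨Set.Subset.antisymm ?_ ?_, fun η hη => ⟨?_, ?_⟩⟩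
  · refine Set.iInter₂_mono fun As _ => closure_mono (Set.iUnion_mono fun n => ?_)
    exact @closure_mono _ (wstarTop X) _ _ (subset_convexHull ℝ _)
  · intro η hη
    by_contra hn
    obtain ⟨As, hAs, hn⟩ : ∃ As : ℕ → Set (X →L[ℝ] ℝ), A = ⋃ n, As n ∧
        η ∉ closure (⋃ n, wstarClosure (As n)) := by
      by_contra! hcon
      exact hn (Set.mem_iInter₂.2 hcon)
    rw [Metric.mem_closure_iff] at hn
    push Not at hn
    obtain ⟨r, hr, hn⟩ := hn
    have key : ∀ p : ℕ × ℕ, ∃ T : Set X, T.Finite ∧ (∀ x ∈ T, ‖x‖ ≤ 1) ∧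
        ∀ ξ ∈ As p.1 ∩ Metric.closedBall 0 (p.2 : ℝ), ∃ x ∈ T, η x + r / 2 < ξ x := by
      intro p
      refine aux_finite _ p.2 Set.inter_subset_right η r hr fun ξ hξ => ?_
      have hmono : wstarClosure (As p.1 ∩ Metric.closedBall 0 (p.2 : ℝ)) ⊆ wstarClosure (As p.1) :=
        @closure_mono _ (wstarTop X) _ _ Set.inter_subset_left
      have := hn ξ (Set.mem_iUnion.2 ⟨p.1,
        hmono hξ⟩)
      rwa [dist_comm, dist_eq_norm] at this
    choose T hT1 hT2 hT3 using key
    have hcount : (insert 0 (⋃ p, T p)).Countable :=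
      (Set.countable_iUnion fun p => (hT1 p).countable).insert 0
    obtain ⟨f, hf⟩ := hcount.exists_eq_range ⟨0, Set.mem_insert _ _⟩
    have hf1 : ∀ n, ‖f n‖ ≤ 1 := by
      intro n
      have : f n ∈ insert 0 (⋃ p, T p) := hf ▸ Set.mem_range_self n
      rcases this with h | h
      · rw [h]; simp
      · obtain ⟨p, hp⟩ := Set.mem_iUnion.1 h
        exact hT2 p _ hp
    have h := Set.mem_iInter₂.1 hη (fun n => A ∩ {ξ | η (f n) + r / 2 ≤ ξ (f n)}) (by
      rw [← Set.inter_iUnion]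
      refine (Set.inter_eq_left.2 fun ξ hξ => ?_).symm
      rw [hAs] at hξ
      obtain ⟨n, hξn⟩ := Set.mem_iUnion.1 hξ
      obtain ⟨m, hm⟩ := exists_nat_ge ‖ξ‖
      obtain ⟨x, hx, hx'⟩ := hT3 (n, m) ξ ⟨hξn, by simpa using hm⟩
      have : x ∈ Set.range f := hf ▸ Set.mem_insert_of_mem _ (Set.mem_iUnion.2 ⟨_, hx⟩)
      obtain ⟨k, rfl⟩ := this
      exact Set.mem_iUnion.2 ⟨k, hx'.le⟩)
    rw [Metric.mem_closure_iff] at h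
    obtain ⟨ξ, hξ, hd⟩ := h (r / 2) (by linarith)
    obtain ⟨n, hξ⟩ := Set.mem_iUnion.1 hξ
    have h1 := aux_half (f n) (η (f n) + r / 2) _ (fun ξ h => h.2) ξ hξ
    rw [dist_comm, dist_eq_norm] at hd
    have h2 := (ξ - η).le_opNorm_of_le (hf1 n)
    rw [ContinuousLinearMap.sub_apply, Real.norm_eq_abs] at h2
    have h3 := le_abs_self (ξ (f n) - η (f n))
    linarith
  · have h := Set.mem_iInter.1 (Set.mem_iInter₂.1 hη 1 (fun _ => A)) (Set.iUnion_const A).symm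
    obtain ⟨_, h⟩ := Set.mem_iUnion.1 h
    exact h
  · by_contra hn
    obtain ⟨I, hI, ε, hε, h⟩ := aux_sep A η hn
    haveI := hI.to_subtype
    obtain ⟨n, ⟨e⟩⟩ := Finite.exists_equiv_fin (I × Bool)
    let y : I × Bool → X := fun p => if p.2 then p.1 else -p.1
    have h := Set.mem_iInter.1 (Set.mem_iInter₂.1 hη n
      (fun i => A ∩ {ξ | η (y (e.symm i)) + ε (e.symm i).1 ≤ ξ (y (e.symm i))})) (by
        rw [← Set.inter_iUnion]
        refine (Set.inter_eq_left.2 fun ξ hξ => ?_).symm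
        obtain ⟨x, hx, hx'⟩ := h ξ hξ
        rcases le_abs.1 hx' with h | h
        · refine Set.mem_iUnion.2 ⟨e (⟨x, hx⟩, true), ?_⟩
          simp [y]
          linarith
        · refine Set.mem_iUnion.2 ⟨e (⟨x, hx⟩, false), ?_⟩
          simp [y]
          linarith)
    obtain ⟨i, hi⟩ := Set.mem_iUnion.1 h
    have := aux_env _ _ _ (fun ξ h => h.2) η hi
    linarith [hε (e.symm i).1]
end

section
/- Let X be a real Banach space and A ⊆ X* a norm-separable subset. Then: (i) Iccl(A) equals the norm-closure of A, where Iccl(A) = ⋂ { norm-closure of ⋃_{n∈ℕ} weak*-closure(conv(A_n)) : A = ⋃_{n∈ℕ} A_n }; (ii) Iw(A) = cl_IF(A) = the closure of A in the weak topology σ(X*,X**), where Iw(A) = ⋂ { weak-closure of ⋃_{n∈ℕ} weak*-closure(conv(A_n)) : A = ⋃_{n∈ℕ} A_n } and cl_IF(A) = ⋂ { Ienv(A₁) ∪ … ∪ Ienv(A_n) : n ∈ ℕ, A = A₁ ∪ … ∪ A_n }; (iii) Ienv(A) equals the norm-closure of conv(A). -/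
open Filter Topology

/-- The weak topology on a normed space: pointwise convergence against all
continuous linear functionals (for the dual `X*`, this is `σ(X*, X**)`). -/
def weakTop (E : Type*) [NormedAddCommGroup E] [NormedSpace ℝ E] :
    TopologicalSpace E :=
  TopologicalSpace.induced (fun x (f : E →L[ℝ] ℝ) => f x) Pi.topologicalSpace

/-- `(I)-w(A)`: as `Iccl` but with the weak closure instead of the norm closure. -/
def Iw {E : Type*} [NormedAddCommGroup E] [NormedSpace ℝ E]
    (A : Set (E →L[ℝ] ℝ)) : Set (E →L[ℝ] ℝ) :=
  ⋂ (As : ℕ → Set (E →L[ℝ] ℝ)) (_ : A = ⋃ n, As n),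
    @closure _ (weakTop (E →L[ℝ] ℝ)) (⋃ n, wstarClosure (convexHull ℝ (As n)))

section Aux

variable {E : Type*} [NormedAddCommGroup E] [NormedSpace ℝ E]

theorem aux_subset_wstar (B : Set (E →L[ℝ] ℝ)) : B ⊆ wstarClosure (convexHull ℝ B) :=
  (subset_convexHull ℝ B).trans (@subset_closure _ (wstarTop E) _)

theorem aux_ball_closed (a : E →L[ℝ] ℝ) (r : ℝ) (hr : 0 ≤ r) :
    @IsClosed _ (wstarTop E) (Metric.closedBall a r) := by
  have h : Metric.closedBall a r =
      (fun (f : E →L[ℝ] ℝ) (x : E) => f x) ⁻¹' {g | ∀ x, |g x - a x| ≤ r * ‖x‖} := by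
    ext f
    simp only [Metric.mem_closedBall, dist_eq_norm, Set.mem_preimage, Set.mem_setOf_eq]
    rw [ContinuousLinearMap.opNorm_le_iff hr]
    rfl
  rw [h]
  refine @IsClosed.preimage _ _ (wstarTop E) _ _ continuous_induced_dom _ ?_
  rw [Set.setOf_forall]
  refine isClosed_iInter fun x => isClosed_le ?_ continuous_const
  fun_prop

theorem aux_cover (A : Set (E →L[ℝ] ℝ)) (hA : TopologicalSpace.IsSeparable A)
    {ε : ℝ} (hε : 0 < ε) : ∃ As : ℕ → Set (E →L[ℝ] ℝ), A = ⋃ n, As n ∧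
      (⋃ n, wstarClosure (convexHull ℝ (As n))) ⊆ Metric.cthickening ε A := by
  obtain ⟨c, hcA, hc, hd⟩ := hA.exists_countable_dense_subset
  rcases Set.eq_empty_or_nonempty c with rfl | hne
  · have : A = ∅ := by simpa using hd
    subst this
    refine ⟨fun _ => ∅, by simp, ?_⟩
    simp [wstarClosure, @closure_empty _ (wstarTop E)]
  obtain ⟨d, rfl⟩ := hc.exists_eq_range hne
  refine ⟨fun n => A ∩ Metric.closedBall (d n) ε, ?_, ?_⟩
  · rw [← Set.inter_iUnion]
    symm
    rw [Set.inter_eq_left]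
    intro y hy
    obtain ⟨_, ⟨n, rfl⟩, hz⟩ := Metric.mem_closure_iff.1 (hd hy) ε hε
    exact Set.mem_iUnion.2 ⟨n, hz.le⟩
  · refine Set.iUnion_subset fun n => ?_
    have h1 : convexHull ℝ (A ∩ Metric.closedBall (d n) ε) ⊆ Metric.closedBall (d n) ε :=
      convexHull_min Set.inter_subset_right (convex_closedBall _ _)
    have h2 : wstarClosure (convexHull ℝ (A ∩ Metric.closedBall (d n) ε)) ⊆
        Metric.closedBall (d n) ε :=
      @closure_minimal _ (wstarTop E) _ _ h1 (aux_ball_closed _ _ hε.le)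
    exact h2.trans (Metric.closedBall_subset_cthickening (hcA ⟨n, rfl⟩) ε)

theorem aux_weak_cont (F : E →L[ℝ] ℝ) :
    @Continuous _ _ (weakTop E) _ (fun y => F y) := by
  have h : @Continuous _ _ (weakTop E) _ (fun x (f : E →L[ℝ] ℝ) => f x) :=
    continuous_induced_dom
  exact @Continuous.comp _ _ _ (weakTop E) _ _ (fun x (f : E →L[ℝ] ℝ) => f x)
    (fun p : (E →L[ℝ] ℝ) → ℝ => p F) (continuous_apply F) h

theorem aux_weak_sep (A : Set E) (x : E) (hx : x ∉ @closure _ (weakTop E) A) :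
    ∃ s : Finset (E →L[ℝ] ℝ), ∃ ε : ℝ, 0 < ε ∧ ∀ y ∈ A, ∃ G ∈ s, ε ≤ G y - G x := by
  classical
  unfold weakTop at hx
  rw [closure_induced, mem_closure_iff_nhds] at hx
  push Not at hx
  obtain ⟨t, ht, hdis⟩ := hx
  rw [nhds_pi, Filter.mem_pi] at ht
  obtain ⟨I, hI, u, hu, hsub⟩ := ht
  choose e he hball using fun F => Metric.mem_nhds_iff.1 (hu F)
  obtain ⟨ε, hε, hεle⟩ : ∃ ε : ℝ, 0 < ε ∧ ∀ F ∈ I, ε ≤ e F := by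
    rcases Set.eq_empty_or_nonempty I with rfl | hne
    · exact ⟨1, one_pos, by simp⟩
    · obtain ⟨F, -, hmin⟩ := hI.exists_minimalFor e I hne
      obtain ⟨F, hF, hmin⟩ := Set.exists_min_image I e hI hne
      exact ⟨e F, he F, hmin⟩
  refine ⟨hI.toFinset ∪ hI.toFinset.image (fun F => -F), ε, hε, fun y hy => ?_⟩
  by_contra! hcon
  have : (fun f : E →L[ℝ] ℝ => f y) ∈ t ∩ ((fun x (f : E →L[ℝ] ℝ) => f x) '' A) := by
    refine ⟨hsub fun F hF => hball F ?_, ⟨y, hy, rfl⟩⟩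
    have h1 := hcon F (by simp [hF])
    have h2 := hcon (-F) (by simp [hF])
    simp only [ContinuousLinearMap.neg_apply] at h2
    rw [Metric.mem_ball, Real.dist_eq, abs_lt]
    have := hεle F hF
    constructor <;> linarith
  rw [hdis] at this
  exact this

theorem aux_weak_closed (s : Finset (E →L[ℝ] ℝ)) (x : E) (ε : ℝ) :
    @IsClosed _ (weakTop E) {y | ∃ G ∈ s, ε ≤ G y - G x} := by
  letI := weakTop E
  have : {y | ∃ G ∈ s, ε ≤ G y - G x} = ⋃ G ∈ s, (fun y => G y) ⁻¹' {r | ε ≤ r - G x} := by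
    ext y; simp
  rw [this]
  refine s.finite_toSet.isClosed_biUnion fun G _ => IsClosed.preimage (aux_weak_cont G) ?_
  exact isClosed_le continuous_const (by fun_prop)

theorem aux_weak_sub (A : Set E) :
    @closure _ (weakTop E) A ⊆ closure (convexHull ℝ A) := by
  intro x hx
  by_contra hn
  obtain ⟨f, u, h1, h2⟩ := geometric_hahn_banach_closed_point
    (convex_convexHull ℝ A).closure isClosed_closure hn
  have hcl : @IsClosed _ (weakTop E) ((fun y => f y) ⁻¹' Set.Iic u) :=
    @IsClosed.preimage _ _ (weakTop E) _ _ (aux_weak_cont f) _ isClosed_Iic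
  have hs : A ⊆ (fun y => f y) ⁻¹' Set.Iic u :=
    fun y hy => (h1 y (subset_closure (subset_convexHull ℝ A hy))).le
  have h3 := @closure_minimal _ (weakTop E) _ _ hs hcl
  exact absurd h2 (not_lt.2 (h3 hx))

theorem aux_Ienv_sup (A : Set (E →L[ℝ] ℝ)) : closure (convexHull ℝ A) ⊆ Ienv A := by
  refine Set.subset_iInter₂ fun As h => closure_mono (convexHull_mono ?_)
  rw [h]
  exact Set.iUnion_mono fun n => aux_subset_wstar _

theorem aux_closed_of_thick {A B : Set E}
    (h : ∀ ε > 0, B ⊆ Metric.cthickening ε A) : B ⊆ closure A := by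
  rw [Metric.closure_eq_iInter_cthickening]
  exact Set.subset_iInter₂ h

theorem aux_Ienv (A : Set (E →L[ℝ] ℝ)) (hA : TopologicalSpace.IsSeparable A) :
    Ienv A = closure (convexHull ℝ A) := by
  refine (aux_closed_of_thick fun ε hε => ?_).antisymm (aux_Ienv_sup A)
  obtain ⟨As, h, hs⟩ := aux_cover A hA hε
  refine (Set.iInter₂_subset As h).trans ?_
  refine closure_minimal (convexHull_min (hs.trans ?_) ?_) Metric.isClosed_cthickening
  · exact Metric.cthickening_subset_of_subset _ (subset_convexHull ℝ A)
  · exact (convex_convexHull ℝ A).cthickening ε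

theorem aux_Iccl (A : Set (E →L[ℝ] ℝ)) (hA : TopologicalSpace.IsSeparable A) :
    Iccl A = closure A := by
  refine (aux_closed_of_thick fun ε hε => ?_).antisymm ?_
  · obtain ⟨As, h, hs⟩ := aux_cover A hA hε
    exact (Set.iInter₂_subset As h).trans (closure_minimal hs Metric.isClosed_cthickening)
  · refine Set.subset_iInter₂ fun As h => closure_mono ?_
    rw [h]
    exact Set.iUnion_mono fun n => aux_subset_wstar _

theorem aux_Iw (A : Set (E →L[ℝ] ℝ)) (hA : TopologicalSpace.IsSeparable A) :
    Iw A = @closure _ (weakTop (E →L[ℝ] ℝ)) A := by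
  refine Set.Subset.antisymm ?_ ?_
  · intro x hx
    by_contra hn
    obtain ⟨s, ε, hε, hs⟩ := aux_weak_sep A x hn
    set M : ℝ := ∑ G ∈ s, ‖G‖ with hM
    have hM0 : 0 ≤ M := Finset.sum_nonneg fun _ _ => norm_nonneg _
    set δ : ℝ := ε / (4 * (M + 1)) with hδ
    have hδ0 : 0 < δ := by positivity
    have hδM : 2 * δ * (M + 1) = ε / 2 := by
      rw [hδ]; field_simp; ring
    obtain ⟨As, h, hsub⟩ := aux_cover A hA hδ0
    have hx' := Set.mem_iInter₂.1 hx As h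
    have key : (⋃ n, wstarClosure (convexHull ℝ (As n))) ⊆ {y | ∃ G ∈ s, ε / 2 ≤ G y - G x} := by
      intro y hy
      have hy1 : y ∈ Metric.thickening (2 * δ) A :=
        Metric.cthickening_subset_thickening' (by positivity) (by linarith) A (hsub hy)
      obtain ⟨a, ha, hya⟩ := Metric.mem_thickening_iff.1 hy1
      obtain ⟨G, hG, hGa⟩ := hs a ha
      refine ⟨G, hG, ?_⟩
      have h1 : ‖G (a - y)‖ ≤ ‖G‖ * ‖a - y‖ := G.le_opNorm _
      have h2 : ‖G‖ ≤ M := Finset.single_le_sum (f := fun G => ‖G‖)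
        (fun _ _ => norm_nonneg _) hG
      have h3 : ‖a - y‖ ≤ 2 * δ := by rw [← dist_eq_norm, dist_comm]; exact hya.le
      have h4 : ‖G‖ * ‖a - y‖ ≤ M * (2 * δ) := by gcongr
      have h5 := le_abs_self (G (a - y))
      rw [Real.norm_eq_abs] at h1
      rw [map_sub] at h1 h5
      nlinarith
    have h3 := @closure_minimal _ (weakTop (E →L[ℝ] ℝ)) _ _ key (aux_weak_closed s x _)
    obtain ⟨G, -, hG⟩ := h3 hx'
    linarith
  · refine Set.subset_iInter₂ fun As h => @closure_mono _ (weakTop (E →L[ℝ] ℝ)) _ _ ?_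
    rw [h]
    exact Set.iUnion_mono fun n => aux_subset_wstar _

theorem aux_clIF (A : Set (E →L[ℝ] ℝ)) (hA : TopologicalSpace.IsSeparable A) :
    clIF A = @closure _ (weakTop (E →L[ℝ] ℝ)) A := by
  refine Set.Subset.antisymm ?_ ?_
  · intro x hx
    by_contra hn
    obtain ⟨s, ε, hε, hs⟩ := aux_weak_sep A x hn
    let As : Fin s.card → Set (E →L[ℝ] ℝ) := fun i =>
      A ∩ {y | ε ≤ (s.equivFin.symm i).1 y - (s.equivFin.symm i).1 x}
    have hAs : A = ⋃ i, As i := by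
      refine Set.Subset.antisymm (fun y hy => ?_) (Set.iUnion_subset fun i => Set.inter_subset_left)
      obtain ⟨G, hG, h⟩ := hs y hy
      refine Set.mem_iUnion.2 ⟨s.equivFin ⟨G, hG⟩, hy, ?_⟩
      simpa using h
    have h1 := Set.mem_iInter.1 (Set.mem_iInter₂.1 hx s.card As) hAs
    obtain ⟨i, hi⟩ := Set.mem_iUnion.1 h1
    rw [aux_Ienv _ (hA.mono Set.inter_subset_left)] at hi
    set G := (s.equivFin.symm i).1 with hG
    have h2 : closure (convexHull ℝ (As i)) ⊆ {y | ε + G x ≤ G y} := by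
      refine closure_minimal (convexHull_min ?_ ?_) ?_
      · rintro y ⟨-, hy⟩
        have : ε ≤ G y - G x := hy
        show ε + G x ≤ G y
        linarith
      · exact convex_halfSpace_ge G.toLinearMap.isLinear _
      · exact isClosed_le continuous_const G.continuous
    have h3 : ε + G x ≤ G x := h2 hi
    linarith
  · refine Set.subset_iInter₂ fun n As => Set.subset_iInter fun h => ?_
    rw [h, @closure_iUnion_of_finite _ (weakTop (E →L[ℝ] ℝ))]
    exact Set.iUnion_mono fun i => (aux_weak_sub _).trans (aux_Ienv_sup _)

end Aux

theorem stmt18 {X : Type*} [NormedAddCommGroup X] [NormedSpace ℝ X] [CompleteSpace X]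
    (A : Set (X →L[ℝ] ℝ)) (hA : TopologicalSpace.IsSeparable A) :
    Iccl A = closure A ∧
    Iw A = clIF A ∧ clIF A = @closure _ (weakTop (X →L[ℝ] ℝ)) A ∧
    Ienv A = closure (convexHull ℝ A) :=
  ⟨aux_Iccl A hA, (aux_Iw A hA).trans (aux_clIF A hA).symm, aux_clIF A hA, aux_Ienv A hA⟩
end

section
/- Let X be a real vector space, β : 𝒫(X) → 𝒫(X) a closure operator (β(∅)=∅, A ⊆ β(A), β(A∪B)=β(A)∪β(B)) and α : 𝒫(X) → 𝒫(X) a monotone map with α(∅)=∅, A ⊆ α(A) and β(A) ⊆ α(A) for all A ⊆ X. Define γ₁(A) = ⋂ { β(α(A₁) ∪ … ∪ α(A_n)) : n ∈ ℕ, A = A₁ ∪ … ∪ A_n } and γ₂(A) = ⋂ { β(⋃_{n∈ℕ} α(A_n)) : A = ⋃_{n∈ℕ} A_n }. Then: (a) if α(λA) = λ·α(A) and β(λA) = λ·β(A) for every scalar λ ∈ ℝ and every A ⊆ X, then γ₁(λA) = λ·γ₁(A) and γ₂(λA) = λ·γ₂(A) for every λ ∈ ℝ and A ⊆ X; (b)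 if α and β are translation invariant (α(x+A) = x+α(A) and β(x+A) = x+β(A) for all x ∈ X and A ⊆ X), then γ_j(A) + γ_j(B) ⊆ γ_j(γ_j(A+B)) for all A,B ⊆ X and j ∈ {1,2}, where A+B denotes the Minkowski sum. -/
open Pointwise

theorem mem_g1 {X : Type*} (α β : Set X → Set X) (A : Set X) (x : X) :
    x ∈ gamma1 α β A ↔ ∀ (n : ℕ) (As : Fin n → Set X), A = ⋃ i, As i → x ∈ β (⋃ i, α (As i)) := by
  simp only [gamma1, Set.mem_iInter]

theorem mem_g2 {X : Type*} (α β : Set X → Set X) (A : Set X) (x : X) :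
    x ∈ gamma2 α β A ↔ ∀ (As : ℕ → Set X), A = ⋃ i, As i → x ∈ β (⋃ i, α (As i)) := by
  simp only [gamma2, Set.mem_iInter]

theorem aux_pull {X ι : Type*} (α β : Set X → Set X) (e : X ≃ X)
    (ha : ∀ A, α (e.symm '' A) = e.symm '' α A) (hb : ∀ A, β (e.symm '' A) = e.symm '' β A)
    (A : Set X) (x : X) (As : ι → Set X) (hA : e '' A = ⋃ i, As i)
    (h : ∀ (Bs : ι → Set X), A = ⋃ i, Bs i → x ∈ β (⋃ i, α (Bs i))) :
    e x ∈ β (⋃ i, α (As i)) := by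
  have h1 := h (fun i => e.symm '' As i) (by
    rw [← Set.image_iUnion, ← hA, Equiv.symm_image_image])
  simp only [ha] at h1
  rw [← Set.image_iUnion, hb] at h1
  obtain ⟨y, hy, rfl⟩ := h1
  simpa using hy

theorem comm_symm {X : Type*} (α : Set X → Set X) (e : X ≃ X)
    (ha : ∀ A, α (e '' A) = e '' α A) (A : Set X) : α (e.symm '' A) = e.symm '' α A := by
  have := ha (e.symm '' A)
  rw [Equiv.image_symm_image] at this
  rw [this, Equiv.symm_image_image]

theorem eq_of_sub {X : Type*} (g : Set X → Set X) (e : X ≃ X)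
    (h1 : ∀ A, e '' g A ⊆ g (e '' A)) (h2 : ∀ A, e.symm '' g A ⊆ g (e.symm '' A)) (A : Set X) :
    g (e '' A) = e '' g A := by
  apply subset_antisymm _ (h1 A)
  have := h2 (e '' A)
  rw [Equiv.symm_image_image] at this
  intro x hx
  exact ⟨e.symm x, this ⟨x, hx, rfl⟩, by simp⟩

theorem g1_sub {X : Type*} (α β : Set X → Set X) (e : X ≃ X)
    (ha : ∀ A, α (e.symm '' A) = e.symm '' α A) (hb : ∀ A, β (e.symm '' A) = e.symm '' β A)
    (A : Set X) : e '' gamma1 α β A ⊆ gamma1 α β (e '' A) := by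
  rintro _ ⟨x, hx, rfl⟩
  rw [mem_g1] at hx ⊢
  exact fun n As h => aux_pull α β e ha hb A x As h (hx n)

theorem g2_sub {X : Type*} (α β : Set X → Set X) (e : X ≃ X)
    (ha : ∀ A, α (e.symm '' A) = e.symm '' α A) (hb : ∀ A, β (e.symm '' A) = e.symm '' β A)
    (A : Set X) : e '' gamma2 α β A ⊆ gamma2 α β (e '' A) := by
  rintro _ ⟨x, hx, rfl⟩
  rw [mem_g2] at hx ⊢
  exact fun As h => aux_pull α β e ha hb A x As h hx

theorem g1_equiv {X : Type*} (α β : Set X → Set X) (e : X ≃ X)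
    (ha : ∀ A, α (e '' A) = e '' α A) (hb : ∀ A, β (e '' A) = e '' β A)
    (A : Set X) : gamma1 α β (e '' A) = e '' gamma1 α β A :=
  eq_of_sub _ e (g1_sub α β e (comm_symm α e ha) (comm_symm β e hb))
    (g1_sub α β e.symm ha hb) A

theorem g2_equiv {X : Type*} (α β : Set X → Set X) (e : X ≃ X)
    (ha : ∀ A, α (e '' A) = e '' α A) (hb : ∀ A, β (e '' A) = e '' β A)
    (A : Set X) : gamma2 α β (e '' A) = e '' gamma2 α β A :=
  eq_of_sub _ e (g2_sub α β e (comm_symm α e ha) (comm_symm β e hb))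
    (g2_sub α β e.symm ha hb) A

theorem aux_mono_s19 {X ι : Type*} (α β : Set X → Set X)
    (ha : ∀ A B, A ⊆ B → α A ⊆ α B) (hb : ∀ A B, A ⊆ B → β A ⊆ β B)
    (A B : Set X) (hAB : A ⊆ B) (x : X) (As : ι → Set X) (hB : B = ⋃ i, As i)
    (h : ∀ (Bs : ι → Set X), A = ⋃ i, Bs i → x ∈ β (⋃ i, α (Bs i))) :
    x ∈ β (⋃ i, α (As i)) := by
  refine hb _ _ ?_ (h (fun i => A ∩ As i) ?_)
  · exact Set.iUnion_mono fun i => ha _ _ Set.inter_subset_right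
  · rw [← Set.inter_iUnion, ← hB, Set.inter_eq_left.2 hAB]

theorem smul_part {X : Type*} [AddCommGroup X] [Module ℝ X] (α β g : Set X → Set X)
    (hα : ∀ (lam : ℝ) (A : Set X), α (lam • A) = lam • α A)
    (hβ : ∀ (lam : ℝ) (A : Set X), β (lam • A) = lam • β A)
    (hα1 : ∀ A : Set X, A ⊆ α A) (hβ1 : ∀ A : Set X, A ⊆ β A)
    (hα0 : α ∅ = ∅) (hβ0 : β ∅ = ∅)
    (hg1 : ∀ A, A ⊆ g A) (hg : ∀ A, g A ⊆ β (α A))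
    (he : ∀ e : X ≃ X, (∀ A, α (e '' A) = e '' α A) → (∀ A, β (e '' A) = e '' β A) →
      ∀ A, g (e '' A) = e '' g A) (lam : ℝ) (A : Set X) : g (lam • A) = lam • g A := by
  by_cases hl : lam = 0
  · subst hl
    rcases A.eq_empty_or_nonempty with rfl | hA
    · have : g ∅ = ∅ := by
        apply Set.subset_empty_iff.1
        simpa [hα0, hβ0] using hg ∅
      simp [this]
    · rw [Set.zero_smul_set hA, Set.zero_smul_set (hA.mono (hg1 A))]
      apply subset_antisymm _ (hg1 _)
      have hα' := hα 0 A
      rw [Set.zero_smul_set hA, Set.zero_smul_set (hA.mono (hα1 A))] at hα'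
      have hβ' := hβ 0 A
      rw [Set.zero_smul_set hA, Set.zero_smul_set (hA.mono (hβ1 A))] at hβ'
      have := hg (0 : Set X)
      rwa [hα', hβ'] at this
  · exact he (MulAction.toPerm (Units.mk0 lam hl)) (hα lam) (hβ lam) A

theorem add_part {X : Type*} [AddCommGroup X] (g : Set X → Set X)
    (hm : ∀ A B, A ⊆ B → g A ⊆ g B) (ht : ∀ (x : X) A, g (x +ᵥ A) = x +ᵥ g A)
    (A B : Set X) : g A + g B ⊆ g (g (A + B)) := by
  rintro _ ⟨a, ha, b, hb, rfl⟩
  have h : b +ᵥ A ⊆ g (A + B) := by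
    rintro _ ⟨a', ha', rfl⟩
    have h2 : a' +ᵥ B ⊆ A + B := by
      rintro _ ⟨b', hb', rfl⟩
      exact Set.add_mem_add ha' hb'
    have h3 := hm _ _ h2
    rw [ht] at h3
    have := h3 (Set.vadd_mem_vadd_set (a := a') hb)
    simpa [add_comm] using this
  have h3 := hm _ _ h
  rw [ht] at h3
  have := h3 (Set.vadd_mem_vadd_set (a := b) ha)
  simpa [add_comm] using this

theorem stmt19 {X : Type*} [AddCommGroup X] [Module ℝ X] (α β : Set X → Set X)
    (hβ0 : β ∅ = ∅) (hβ1 : ∀ A : Set X, A ⊆ β A)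
    (hβ2 : ∀ A B : Set X, β (A ∪ B) = β A ∪ β B)
    (hαmono : ∀ A B : Set X, A ⊆ B → α A ⊆ α B)
    (hα0 : α ∅ = ∅) (hα1 : ∀ A : Set X, A ⊆ α A)
    (hβα : ∀ A : Set X, β A ⊆ α A) :
    (((∀ (lam : ℝ) (A : Set X), α (lam • A) = lam • α A) ∧
        (∀ (lam : ℝ) (A : Set X), β (lam • A) = lam • β A)) →
      (∀ (lam : ℝ) (A : Set X), gamma1 α β (lam • A) = lam • gamma1 α β A) ∧
      (∀ (lam : ℝ) (A : Set X), gamma2 α β (lam • A) = lam • gamma2 α β A)) ∧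
    (((∀ (x : X) (A : Set X), α (x +ᵥ A) = x +ᵥ α A) ∧
        (∀ (x : X) (A : Set X), β (x +ᵥ A) = x +ᵥ β A)) →
      (∀ A B : Set X,
        gamma1 α β A + gamma1 α β B ⊆ gamma1 α β (gamma1 α β (A + B))) ∧
      (∀ A B : Set X,
        gamma2 α β A + gamma2 α β B ⊆ gamma2 α β (gamma2 α β (A + B)))) := by
  have hβm : ∀ A B : Set X, A ⊆ B → β A ⊆ β B := by
    intro A B h
    rw [← Set.union_eq_self_of_subset_left h, hβ2]
    exact Set.subset_union_left
  have key : ∀ {ι : Type} (A : Set X) (As : ι → Set X), A = ⋃ i, As i →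
      A ⊆ β (⋃ i, α (As i)) := by
    intro ι A As h
    rw [h]
    exact (Set.iUnion_mono fun i => hα1 _).trans (hβ1 _)
  refine ⟨fun ⟨ha, hb⟩ => ⟨?_, ?_⟩, fun ⟨ha, hb⟩ => ⟨?_, ?_⟩⟩
  · refine smul_part α β _ ha hb hα1 hβ1 hα0 hβ0 ?_ ?_ (g1_equiv α β)
    · exact fun A x hx => (mem_g1 ..).2 fun n As h => key A As h hx
    · intro A x hx
      have := (mem_g1 ..).1 hx 1 (fun _ => A) (Set.iUnion_const A).symm
      rwa [Set.iUnion_const] at this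
  · refine smul_part α β _ ha hb hα1 hβ1 hα0 hβ0 ?_ ?_ (g2_equiv α β)
    · exact fun A x hx => (mem_g2 ..).2 fun As h => key A As h hx
    · intro A x hx
      have := (mem_g2 ..).1 hx (fun _ => A) (Set.iUnion_const A).symm
      rwa [Set.iUnion_const] at this
  · refine add_part _ ?_ fun x => g1_equiv α β (AddAction.toPerm x) (ha x) (hb x)
    exact fun A B h x hx => (mem_g1 ..).2 fun n As hB =>
      aux_mono_s19 α β hαmono hβm A B h x As hB ((mem_g1 ..).1 hx n)
  · refine add_part _ ?_ fun x => g2_equiv α β (AddAction.toPerm x) (ha x) (hb x)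
    exact fun A B h x hx => (mem_g2 ..).2 fun As hB =>
      aux_mono_s19 α β hαmono hβm A B h x As hB ((mem_g2 ..).1 hx)
end
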